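/- There exist constants γ ∈ (0,1] and N, depending only on δ, K, and d, such that for any L ∈ 𝔏_{δ,K} with coefficients independent of t and any u ∈ W²_{d,loc}(B₁) ∩ C(B̄₁) one has ∫_{B₁} |D²u|^γ dx ≤ N (∫_{B₁} |Lu|^d dx)^{γ/d} + N sup_{∂B₁} |u|^γ. -/

import Mathlib

open MeasureTheory ENNReal Set

noncomputable section

/-- The Frobenius norm of a matrix, used as `|D²u|`. -/
def frobNorm {d : ℕ} (m : Matrix (Fin d) (Fin d) ℝ) : ℝ :=
  Real.sqrt (∑ i, ∑ j, (m i j) ^ 2)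

/-! ### Linear algebra -/

/-- Uniform ellipticity of a matrix. -/
def EllMat {d : ℕ} (δ : ℝ) (a : Matrix (Fin d) (Fin d) ℝ) : Prop :=
  a.IsSymm ∧ ∀ ξ : EuclideanSpace ℝ (Fin d),
    δ * ‖ξ‖ ^ 2 ≤ ∑ i, ∑ j, a i j * ξ i * ξ j ∧
    ∑ i, ∑ j, a i j * ξ i * ξ j ≤ δ⁻¹ * ‖ξ‖ ^ 2

theorem posSemidef_of_quad {d : ℕ} {A : Matrix (Fin d) (Fin d) ℝ} (hs : A.IsSymm)
    (h : ∀ ξ : EuclideanSpace ℝ (Fin d), 0 ≤ ∑ i, ∑ j, A i j * ξ i * ξ j) : A.PosSemidef := by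
  rw [Matrix.posSemidef_iff_dotProduct_mulVec]
  refine ⟨by rw [Matrix.IsHermitian, Matrix.conjTranspose_eq_transpose_of_trivial]; exact hs, fun x => ?_⟩
  have := h (WithLp.toLp 2 x)
  simp only [dotProduct, Matrix.mulVec, star_trivial, Finset.mul_sum] at this ⊢
  refine this.trans_eq ?_
  refine Finset.sum_congr rfl fun i _ => Finset.sum_congr rfl fun j _ => ?_
  ring

theorem quad_of_posSemidef {d : ℕ} {A : Matrix (Fin d) (Fin d) ℝ} (hA : A.PosSemidef)
    (x : Fin d → ℝ) : 0 ≤ ∑ i, ∑ j, A i j * x i * x j := by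
  have := hA.dotProduct_mulVec_nonneg x
  simp only [dotProduct, Matrix.mulVec, star_trivial, Finset.mul_sum] at this
  refine this.trans_eq ?_
  refine Finset.sum_congr rfl fun i _ => Finset.sum_congr rfl fun j _ => ?_
  ring

theorem ell_trace_le {d : ℕ} {δ : ℝ} {a A : Matrix (Fin d) (Fin d) ℝ} (ha : EllMat δ a)
    (hA : A.PosSemidef) : δ * ∑ i, A i i ≤ ∑ i, ∑ j, a i j * A i j := by
  have h1 : (a - δ • (1 : Matrix (Fin d) (Fin d) ℝ)).PosSemidef := by
    apply posSemidef_of_quad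
    · have := ha.1
      simp [Matrix.IsSymm, Matrix.transpose_sub, Matrix.transpose_smul] at this ⊢
      exact this
    · intro ξ
      have h := (ha.2 ξ).1
      rw [EuclideanSpace.norm_sq_eq] at h
      simp only [Matrix.sub_apply, Matrix.smul_apply, sub_mul, Finset.sum_sub_distrib,
        Matrix.one_apply, smul_eq_mul, mul_ite, ite_mul, mul_one, mul_zero, zero_mul,
        Finset.sum_ite_eq, Finset.mem_univ, if_true]
      simp only [Real.norm_eq_abs, sq_abs, Finset.mul_sum] at h
      have h2 : ∑ i, δ * ξ i * ξ i = ∑ i, δ * ξ i ^ 2 :=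
        Finset.sum_congr rfl fun i _ => by ring
      linarith
  have h2 := quad_of_posSemidef (h1.hadamard hA) (fun _ => 1)
  simp only [Matrix.hadamard_apply, Matrix.sub_apply, Matrix.smul_apply, sub_mul,
    Finset.sum_sub_distrib, Matrix.one_apply, smul_eq_mul, mul_ite, ite_mul, mul_one, mul_zero,
    zero_mul, Finset.sum_ite_eq, Finset.mem_univ, if_true] at h2
  rw [Finset.mul_sum]
  linarith

theorem ell_trace_diag {d : ℕ} {δ : ℝ} {a : Matrix (Fin d) (Fin d) ℝ} (ha : EllMat δ a) :
    ∑ i, a i i ≤ d * δ⁻¹ := by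
  have h : ∀ i ∈ (Finset.univ : Finset (Fin d)), a i i ≤ δ⁻¹ := by
    intro i _
    have := (ha.2 (EuclideanSpace.single i 1)).2
    simpa using this
  simpa using Finset.sum_le_card_nsmul _ _ _ h

theorem det_le_trace_pow {d : ℕ} {A : Matrix (Fin d) (Fin d) ℝ} (hA : A.PosSemidef) :
    |A.det| ≤ (∑ i, A i i) ^ d := by
  rw [abs_of_nonneg hA.det_nonneg, hA.isHermitian.det_eq_prod_eigenvalues]
  have h1 : ∑ i, A i i = ∑ i, hA.1.eigenvalues i := by
    have := hA.isHermitian.trace_eq_sum_eigenvalues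
    simpa [Matrix.trace] using this
  rw [h1]
  have : ∀ i ∈ (Finset.univ : Finset (Fin d)), hA.1.eigenvalues i ≤ ∑ i, hA.1.eigenvalues i :=
    fun i hi => Finset.single_le_sum (fun j _ => hA.eigenvalues_nonneg j) hi
  have h2 := Finset.prod_le_prod (fun i _ => hA.eigenvalues_nonneg i) this
  simpa using h2

theorem entry_le_trace {d : ℕ} {A : Matrix (Fin d) (Fin d) ℝ} (hA : A.PosSemidef) (i j : Fin d) :
    |A i j| ≤ ∑ k, A k k := by
  have hd : ∀ k, 0 ≤ A k k := fun k => hA.diag_nonneg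
  by_cases hij : i = j
  · subst hij
    rw [abs_of_nonneg (hd i)]
    exact Finset.single_le_sum (fun k _ => hd k) (Finset.mem_univ i)
  have hsum : A i i + A j j ≤ ∑ k, A k k := by
    rw [← Finset.sum_pair (f := fun k => A k k) hij]
    exact Finset.sum_le_sum_of_subset_of_nonneg (Finset.subset_univ _) (fun k _ _ => hd k)
  have hsym : A j i = A i j := by
    have := hA.isHermitian.apply i j
    simpa using this
  have key : ∀ s : ℝ, s ^ 2 = 1 → 0 ≤ A i i + A j j + 2 * s * A i j := by
    intro s hs
    have := quad_of_posSemidef hA (Pi.single i 1 + Pi.single j s)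
    simp only [Pi.add_apply, Pi.single_apply, mul_add, add_mul, mul_ite, ite_mul, mul_one, mul_zero,
      zero_mul, Finset.sum_add_distrib, Finset.sum_ite_eq', Finset.mem_univ, if_true] at this
    simp [hsym] at this
    have h3 : A j j * s * s = A j j := by rw [mul_assoc, ← sq, hs, mul_one]
    linarith
  have k1 := key 1 (by norm_num)
  have k2 := key (-1) (by norm_num)
  rw [abs_le]
  constructor <;> linarith [hd i, hd j]

theorem frobNorm_le {d : ℕ} {A : Matrix (Fin d) (Fin d) ℝ} {C : ℝ} (hC : 0 ≤ C)
    (h : ∀ i j, |A i j| ≤ C) : frobNorm A ≤ d * C := by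
  unfold frobNorm
  apply Real.sqrt_le_iff.2 ⟨by positivity, ?_⟩
  calc ∑ i, ∑ j, A i j ^ 2 ≤ ∑ i : Fin d, ∑ j : Fin d, C ^ 2 := by
        refine Finset.sum_le_sum fun i _ => Finset.sum_le_sum fun j _ => ?_
        exact sq_le_sq' (abs_le.1 (h i j)).1 (abs_le.1 (h i j)).2
    _ = (d * C) ^ 2 := by simp; ring

/-- The matrix of a continuous linear map. -/
def hmat {d : ℕ} (H : EuclideanSpace ℝ (Fin d) →L[ℝ] EuclideanSpace ℝ (Fin d)) :
    Matrix (Fin d) (Fin d) ℝ := fun i j => H (EuclideanSpace.single j 1) i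

theorem hmat_det {d : ℕ} (H : EuclideanSpace ℝ (Fin d) →L[ℝ] EuclideanSpace ℝ (Fin d)) :
    (hmat H).det = H.det := by
  have : hmat H = LinearMap.toMatrix (EuclideanSpace.basisFun (Fin d) ℝ).toBasis
      (EuclideanSpace.basisFun (Fin d) ℝ).toBasis (H : _ →ₗ[ℝ] _) := by
    ext i j
    simp [hmat, LinearMap.toMatrix_apply]
  rw [this, LinearMap.det_toMatrix]

theorem hmat_quad {d : ℕ} (H : EuclideanSpace ℝ (Fin d) →L[ℝ] EuclideanSpace ℝ (Fin d))
    (ξ η : EuclideanSpace ℝ (Fin d)) :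
    ∑ i, ∑ j, hmat H i j * ξ i * η j = inner ℝ (H η) ξ := by
  have h : η = ∑ j, η j • EuclideanSpace.single j (1 : ℝ) := by
    have := (EuclideanSpace.basisFun (Fin d) ℝ).sum_repr η
    simpa using this.symm
  conv_rhs => rw [h]
  simp only [map_sum, map_smul, PiLp.inner_apply, RCLike.inner_apply, conj_trivial]
  simp only [WithLp.ofLp_sum, Finset.sum_apply, WithLp.ofLp_smul, Pi.smul_apply, smul_eq_mul,
    Finset.mul_sum]
  refine Finset.sum_congr rfl fun i _ => Finset.sum_congr rfl fun j _ => ?_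
  simp [hmat]; ring

theorem hmat_posSemidef {d : ℕ} {H : EuclideanSpace ℝ (Fin d) →L[ℝ] EuclideanSpace ℝ (Fin d)}
    (hs : ∀ v w, inner ℝ (H v) w = inner ℝ (H w) v) (hp : ∀ v, 0 ≤ inner ℝ (H v) v) :
    (hmat H).PosSemidef := by
  apply posSemidef_of_quad
  · ext i j
    have := hs (EuclideanSpace.single i 1) (EuclideanSpace.single j 1)
    simpa [EuclideanSpace.inner_single_right, hmat] using this
  · intro ξ
    rw [hmat_quad]
    exact hp ξ

/-- Area-type inequality. -/
theorem area_le {d : ℕ} {G : EuclideanSpace ℝ (Fin d) → EuclideanSpace ℝ (Fin d)}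
    {H : EuclideanSpace ℝ (Fin d) → EuclideanSpace ℝ (Fin d) →L[ℝ] EuclideanSpace ℝ (Fin d)}
    {Γ V : Set (EuclideanSpace ℝ (Fin d))} (hΓ : MeasurableSet Γ)
    (hG : ∀ x ∈ Γ, HasFDerivAt G (H x) x) (hV : V ⊆ G '' Γ)
    (hpos : ∀ x ∈ Γ, (hmat (H x)).PosSemidef) {h : EuclideanSpace ℝ (Fin d) → ℝ≥0∞}
    (hh : ∀ x ∈ Γ, ENNReal.ofReal ((∑ i, hmat (H x) i i) ^ d) ≤ h x) :
    volume V ≤ ∫⁻ x in Γ, h x := by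
  refine (measure_mono hV).trans ((addHaar_image_le_lintegral_abs_det_fderiv volume hΓ
    fun x hx => (hG x hx).hasFDerivWithinAt).trans ?_)
  refine setLIntegral_mono' hΓ fun x hx => ?_
  refine le_trans (ENNReal.ofReal_le_ofReal ?_) (hh x hx)
  rw [← hmat_det]
  exact det_le_trace_pow (hpos x hx)

/-! ### Twice differentiable functions and contact points -/

/-- `g` and `H` are the gradient and the Hessian of `u`. -/
structure C2Data {d : ℕ} (u : EuclideanSpace ℝ (Fin d) → ℝ)
    (g : EuclideanSpace ℝ (Fin d) → EuclideanSpace ℝ (Fin d))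
    (H : EuclideanSpace ℝ (Fin d) → EuclideanSpace ℝ (Fin d) →L[ℝ] EuclideanSpace ℝ (Fin d)) :
    Prop where
  hu : ∀ x, HasFDerivAt u (innerSL ℝ (g x)) x
  hg : ∀ x, HasFDerivAt g (H x) x
  symm : ∀ x v w, inner ℝ (H x v) w = inner ℝ (H x w) v

theorem C2Data.continuous {d : ℕ} {u : EuclideanSpace ℝ (Fin d) → ℝ}
    {g : EuclideanSpace ℝ (Fin d) → EuclideanSpace ℝ (Fin d)}
    {H : EuclideanSpace ℝ (Fin d) → EuclideanSpace ℝ (Fin d) →L[ℝ] EuclideanSpace ℝ (Fin d)}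
    (h : C2Data u g H) : Continuous u :=
  continuous_iff_continuousAt.2 fun x => (h.hu x).continuousAt

theorem C2Data.continuous_grad {d : ℕ} {u : EuclideanSpace ℝ (Fin d) → ℝ}
    {g : EuclideanSpace ℝ (Fin d) → EuclideanSpace ℝ (Fin d)}
    {H : EuclideanSpace ℝ (Fin d) → EuclideanSpace ℝ (Fin d) →L[ℝ] EuclideanSpace ℝ (Fin d)}
    (h : C2Data u g H) : Continuous g :=
  continuous_iff_continuousAt.2 fun x => (h.hg x).continuousAt

theorem C2Data.neg {d : ℕ} {u : EuclideanSpace ℝ (Fin d) → ℝ}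
    {g : EuclideanSpace ℝ (Fin d) → EuclideanSpace ℝ (Fin d)}
    {H : EuclideanSpace ℝ (Fin d) → EuclideanSpace ℝ (Fin d) →L[ℝ] EuclideanSpace ℝ (Fin d)}
    (h : C2Data u g H) : C2Data (fun x => - u x) (fun x => - g x) (fun x => - H x) where
  hu x := by simpa using (h.hu x).fun_neg
  hg x := (h.hg x).neg
  symm x v w := by simpa using h.symm x v w

theorem C2Data.const_mul {d : ℕ} {u : EuclideanSpace ℝ (Fin d) → ℝ}
    {g : EuclideanSpace ℝ (Fin d) → EuclideanSpace ℝ (Fin d)}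
    {H : EuclideanSpace ℝ (Fin d) → EuclideanSpace ℝ (Fin d) →L[ℝ] EuclideanSpace ℝ (Fin d)}
    (h : C2Data u g H) (c : ℝ) :
    C2Data (fun x => c * u x) (fun x => c • g x) (fun x => c • H x) where
  hu x := by simpa using (h.hu x).const_mul c
  hg x := (h.hg x).const_smul c
  symm x v w := by simp [inner_smul_left, h.symm x v w]

theorem C2Data.contact {d : ℕ} {u : EuclideanSpace ℝ (Fin d) → ℝ}
    {g : EuclideanSpace ℝ (Fin d) → EuclideanSpace ℝ (Fin d)}
    {H : EuclideanSpace ℝ (Fin d) → EuclideanSpace ℝ (Fin d) →L[ℝ] EuclideanSpace ℝ (Fin d)}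
    (h : C2Data u g H) {S : Set (EuclideanSpace ℝ (Fin d))} {x p : EuclideanSpace ℝ (Fin d)}
    (hS : S ∈ nhds x) (hx : ∀ z ∈ S, u x + inner ℝ p (z - x) ≤ u z) :
    g x = p ∧ ∀ v, 0 ≤ inner ℝ (H x v) v := by
  have line : ∀ v : EuclideanSpace ℝ (Fin d), ∀ s : ℝ,
      HasDerivAt (fun s : ℝ => x + s • v) v s := by
    intro v s
    simpa using ((hasDerivAt_id s).smul_const v).const_add x
  have d1 : ∀ v : EuclideanSpace ℝ (Fin d), ∀ s : ℝ,
      HasDerivAt (fun s : ℝ => u (x + s • v) - s * inner ℝ p v)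
        (inner ℝ (g (x + s • v)) v - inner ℝ p v) s := by
    intro v s
    have h1 := (h.hu (x + s • v)).comp_hasDerivAt s (line v s)
    have h2 := (hasDerivAt_id s).mul_const (inner ℝ p v)
    simpa [Function.comp_def] using h1.fun_sub h2
  have lmin : ∀ v : EuclideanSpace ℝ (Fin d),
      IsLocalMin (fun s : ℝ => u (x + s • v) - s * inner ℝ p v) 0 := by
    intro v
    have hc : ContinuousAt (fun s : ℝ => x + s • v) 0 := (line v 0).continuousAt
    have : ∀ᶠ s in nhds (0:ℝ), x + s • v ∈ S := hc.eventually_mem (by simpa using hS)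
    filter_upwards [this] with s hs
    have := hx _ hs
    simp [inner_smul_right] at this ⊢
    linarith
  have hgp : g x = p := by
    have h0 : ∀ v, inner ℝ (g x - p) v = 0 := by
      intro v
      have := (lmin v).hasDerivAt_eq_zero (d1 v 0)
      simpa [inner_sub_left] using this
    have := h0 (g x - p)
    rw [inner_self_eq_zero] at this
    exact sub_eq_zero.1 this
  refine ⟨hgp, fun v => ?_⟩
  by_contra hneg
  push Not at hneg
  set θ := (fun s : ℝ => u (x + s • v) - s * inner ℝ p v) with hθ
  have hd1 : deriv θ = fun s => inner ℝ (g (x + s • v)) v - inner ℝ p v :=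
    funext fun s => (d1 v s).deriv
  have hd2 : deriv (deriv θ) 0 = inner ℝ (H x v) v := by
    rw [hd1]
    have h1 : HasDerivAt (fun s : ℝ => g (x + s • v)) (H (x + (0:ℝ) • v) v) 0 :=
      (h.hg (x + (0:ℝ) • v)).comp_hasDerivAt (0:ℝ) (line v 0)
    have h2 := (h1.inner ℝ (hasDerivAt_const (0:ℝ) v)).sub_const (inner ℝ p v)
    simpa using h2.deriv
  have hmax : IsLocalMax θ 0 := by
    apply isLocalMax_of_deriv_deriv_neg (by rw [hd2]; exact hneg)
    · rw [hd1]; simp [hgp]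
    · exact (d1 v 0).continuousAt
  have hconst : θ =ᶠ[nhds 0] fun _ => θ 0 := by
    filter_upwards [hmax, lmin v] with s h1 h2
    exact le_antisymm h1 h2
  have : deriv (deriv θ) 0 = 0 := by
    have h1 : deriv θ =ᶠ[nhds 0] fun _ => 0 := by
      have := hconst.deriv
      simpa using this
    rw [h1.deriv_eq]; simp
  rw [hd2] at this
  linarith

theorem C2Data.contact_psd {d : ℕ} {u : EuclideanSpace ℝ (Fin d) → ℝ}
    {g : EuclideanSpace ℝ (Fin d) → EuclideanSpace ℝ (Fin d)}
    {H : EuclideanSpace ℝ (Fin d) → EuclideanSpace ℝ (Fin d) →L[ℝ] EuclideanSpace ℝ (Fin d)}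
    (h : C2Data u g H) {S : Set (EuclideanSpace ℝ (Fin d))} {x p : EuclideanSpace ℝ (Fin d)}
    (hS : S ∈ nhds x) (hx : ∀ z ∈ S, u x + inner ℝ p (z - x) ≤ u z) :
    (hmat (H x)).PosSemidef :=
  hmat_posSemidef (h.symm x) (h.contact hS hx).2

/-! ### The maximum principle -/

theorem vol_ball {d : ℕ} (x : EuclideanSpace ℝ (Fin d)) {r : ℝ} (hr : 0 < r) :
    volume (Metric.ball x r) =
      ENNReal.ofReal (r ^ d) * volume (Metric.ball (0 : EuclideanSpace ℝ (Fin d)) 1) := by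
  have := Measure.addHaar_ball_of_pos (volume : Measure (EuclideanSpace ℝ (Fin d))) x hr
  simpa using this

theorem vol_closedBall {d : ℕ} (x : EuclideanSpace ℝ (Fin d)) {r : ℝ} (hr : 0 ≤ r) :
    volume (Metric.closedBall x r) =
      ENNReal.ofReal (r ^ d) * volume (Metric.ball (0 : EuclideanSpace ℝ (Fin d)) 1) := by
  have := Measure.addHaar_closedBall (volume : Measure (EuclideanSpace ℝ (Fin d))) x hr
  simpa using this

theorem isClosed_forall_mem {X Y : Type*} [TopologicalSpace X] {S : Set Y} {P : Y → X → Prop}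
    (h : ∀ z ∈ S, IsClosed {x | P z x}) : IsClosed {x | ∀ z ∈ S, P z x} := by
  have : {x | ∀ z ∈ S, P z x} = ⋂ z ∈ S, {x | P z x} := by ext x; simp
  rw [this]
  exact isClosed_biInter h

theorem omega_pos (d : ℕ) : 0 < volume (Metric.ball (0 : EuclideanSpace ℝ (Fin d)) 1) :=
  Metric.measure_ball_pos _ _ one_pos

theorem omega_lt_top (d : ℕ) : volume (Metric.ball (0 : EuclideanSpace ℝ (Fin d)) 1) < ∞ :=
  measure_ball_lt_top

theorem add_pow_le_two_pow {x y : ℝ} (hx : 0 ≤ x) (hy : 0 ≤ y) (d : ℕ) :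
    (x + y) ^ d ≤ 2 ^ d * (x ^ d + y ^ d) := by
  refine (add_pow_le hx hy d).trans ?_
  have : (2:ℝ) ^ (d - 1) ≤ 2 ^ d := pow_le_pow_right₀ (by norm_num) (Nat.sub_le _ _)
  gcongr

theorem vol_shell {d : ℕ} (hd : 1 ≤ d) {q : ℝ} (hq : 0 < q) :
    ENNReal.ofReal (q ^ d) * volume (Metric.ball (0 : EuclideanSpace ℝ (Fin d)) 1) ≤
      volume (Metric.ball (0 : EuclideanSpace ℝ (Fin d)) (2 * q) \ Metric.ball 0 q) := by
  rw [measure_sdiff (Metric.ball_subset_ball (by linarith))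
    Metric.isOpen_ball.nullMeasurableSet measure_ball_lt_top.ne, vol_ball _ hq,
    vol_ball _ (by linarith : (0:ℝ) < 2 * q)]
  have h1 : (2:ℝ) * q ^ d ≤ (2 * q) ^ d := by
    rw [mul_pow]
    gcongr
    calc (2:ℝ) = 2 ^ 1 := by norm_num
      _ ≤ 2 ^ d := pow_le_pow_right₀ (by norm_num) hd
  rw [← ENNReal.sub_mul (fun _ _ => (omega_lt_top d).ne), ← ENNReal.ofReal_sub _ (by positivity)]
  gcongr
  linarith

theorem abp_one_sided (d : ℕ) (hd : 1 ≤ d) (δ K : ℝ) (hδ : 0 < δ) (hK : 0 ≤ K) :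
    ∃ C : ℝ, 0 < C ∧ ∀ (R : ℝ), 0 < R → R ≤ 1 →
      ∀ (u : EuclideanSpace ℝ (Fin d) → ℝ)
        (g : EuclideanSpace ℝ (Fin d) → EuclideanSpace ℝ (Fin d))
        (H : EuclideanSpace ℝ (Fin d) → EuclideanSpace ℝ (Fin d) →L[ℝ] EuclideanSpace ℝ (Fin d))
        (a : EuclideanSpace ℝ (Fin d) → Matrix (Fin d) (Fin d) ℝ)
        (f : EuclideanSpace ℝ (Fin d) → ℝ) (m F : ℝ),
        C2Data u g H → (∀ x, EllMat δ (a x)) → Measurable f → (∀ x, 0 ≤ f x) →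
        (∀ x ∈ Metric.ball (0 : EuclideanSpace ℝ (Fin d)) R, 0 ≤ u x →
          - ∑ i, ∑ j, a x i j * hmat (H x) i j ≤ f x + K * ‖g x‖) →
        0 ≤ m → (∀ x ∈ Metric.sphere (0 : EuclideanSpace ℝ (Fin d)) R, u x ≤ m) → 0 < F →
        ∫⁻ x in Metric.ball (0 : EuclideanSpace ℝ (Fin d)) R, ENNReal.ofReal (f x) ^ d ≤
          ENNReal.ofReal (F ^ d) →
        ∀ x ∈ Metric.closedBall (0 : EuclideanSpace ℝ (Fin d)) R, u x ≤ m + C * F := by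
  set ω := volume (Metric.ball (0 : EuclideanSpace ℝ (Fin d)) 1) with hω
  set Q : ℝ≥0∞ := ENNReal.ofReal (δ⁻¹ ^ d * 2 ^ d) + ENNReal.ofReal (δ⁻¹ ^ d * 4 ^ d * K ^ d) * ω
    with hQ
  have hQtop : Q ≠ ∞ :=
    ENNReal.add_ne_top.2 ⟨ofReal_ne_top, ENNReal.mul_ne_top ofReal_ne_top (omega_lt_top d).ne⟩
  obtain ⟨n, hn⟩ := ENNReal.exists_nat_mul_gt (omega_pos d).ne' hQtop
  refine ⟨2 ^ (n + 1), by positivity, ?_⟩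
  intro R hR0 hR1 u g H a f m F hc ha hf hf0 hsub hm hbd hF hIntg xs hxs
  by_contra hcon
  push Not at hcon
  set Γ : Set (EuclideanSpace ℝ (Fin d)) := {x | x ∈ Metric.ball 0 R ∧ 0 ≤ u x ∧
    ∀ z ∈ Metric.closedBall (0 : EuclideanSpace ℝ (Fin d)) R, u z ≤ u x + inner ℝ (g x) (z - x)}
    with hΓ
  have hu := hc.continuous
  have hg := hc.continuous_grad
  have hΓm : MeasurableSet Γ := by
    refine Metric.isOpen_ball.measurableSet.inter (IsClosed.measurableSet ?_)
    refine (isClosed_le continuous_const hu).inter ?_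
    refine isClosed_forall_mem fun z _ => ?_
    exact isClosed_le continuous_const (hu.add (hg.inner (continuous_const.sub continuous_id)))
  have hΓimg : ∀ p : EuclideanSpace ℝ (Fin d), ‖p‖ < 2 ^ n * F → ∃ x ∈ Γ, g x = p := by
    intro p hp
    obtain ⟨x, hxB, hxmax⟩ := (isCompact_closedBall (0 : EuclideanSpace ℝ (Fin d)) R).exists_isMaxOn
      ⟨xs, hxs⟩ (f := fun z => u z - inner ℝ p z) (by fun_prop)
    have hmax : ∀ z ∈ Metric.closedBall (0 : EuclideanSpace ℝ (Fin d)) R,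
        u z - inner ℝ p z ≤ u x - inner ℝ p x := fun z hz => hxmax hz
    have hux : m < u x := by
      have h1 := hmax xs hxs
      have h2 : inner ℝ p xs - inner ℝ p x ≤ ‖p‖ * 2 := by
        rw [← inner_sub_right]
        refine (real_inner_le_norm _ _).trans ?_
        gcongr
        refine (norm_sub_le _ _).trans ?_
        simp only [mem_closedBall_zero_iff] at hxs hxB
        linarith
      have h3 : (2:ℝ) ^ (n+1) * F = 2 ^ n * F * 2 := by ring
      nlinarith
    have hxball : x ∈ Metric.ball (0 : EuclideanSpace ℝ (Fin d)) R := by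
      rcases (Metric.mem_closedBall.1 hxB).lt_or_eq with h | h
      · exact h
      · exact absurd (hbd x h) (not_le.2 hux)
    have hcontact := hc.neg.contact (S := Metric.closedBall 0 R) (x := x) (p := -p)
      (Filter.mem_of_superset (Metric.isOpen_ball.mem_nhds hxball) Metric.ball_subset_closedBall)
      (by
        intro z hz
        have := hmax z hz
        simp only [inner_neg_left, inner_sub_right]
        linarith)
    have hgx : g x = p := by simpa using hcontact.1
    refine ⟨x, ⟨hxball, by linarith, ?_⟩, hgx⟩
    intro z hz
    have := hmax z hz
    rw [hgx, inner_sub_right]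
    linarith
  have hpsd : ∀ x ∈ Γ, (hmat (-H x)).PosSemidef := by
    intro x hx
    refine hc.neg.contact_psd (S := Metric.closedBall 0 R) (p := - g x)
      (Filter.mem_of_superset (Metric.isOpen_ball.mem_nhds hx.1) Metric.ball_subset_closedBall) ?_
    intro z hz
    have := hx.2.2 z hz
    simp only [inner_neg_left]
    linarith
  set G : EuclideanSpace ℝ (Fin d) → ℝ≥0∞ := fun x =>
    ENNReal.ofReal (δ⁻¹ ^ d * 2 ^ d / F ^ d) * ENNReal.ofReal (f x) ^ d +
      ENNReal.ofReal (δ⁻¹ ^ d * 4 ^ d * K ^ d) with hG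
  set V : ℕ → Set (EuclideanSpace ℝ (Fin d)) := fun k =>
    Metric.ball 0 (2 * (2 ^ k * F)) \ Metric.ball 0 (2 ^ k * F) with hV
  have hVm : ∀ k, MeasurableSet (V k) := fun k =>
    Metric.isOpen_ball.measurableSet.diff Metric.isOpen_ball.measurableSet
  have hVdisj : ∀ i j, i < j → Disjoint (V i) (V j) := by
    intro i j hij
    rw [Set.disjoint_left]
    rintro x ⟨hx1, _⟩ ⟨_, hx2⟩
    simp only [mem_ball_zero_iff, not_lt] at hx1 hx2
    have : (2:ℝ) ^ (i + 1) ≤ 2 ^ j := pow_le_pow_right₀ (by norm_num) hij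
    have : (2:ℝ) * (2 ^ i * F) ≤ 2 ^ j * F := by
      calc (2:ℝ) * (2 ^ i * F) = 2 ^ (i+1) * F := by ring
        _ ≤ _ := by gcongr
    linarith
  have hstep : ∀ k < n, ω ≤ ∫⁻ x in Γ ∩ g ⁻¹' (V k), G x := by
    intro k hk
    set q := (2:ℝ) ^ k * F with hq
    have hq0 : 0 < q := by positivity
    have hm' : MeasurableSet (Γ ∩ g ⁻¹' (V k)) := hΓm.inter (hg.measurable (hVm k))
    have h1 : volume ((fun x => -x) ⁻¹' (V k)) ≤ ∫⁻ x in Γ ∩ g ⁻¹' (V k),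
        ENNReal.ofReal (q ^ d) * G x := by
      refine area_le (G := fun x => - g x) (H := fun x => - H x) hm'
        (fun x _ => hc.neg.hg x) ?_ (fun x hx => hpsd x hx.1) ?_
      · intro p hp
        have hp' : ‖-p‖ < 2 ^ n * F := by
          have := hp.1
          rw [mem_ball_zero_iff] at this
          refine this.trans_le ?_
          calc (2:ℝ) * (2 ^ k * F) = 2 ^ (k+1) * F := by ring
            _ ≤ _ := by
              have : (2:ℝ) ^ (k + 1) ≤ 2 ^ n := pow_le_pow_right₀ (by norm_num) hk
              gcongr
        obtain ⟨x, hxΓ, hxp⟩ := hΓimg _ hp'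
        refine ⟨x, ⟨hxΓ, ?_⟩, ?_⟩
        · change g x ∈ V k
          rw [hxp]; exact hp
        · simp [hxp]
      · intro x hx
        have hgx : ‖g x‖ ≤ 2 * q := by
          have := hx.2.1
          rw [mem_ball_zero_iff] at this
          exact this.le
        have htr := ell_trace_le (ha x) (hpsd x hx.1)
        have h2 := hsub x hx.1.1 hx.1.2.1
        have h3 : ∑ i, ∑ j, a x i j * hmat (-H x) i j = - ∑ i, ∑ j, a x i j * hmat (H x) i j := by
          simp [hmat, Finset.sum_neg_distrib]
        have h4 : ∑ i, hmat (-H x) i i ≤ δ⁻¹ * (f x + K * (2 * q)) := by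
          rw [h3] at htr
          have : K * ‖g x‖ ≤ K * (2 * q) := by gcongr
          rw [← div_eq_inv_mul, le_div_iff₀ hδ]
          linarith
        have h5 : 0 ≤ ∑ i, hmat (-H x) i i :=
          Finset.sum_nonneg fun i _ => (hpsd x hx.1).diag_nonneg
        have h6 : F ^ d ≤ q ^ d := by
          gcongr
          rw [hq]
          have : (1:ℝ) ≤ 2 ^ k := one_le_pow₀ (by norm_num)
          nlinarith
        have h7 : (∑ i, hmat (-H x) i i) ^ d ≤ q ^ d *
            (δ⁻¹ ^ d * 2 ^ d / F ^ d * (f x) ^ d + δ⁻¹ ^ d * 4 ^ d * K ^ d) := by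
          calc (∑ i, hmat (-H x) i i) ^ d ≤ (δ⁻¹ * (f x + K * (2 * q))) ^ d := by gcongr
            _ = δ⁻¹ ^ d * (f x + K * (2 * q)) ^ d := by rw [mul_pow]
            _ ≤ δ⁻¹ ^ d * (2 ^ d * ((f x) ^ d + (K * (2 * q)) ^ d)) := by
              gcongr
              exact add_pow_le_two_pow (hf0 x) (by positivity) d
            _ = δ⁻¹ ^ d * 2 ^ d * 1 * (f x) ^ d + q ^ d * (δ⁻¹ ^ d * 4 ^ d * K ^ d) := by
              have : (4:ℝ) ^ d = 2 ^ d * 2 ^ d := by rw [← mul_pow]; norm_num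
              rw [this, mul_pow, mul_pow]; ring
            _ ≤ δ⁻¹ ^ d * 2 ^ d * (q ^ d / F ^ d) * (f x) ^ d
                + q ^ d * (δ⁻¹ ^ d * 4 ^ d * K ^ d) := by
              have : 1 ≤ q ^ d / F ^ d := by rw [le_div_iff₀ (by positivity)]; linarith
              have := hf0 x
              gcongr
            _ = _ := by ring
        refine (ENNReal.ofReal_le_ofReal h7).trans_eq ?_
        have := hf0 x
        rw [ENNReal.ofReal_mul (by positivity), ENNReal.ofReal_add (by positivity) (by positivity),
          ENNReal.ofReal_mul (by positivity), ENNReal.ofReal_pow this]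
    have h2 : volume ((fun x : EuclideanSpace ℝ (Fin d) => -x) ⁻¹' (V k)) = volume (V k) := by
      exact Measure.measure_preimage_neg volume (V k)
    rw [h2, lintegral_const_mul' _ _ ofReal_ne_top] at h1
    have h3 := (vol_shell hd hq0).trans h1
    exact (ENNReal.mul_le_mul_iff_right (by simpa using pow_pos hq0 d) ofReal_ne_top).1 h3
  have hsum : (n : ℝ≥0∞) * ω ≤ ∫⁻ x in Metric.ball 0 R, G x := by
    calc (n : ℝ≥0∞) * ω = ∑ k ∈ Finset.range n, ω := by simp
      _ ≤ ∑ k ∈ Finset.range n, ∫⁻ x in Γ ∩ g ⁻¹' (V k), G x :=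
        Finset.sum_le_sum fun k hk => hstep k (Finset.mem_range.1 hk)
      _ = ∫⁻ x in ⋃ k ∈ Finset.range n, (Γ ∩ g ⁻¹' (V k)), G x := by
        rw [lintegral_biUnion_finset]
        · intro i _ j _ hij
          have : Disjoint (V i) (V j) := by
            rcases lt_or_gt_of_ne hij with h | h
            · exact hVdisj i j h
            · exact (hVdisj j i h).symm
          exact (this.preimage g).mono inter_subset_right inter_subset_right
        · exact fun k _ => hΓm.inter (hg.measurable (hVm k))
      _ ≤ _ := by
        refine lintegral_mono_set ?_
        simp only [iUnion_subset_iff]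
        intro k _ x hx
        exact hx.1.1
  have hfin : ∫⁻ x in Metric.ball 0 R, G x ≤ Q := by
    rw [hG, lintegral_add_right _ measurable_const, lintegral_const_mul' _ _ ofReal_ne_top,
      lintegral_const]
    simp only [Measure.restrict_apply_univ]
    refine add_le_add ?_ (mul_le_mul_right (measure_mono (Metric.ball_subset_ball hR1)) _)
    · calc _ ≤ ENNReal.ofReal (δ⁻¹ ^ d * 2 ^ d / F ^ d) * ENNReal.ofReal (F ^ d) := by gcongr
        _ = _ := by
          rw [← ENNReal.ofReal_mul (by positivity)]
          congr 1
          field_simp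
  exact absurd (hn.trans_le (hsum.trans hfin)) (lt_irrefl _)

/-! ### Contact sets -/

/-- Points at which `u` is touched from below by a paraboloid of opening `t`. -/
def Aset {d : ℕ} (u : EuclideanSpace ℝ (Fin d) → ℝ)
    (g : EuclideanSpace ℝ (Fin d) → EuclideanSpace ℝ (Fin d)) (R t : ℝ) :
    Set (EuclideanSpace ℝ (Fin d)) :=
  {x | x ∈ Metric.closedBall 0 R ∧ ∀ z ∈ Metric.closedBall (0 : EuclideanSpace ℝ (Fin d)) R,
    u x + inner ℝ (g x) (z - x) - t / 2 * ‖z - x‖ ^ 2 ≤ u z}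

theorem Aset_isClosed {d : ℕ} {u : EuclideanSpace ℝ (Fin d) → ℝ}
    {g : EuclideanSpace ℝ (Fin d) → EuclideanSpace ℝ (Fin d)} (hu : Continuous u)
    (hg : Continuous g) (R t : ℝ) : IsClosed (Aset u g R t) := by
  refine Metric.isClosed_closedBall.inter (isClosed_forall_mem fun z _ => ?_)
  exact isClosed_le (by fun_prop) continuous_const

theorem Aset_mono {d : ℕ} (u : EuclideanSpace ℝ (Fin d) → ℝ)
    (g : EuclideanSpace ℝ (Fin d) → EuclideanSpace ℝ (Fin d)) (R : ℝ) {t s : ℝ} (h : t ≤ s) :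
    Aset u g R t ⊆ Aset u g R s := by
  intro x hx
  refine ⟨hx.1, fun z hz => le_trans ?_ (hx.2 z hz)⟩
  have : t / 2 * ‖z - x‖ ^ 2 ≤ s / 2 * ‖z - x‖ ^ 2 := by gcongr
  linarith

theorem Aset_grad {d : ℕ} {u : EuclideanSpace ℝ (Fin d) → ℝ}
    {g : EuclideanSpace ℝ (Fin d) → EuclideanSpace ℝ (Fin d)} {R σ : ℝ} (hσ : 0 < σ)
    (hu1 : ∀ x ∈ Metric.closedBall (0 : EuclideanSpace ℝ (Fin d)) R, |u x| ≤ 1)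
    {x : EuclideanSpace ℝ (Fin d)} (hx : x ∈ Aset u g R (σ ^ 2)) (hxR : ‖x‖ + 2 / σ ≤ R) :
    ‖g x‖ ≤ 2 * σ := by
  rcases eq_or_ne (g x) 0 with h0 | h0
  · rw [h0, norm_zero]; positivity
  have hn : 0 < ‖g x‖ := norm_pos_iff.2 h0
  set z := x + (2 / σ / ‖g x‖) • g x with hz
  have hzx : z - x = (2 / σ / ‖g x‖) • g x := by simp [hz]
  have hnorm : ‖z - x‖ = 2 / σ := by
    rw [hzx, norm_smul, Real.norm_of_nonneg (by positivity)]
    field_simp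
  have hzB : z ∈ Metric.closedBall (0 : EuclideanSpace ℝ (Fin d)) R := by
    rw [mem_closedBall_zero_iff]
    calc ‖z‖ = ‖x + (z - x)‖ := by congr 1; abel
      _ ≤ ‖x‖ + ‖z - x‖ := norm_add_le _ _
      _ ≤ R := by rw [hnorm]; exact hxR
  have h1 := hx.2 z hzB
  have h2 := abs_le.1 (hu1 x hx.1)
  have h3 := abs_le.1 (hu1 z hzB)
  have h4 : inner ℝ (g x) (z - x) = 2 / σ * ‖g x‖ := by
    rw [hzx, inner_smul_right, real_inner_self_eq_norm_sq]
    field_simp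
  rw [hnorm, h4] at h1
  have h5 : σ ^ 2 / 2 * (2 / σ) ^ 2 = 2 := by field_simp
  have h6 : 2 / σ * ‖g x‖ ≤ 4 := by linarith
  have h7 : 2 / σ * ‖g x‖ * σ = 2 * ‖g x‖ := by field_simp
  nlinarith

theorem Aset_near {d : ℕ} {u : EuclideanSpace ℝ (Fin d) → ℝ}
    {g : EuclideanSpace ℝ (Fin d) → EuclideanSpace ℝ (Fin d)}
    {H : EuclideanSpace ℝ (Fin d) → EuclideanSpace ℝ (Fin d) →L[ℝ] EuclideanSpace ℝ (Fin d)}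
    (hc : C2Data u g H) {R σ : ℝ} (hσ : 0 < σ)
    (hu1 : ∀ x ∈ Metric.closedBall (0 : EuclideanSpace ℝ (Fin d)) R, |u x| ≤ 1)
    {x0 : EuclideanSpace ℝ (Fin d)} (hxR : ‖x0‖ + 2 / σ < R) :
    ∃ x ∈ Aset u g R (σ ^ 2), dist x0 x ≤ 2 / σ := by
  have hu := hc.continuous
  have h0 : x0 ∈ Metric.closedBall (0 : EuclideanSpace ℝ (Fin d)) R := by
    rw [mem_closedBall_zero_iff]
    have : 0 < 2 / σ := by positivity
    linarith
  obtain ⟨x, hxB, hxmin⟩ := (isCompact_closedBall (0 : EuclideanSpace ℝ (Fin d)) R).exists_isMinOn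
      ⟨x0, h0⟩ (f := fun z => u z + σ ^ 2 / 2 * ‖z - x0‖ ^ 2) (by fun_prop)
  have hmin : ∀ z ∈ Metric.closedBall (0 : EuclideanSpace ℝ (Fin d)) R,
      u x + σ ^ 2 / 2 * ‖x - x0‖ ^ 2 ≤ u z + σ ^ 2 / 2 * ‖z - x0‖ ^ 2 := fun z hz => hxmin hz
  have hdist : ‖x - x0‖ ≤ 2 / σ := by
    have h1 := hmin x0 h0
    have h2 := abs_le.1 (hu1 x hxB)
    have h3 := abs_le.1 (hu1 x0 h0)
    simp at h1
    have h4 : (σ * ‖x - x0‖) ^ 2 ≤ 2 ^ 2 := by nlinarith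
    have h5 := abs_le_of_sq_le_sq h4 (by norm_num)
    rw [le_div_iff₀ hσ]
    have h6 := (le_abs_self _).trans h5
    linarith
  have hball : x ∈ Metric.ball (0 : EuclideanSpace ℝ (Fin d)) R := by
    rw [mem_ball_zero_iff]
    calc ‖x‖ = ‖x0 + (x - x0)‖ := by congr 1; abel
      _ ≤ ‖x0‖ + ‖x - x0‖ := norm_add_le _ _
      _ < R := by linarith
  have hsq : ∀ z, ‖z - x0‖ ^ 2 = ‖x - x0‖ ^ 2 + 2 * inner ℝ (x - x0) (z - x) + ‖z - x‖ ^ 2 := by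
    intro z
    rw [← norm_add_sq_real]; congr 2; abel
  -- gradient at the minimum point
  have hg : g x = -(σ ^ 2) • (x - x0) := by
    have hd : HasFDerivAt (fun z => u z + σ ^ 2 / 2 * ‖z - x0‖ ^ 2)
        (innerSL ℝ (g x) + (σ ^ 2 / 2) • (2 • (innerSL ℝ (x - x0)))) x := by
      refine (hc.hu x).add (HasFDerivAt.const_mul ?_ _)
      have := ((hasFDerivAt_id x).sub_const x0).norm_sq
      simpa using this
    have hz := (hxmin.isLocalMin (Filter.mem_of_superset (Metric.isOpen_ball.mem_nhds hball)
      Metric.ball_subset_closedBall)).hasFDerivAt_eq_zero hd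
    have h1 : ∀ v, inner ℝ (g x - -(σ ^ 2) • (x - x0)) v = 0 := by
      intro v
      have := congrArg (fun L => L v) hz
      simp [inner_sub_left, inner_smul_left, inner_add_left] at this ⊢
      linarith
    have := h1 (g x - -(σ ^ 2) • (x - x0))
    rw [inner_self_eq_zero] at this
    exact sub_eq_zero.1 this
  refine ⟨x, ⟨hxB, fun z hz => ?_⟩, by rw [dist_comm, dist_eq_norm]; exact hdist⟩
  have h1 := hmin z hz
  rw [hsq z] at h1
  rw [hg, inner_smul_left]
  simp only [conj_trivial]
  linarith

/-! ### The barrier -/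

/-- The function `u - P + (c₁ - B exp (-κ |z - x₀|²))`. -/
def barW {d : ℕ} (u : EuclideanSpace ℝ (Fin d) → ℝ) (c0 c1 t B κ : ℝ)
    (g1 x1 x0 z : EuclideanSpace ℝ (Fin d)) : ℝ :=
  u z - (c0 + inner ℝ g1 (z - x1) - t / 2 * ‖z - x1‖ ^ 2) + (c1 - B * Real.exp (-κ * ‖z - x0‖ ^ 2))

/-- Gradient of `barW`. -/
def barG {d : ℕ} (g : EuclideanSpace ℝ (Fin d) → EuclideanSpace ℝ (Fin d)) (t B κ : ℝ)
    (g1 x1 x0 z : EuclideanSpace ℝ (Fin d)) : EuclideanSpace ℝ (Fin d) :=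
  g z - g1 + t • (z - x1) + (2 * B * κ * Real.exp (-κ * ‖z - x0‖ ^ 2)) • (z - x0)

/-- Hessian of `barW`. -/
def barH {d : ℕ}
    (H : EuclideanSpace ℝ (Fin d) → EuclideanSpace ℝ (Fin d) →L[ℝ] EuclideanSpace ℝ (Fin d))
    (t B κ : ℝ) (x0 z : EuclideanSpace ℝ (Fin d)) :
    EuclideanSpace ℝ (Fin d) →L[ℝ] EuclideanSpace ℝ (Fin d) :=
  H z + t • ContinuousLinearMap.id ℝ _
    + (2 * B * κ * Real.exp (-κ * ‖z - x0‖ ^ 2)) • ContinuousLinearMap.id ℝ _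
    + (-(4 * B * κ ^ 2 * Real.exp (-κ * ‖z - x0‖ ^ 2))) •
      (innerSL ℝ (z - x0)).smulRight (z - x0)

theorem barW_c2 {d : ℕ} {u : EuclideanSpace ℝ (Fin d) → ℝ}
    {g : EuclideanSpace ℝ (Fin d) → EuclideanSpace ℝ (Fin d)}
    {H : EuclideanSpace ℝ (Fin d) → EuclideanSpace ℝ (Fin d) →L[ℝ] EuclideanSpace ℝ (Fin d)}
    (hc : C2Data u g H) (c0 c1 t B κ : ℝ) (g1 x1 x0 : EuclideanSpace ℝ (Fin d)) :
    C2Data (barW u c0 c1 t B κ g1 x1 x0) (barG g t B κ g1 x1 x0) (barH H t B κ x0) := by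
  have hnorm : ∀ y z : EuclideanSpace ℝ (Fin d),
      HasFDerivAt (fun z => ‖z - y‖ ^ 2) (2 • (innerSL ℝ (z - y))) z := by
    intro y z
    have := ((hasFDerivAt_id z).sub_const y).norm_sq
    simpa using this
  have hexp : ∀ z : EuclideanSpace ℝ (Fin d),
      HasFDerivAt (fun z => Real.exp (-κ * ‖z - x0‖ ^ 2))
        (Real.exp (-κ * ‖z - x0‖ ^ 2) • ((-κ) • (2 • (innerSL ℝ (z - x0))))) z := by
    intro z
    exact ((hnorm x0 z).const_mul (-κ)).exp
  refine ⟨fun z => ?_, fun z => ?_, fun z v w => ?_⟩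
  · have hP : HasFDerivAt (fun z => c0 + inner ℝ g1 (z - x1) - t / 2 * ‖z - x1‖ ^ 2)
        (innerSL ℝ g1 - (t / 2) • (2 • (innerSL ℝ (z - x1)))) z := by
      refine HasFDerivAt.fun_sub (HasFDerivAt.const_add c0 ?_) ((hnorm x1 z).const_mul _)
      exact ((innerSL ℝ g1).hasFDerivAt (x := z - x1)).comp z ((hasFDerivAt_id z).sub_const x1)
    have h := ((hc.hu z).fun_sub hP).fun_add (((hexp z).const_mul B).const_sub c1)
    refine h.congr_fderiv ?_
    ext v
    simp [barG, inner_sub_left, inner_add_left, inner_smul_left]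
    ring
  · have h1 : HasFDerivAt (fun z => t • (z - x1)) (t • ContinuousLinearMap.id ℝ _) z :=
      ((hasFDerivAt_id z).sub_const x1).const_smul t
    have h2 := ((hexp z).const_mul (2 * B * κ)).fun_smul ((hasFDerivAt_id z).sub_const x0)
    have h := (((hc.hg z).sub_const g1).fun_add h1).fun_add h2
    refine h.congr_fderiv ?_
    apply ContinuousLinearMap.ext
    intro v
    simp only [barH, ContinuousLinearMap.add_apply, ContinuousLinearMap.smul_apply,
      ContinuousLinearMap.smulRight_apply, ContinuousLinearMap.id_apply, id, smul_eq_mul,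
      nsmul_eq_mul, innerSL_apply_apply]
    push_cast
    module
  · simp only [barH, ContinuousLinearMap.add_apply, ContinuousLinearMap.smul_apply,
      ContinuousLinearMap.smulRight_apply, ContinuousLinearMap.id_apply,
      innerSL_apply_apply, inner_add_left, inner_smul_left, conj_trivial]
    rw [hc.symm z v w, real_inner_comm v w]
    ring

theorem barH_sum {d : ℕ} 
    (H : EuclideanSpace ℝ (Fin d) → EuclideanSpace ℝ (Fin d) →L[ℝ] EuclideanSpace ℝ (Fin d))
    (t B κ : ℝ) (x0 z : EuclideanSpace ℝ (Fin d)) (a : Matrix (Fin d) (Fin d) ℝ) :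
    ∑ i, ∑ j, a i j * hmat (barH H t B κ x0 z) i j =
      (∑ i, ∑ j, a i j * hmat (H z) i j)
      + (t + 2 * B * κ * Real.exp (-κ * ‖z - x0‖ ^ 2)) * ∑ i, a i i
      - 4 * B * κ ^ 2 * Real.exp (-κ * ‖z - x0‖ ^ 2) *
        ∑ i, ∑ j, a i j * (z - x0) i * (z - x0) j := by
  have h : ∀ i j, hmat (barH H t B κ x0 z) i j = hmat (H z) i j
      + (t + 2 * B * κ * Real.exp (-κ * ‖z - x0‖ ^ 2)) * (if i = j then 1 else 0)
      - 4 * B * κ ^ 2 * Real.exp (-κ * ‖z - x0‖ ^ 2) * ((z - x0) i * (z - x0) j) := by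
    intro i j
    by_cases hij : i = j
    · simp [hmat, barH, hij, EuclideanSpace.inner_single_right]
      ring
    · simp [hmat, barH, hij, EuclideanSpace.inner_single_right]
      ring
  simp only [h]
  simp only [mul_add, mul_sub, Finset.sum_add_distrib, Finset.sum_sub_distrib, mul_ite, mul_one,
    mul_zero, Finset.sum_ite_eq, Finset.mem_univ, if_true, Finset.mul_sum]
  congr 1
  · congr 1
    rw [← Finset.sum_add_distrib]
    exact Finset.sum_congr rfl fun i _ => by ring
  · exact Finset.sum_congr rfl fun i _ => Finset.sum_congr rfl fun j _ => by ring

/-- The contact points of the barrier function are contact points of `u`. -/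
theorem bar_touch {d : ℕ} {u : EuclideanSpace ℝ (Fin d) → ℝ}
    {g : EuclideanSpace ℝ (Fin d) → EuclideanSpace ℝ (Fin d)} {R t r β l M B κ : ℝ}
    {x0 x1 x : EuclideanSpace ℝ (Fin d)} (ht : 0 < t) (hr : 0 < r) (hβ : 0 < β) (hl : 0 < l)
    (hM : 2 + 2 * β + 8 * β * l ≤ M) (hB : B = t * r ^ 2 * β) (hκ : κ = l / r ^ 2)
    (hx1 : x1 ∈ Aset u g R t) {c1 : ℝ} (hc1 : 0 ≤ c1)
    (hxR : x ∈ Metric.closedBall (0 : EuclideanSpace ℝ (Fin d)) R)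
    (hxr : ‖x - x0‖ ≤ 2 * r)
    (hG : ‖barG g t B κ (g x1) x1 x0 x‖ ≤ t * r / 2)
    (hw : barW u (u x1) c1 t B κ (g x1) x1 x0 x ≤ 0)
    (hcon : ∀ z ∈ Metric.closedBall x0 (3 * r),
      barW u (u x1) c1 t B κ (g x1) x1 x0 x + inner ℝ (barG g t B κ (g x1) x1 x0 x) (z - x) ≤
        barW u (u x1) c1 t B κ (g x1) x1 x0 z) :
    x ∈ Aset u g R (M * t) := by
  refine ⟨hxR, fun z hz => ?_⟩
  have hBκ : B * κ = t * β * l := by rw [hB, hκ]; field_simp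
  have hκ0 : 0 < κ := by rw [hκ]; positivity
  have hB0 : 0 < B := by rw [hB]; positivity
  set e := Real.exp (-κ * ‖x - x0‖ ^ 2) with he
  have he0 : 0 < e := Real.exp_pos _
  have he1 : e ≤ 1 := Real.exp_le_one_iff.2 (by have := sq_nonneg ‖x - x0‖; nlinarith)
  set p := barG g t B κ (g x1) x1 x0 x with hp
  -- gradient decomposition
  have hgx : g x = p + g x1 - t • (x - x1) - (2 * B * κ * e) • (x - x0) := by
    rw [hp, barG]; module
  have hP : ‖z - x1‖ ^ 2 = ‖x - x1‖ ^ 2 + 2 * inner ℝ (x - x1) (z - x) + ‖z - x‖ ^ 2 := by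
    rw [← norm_add_sq_real]; congr 2; abel
  have hP0 : ‖z - x0‖ ^ 2 = ‖x - x0‖ ^ 2 + 2 * inner ℝ (x - x0) (z - x) + ‖z - x‖ ^ 2 := by
    rw [← norm_add_sq_real]; congr 2; abel
  have hlin : inner ℝ (g x1) (z - x1) = inner ℝ (g x1) (x - x1) + inner ℝ (g x1) (z - x) := by
    rw [← inner_add_right]; congr 1; abel
  have hin : inner ℝ (g x) (z - x) = inner ℝ p (z - x) + inner ℝ (g x1) (z - x)
      - t * inner ℝ (x - x1) (z - x) - 2 * B * κ * e * inner ℝ (x - x0) (z - x) := by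
    rw [hgx]
    simp only [inner_sub_left, inner_add_left, inner_smul_left, conj_trivial]
  have hn := sq_nonneg ‖z - x‖
  have htbl : 0 < t * β * l := by positivity
  rcases le_or_gt ‖z - x0‖ (3 * r) with h3 | h3
  · have h := hcon z (by rw [Metric.mem_closedBall, dist_eq_norm]; exact h3)
    have hexp : e * (1 - κ * (2 * inner ℝ (x - x0) (z - x) + ‖z - x‖ ^ 2)) ≤
        Real.exp (-κ * ‖z - x0‖ ^ 2) := by
      rw [hP0]
      have h1 := Real.add_one_le_exp (-κ * (2 * inner ℝ (x - x0) (z - x) + ‖z - x‖ ^ 2))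
      have h2 : Real.exp (-κ * (‖x - x0‖ ^ 2 + 2 * inner ℝ (x - x0) (z - x) + ‖z - x‖ ^ 2)) =
          e * Real.exp (-κ * (2 * inner ℝ (x - x0) (z - x) + ‖z - x‖ ^ 2)) := by
        rw [he, ← Real.exp_add]; congr 1; ring
      rw [h2]
      apply mul_le_mul_of_nonneg_left _ he0.le
      linarith
    have hexp2 := mul_le_mul_of_nonneg_left hexp hB0.le
    simp only [barW] at h
    rw [← he] at h
    rw [hP, hlin] at h
    rw [hin]
    have h5 : B * κ * e * ‖z - x‖ ^ 2 ≤ t * β * l * ‖z - x‖ ^ 2 := by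
      rw [hBκ]
      apply mul_le_mul_of_nonneg_right _ hn
      nlinarith
    have h6 : (1 + 2 * β * l) * t * ‖z - x‖ ^ 2 ≤ M * t * ‖z - x‖ ^ 2 := by
      have : (1 + 2 * β * l) ≤ M := by nlinarith [mul_pos hβ hl]
      gcongr
    linarith
  · have hzr : r ≤ ‖z - x‖ := by
      have := norm_sub_le_norm_sub_add_norm_sub z x x0
      linarith
    have h := hx1.2 z hz
    rw [hP, hlin] at h
    rw [hin]
    simp only [barW] at hw
    rw [← he] at hw
    have h1 : inner ℝ p (z - x) ≤ t * r / 2 * ‖z - x‖ :=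
      (real_inner_le_norm _ _).trans (by gcongr)
    have h2 : t * r / 2 * ‖z - x‖ ≤ t / 2 * ‖z - x‖ ^ 2 := by
      have : t * r / 2 * ‖z - x‖ = t / 2 * (r * ‖z - x‖) := by ring
      rw [this, sq]; gcongr
    have h3' : -inner ℝ (x - x0) (z - x) ≤ 2 * ‖z - x‖ ^ 2 := by
      have a1 := (abs_le.1 (abs_real_inner_le_norm (x - x0) (z - x))).1
      have a2 : ‖x - x0‖ * ‖z - x‖ ≤ 2 * ‖z - x‖ * ‖z - x‖ := by
        gcongr; linarith
      have a3 : 2 * ‖z - x‖ * ‖z - x‖ = 2 * ‖z - x‖ ^ 2 := by ring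
      linarith
    have h4 : 2 * B * κ * e * (-inner ℝ (x - x0) (z - x)) ≤ 4 * (t * β * l) * ‖z - x‖ ^ 2 := by
      have a1 : 2 * B * κ * e * (-inner ℝ (x - x0) (z - x)) ≤
          2 * B * κ * e * (2 * ‖z - x‖ ^ 2) := by gcongr
      have a2 : 2 * B * κ * e * (2 * ‖z - x‖ ^ 2) = 4 * (t * β * l) * ‖z - x‖ ^ 2 * e := by
        rw [← hBκ]; ring
      have a3 : 4 * (t * β * l) * ‖z - x‖ ^ 2 * e ≤ 4 * (t * β * l) * ‖z - x‖ ^ 2 :=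
        mul_le_of_le_one_right (by positivity) he1
      linarith
    have h5 : B * e ≤ t * β * ‖z - x‖ ^ 2 := by
      have a1 : B * e ≤ B := mul_le_of_le_one_right hB0.le he1
      have a2 : r ^ 2 ≤ ‖z - x‖ ^ 2 := by gcongr
      have a3 : t * β * r ^ 2 ≤ t * β * ‖z - x‖ ^ 2 := by gcongr
      rw [hB] at a1 ⊢
      linarith
    have h6 : (2 + 2 * β + 8 * β * l) * t * ‖z - x‖ ^ 2 ≤ M * t * ‖z - x‖ ^ 2 := by gcongr
    linarith

/-- Trace bound at contact points of the barrier. -/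
theorem bar_trace {d : ℕ} {δ : ℝ} (hδ : 0 < δ)
    {H : EuclideanSpace ℝ (Fin d) → EuclideanSpace ℝ (Fin d) →L[ℝ] EuclideanSpace ℝ (Fin d)}
    {t r β l B κ f : ℝ} {x0 x : EuclideanSpace ℝ (Fin d)} {a : Matrix (Fin d) (Fin d) ℝ}
    (ha : EllMat δ a) (ht : 0 < t) (hr : 0 < r) (hβ : 0 < β) (hl : 0 < l)
    (hp1 : 8 * (d * δ⁻¹ + 1) ≤ δ * l) (hp2 : d * δ⁻¹ + 1 ≤ 2 * β * l * Real.exp (-4 * l))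
    (hB : B = t * r ^ 2 * β) (hκ : κ = l / r ^ 2) (hxr : ‖x - x0‖ ≤ 2 * r)
    (hsub : ∑ i, ∑ j, a i j * hmat (H x) i j ≤ f + t)
    (hpsd : (hmat (barH H t B κ x0 x)).PosSemidef) :
    ∑ i, hmat (barH H t B κ x0 x) i i ≤
      δ⁻¹ * (f + if ‖x - x0‖ < r / 4 then (1 + d * δ⁻¹ + 2 * β * l * (d * δ⁻¹)) * t else 0) := by
  have hBκ : B * κ = t * β * l := by rw [hB, hκ]; field_simp
  have h := ell_trace_le ha hpsd
  rw [barH_sum] at h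
  set e := Real.exp (-κ * ‖x - x0‖ ^ 2) with he
  have he0 : 0 < e := Real.exp_pos _
  have hκ0 : 0 < κ := by rw [hκ]; positivity
  have he1 : e ≤ 1 := Real.exp_le_one_iff.2 (by have := sq_nonneg ‖x - x0‖; nlinarith)
  have hel : Real.exp (-4 * l) ≤ e := by
    rw [he]
    apply Real.exp_le_exp.2
    have : κ * ‖x - x0‖ ^ 2 ≤ κ * (2 * r) ^ 2 := by gcongr
    have h2 : κ * (2 * r) ^ 2 = 4 * l := by rw [hκ]; field_simp; norm_num
    linarith
  have hq := (ha.2 (x - x0)).1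
  have htr := ell_trace_diag ha
  have hdd : 0 ≤ d * δ⁻¹ := by positivity
  have h1 : (t + 2 * B * κ * e) * ∑ i, a i i ≤ (t + 2 * (t * β * l) * e) * (d * δ⁻¹) := by
    have : 2 * B * κ * e = 2 * (t * β * l) * e := by rw [← hBκ]; ring
    rw [this]
    gcongr
  have h2 : 4 * (t * β * l) * κ * e * (δ * ‖x - x0‖ ^ 2) ≤
      4 * B * κ ^ 2 * e * ∑ i, ∑ j, a i j * (x - x0) i * (x - x0) j := by
    have : 4 * B * κ ^ 2 * e = 4 * (t * β * l) * κ * e := by rw [← hBκ]; ring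
    rw [this]
    gcongr
  have key : δ * ∑ i, hmat (barH H t B κ x0 x) i i ≤
      f + if ‖x - x0‖ < r / 4 then (1 + d * δ⁻¹ + 2 * β * l * (d * δ⁻¹)) * t else 0 := by
    have hbase : δ * ∑ i, hmat (barH H t B κ x0 x) i i ≤ f + t +
        (t + 2 * (t * β * l) * e) * (d * δ⁻¹) - 4 * (t * β * l) * κ * e * (δ * ‖x - x0‖ ^ 2) := by
      linarith
    split_ifs with hif
    · have h3 : 0 ≤ 4 * (t * β * l) * κ * e * (δ * ‖x - x0‖ ^ 2) := by positivity
      have h4 : (2 * (t * β * l) * e) * (d * δ⁻¹) ≤ (2 * (t * β * l)) * (d * δ⁻¹) := by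
        apply mul_le_mul_of_nonneg_right _ hdd
        exact mul_le_of_le_one_right (by positivity) he1
      linarith
    · push Not at hif
      have h3 : (r / 4) ^ 2 ≤ ‖x - x0‖ ^ 2 := by gcongr
      have h4 : l / 16 ≤ κ * ‖x - x0‖ ^ 2 := by
        calc l / 16 = κ * (r / 4) ^ 2 := by rw [hκ]; field_simp; norm_num
          _ ≤ _ := by gcongr
      have h5 : 4 * (t * β * l) * e * δ * (l / 16) ≤
          4 * (t * β * l) * κ * e * (δ * ‖x - x0‖ ^ 2) := by
        have : 4 * (t * β * l) * κ * e * (δ * ‖x - x0‖ ^ 2) =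
          4 * (t * β * l) * e * δ * (κ * ‖x - x0‖ ^ 2) := by ring
        rw [this]; gcongr
      have h6 : t * (d * δ⁻¹ + 1) ≤ t * (2 * β * l * e) := by
        have : 2 * β * l * Real.exp (-4 * l) ≤ 2 * β * l * e := by gcongr
        exact mul_le_mul_of_nonneg_left (hp2.trans this) ht.le
      have h7 : 2 * (t * β * l) * e * (8 * (d * δ⁻¹ + 1)) ≤ 2 * (t * β * l) * e * (δ * l) := by
        gcongr
      linarith
  have := mul_le_mul_of_nonneg_left key (inv_pos.2 hδ).le
  rwa [← mul_assoc, inv_mul_cancel₀ hδ.ne', one_mul] at this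

/-- The gradient image of the contact set of the barrier. -/
theorem bar_surj {d : ℕ} {w : EuclideanSpace ℝ (Fin d) → ℝ}
    {G : EuclideanSpace ℝ (Fin d) → EuclideanSpace ℝ (Fin d)}
    {H : EuclideanSpace ℝ (Fin d) → EuclideanSpace ℝ (Fin d) →L[ℝ] EuclideanSpace ℝ (Fin d)}
    (hc : C2Data w G H) {r t : ℝ} (hr : 0 < r) (ht : 0 < t) {x0 x1 : EuclideanSpace ℝ (Fin d)}
    (h1 : ‖x1 - x0‖ ≤ r) (hw1 : w x1 ≤ -2 * (t * r ^ 2))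
    (hw2 : ∀ z, 2 * r ≤ ‖z - x0‖ → ‖z - x0‖ ≤ 3 * r → 0 ≤ w z) :
    Metric.ball 0 (t * r / 2) ⊆ G '' {x | x ∈ Metric.ball x0 (2 * r) ∧ ‖G x‖ ≤ t * r / 2 ∧ w x ≤ 0 ∧
      ∀ z ∈ Metric.closedBall x0 (3 * r), w x + inner ℝ (G x) (z - x) ≤ w z} := by
  intro p hp
  rw [mem_ball_zero_iff] at hp
  have hw := hc.continuous
  obtain ⟨x, hxB, hxmin⟩ := (isCompact_closedBall x0 (3 * r)).exists_isMinOn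
      ⟨x0, Metric.mem_closedBall_self (by positivity)⟩ (f := fun z => w z - inner ℝ p (z - x0))
      (by fun_prop)
  have hmin : ∀ z ∈ Metric.closedBall x0 (3 * r), w x - inner ℝ p (x - x0) ≤
      w z - inner ℝ p (z - x0) := fun z hz => hxmin hz
  have hx1 := hmin x1 (by rw [Metric.mem_closedBall, dist_eq_norm]; linarith)
  have a1 : -inner ℝ p (x1 - x0) ≤ ‖p‖ * r := by
    have := (abs_le.1 (abs_real_inner_le_norm p (x1 - x0))).1
    have : ‖p‖ * ‖x1 - x0‖ ≤ ‖p‖ * r := by gcongr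
    linarith
  have a2 := real_inner_le_norm p (x - x0)
  have a3 : ‖p‖ * r < t * r / 2 * r := by gcongr
  rw [Metric.mem_closedBall, dist_eq_norm] at hxB
  have hx2 : ‖x - x0‖ < 2 * r := by
    by_contra hcon
    push Not at hcon
    have := hw2 x hcon hxB
    have a4 : ‖p‖ * ‖x - x0‖ ≤ ‖p‖ * (3 * r) := by gcongr
    nlinarith
  have hcont : ∀ z ∈ Metric.closedBall x0 (3 * r), w x + inner ℝ p (z - x) ≤ w z := by
    intro z hz
    have := hmin z hz
    have h : inner ℝ p (z - x) = inner ℝ p (z - x0) - inner ℝ p (x - x0) := by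
      rw [← inner_sub_right]; congr 1; abel
    linarith
  have hxb : x ∈ Metric.ball x0 (2 * r) := by rw [Metric.mem_ball, dist_eq_norm]; exact hx2
  have hG : G x = p := by
    refine (hc.contact (S := Metric.closedBall x0 (3 * r)) ?_ hcont).1
    refine Filter.mem_of_superset (Metric.isOpen_ball.mem_nhds hxb) ?_
    exact Metric.ball_subset_closedBall.trans (Metric.closedBall_subset_closedBall (by linarith))
  refine ⟨x, ⟨hxb, by rw [hG]; exact hp.le, ?_, by rw [hG]; exact hcont⟩, hG⟩
  have a4 : ‖p‖ * ‖x - x0‖ ≤ ‖p‖ * (2 * r) := by gcongr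
  nlinarith

/-- The basic barrier (growth) lemma. -/
theorem barrier {d : ℕ} {δ K : ℝ} (hδ : 0 < δ) (hK : 0 ≤ K) {β l M σ : ℝ} (hβ : 0 < β) (hl : 0 < l)
    (hp1 : 8 * (d * δ⁻¹ + 1) ≤ δ * l) (hp2 : d * δ⁻¹ + 1 ≤ 2 * β * l * Real.exp (-4 * l))
    (hp3 : 2 ≤ β * (Real.exp (-l) - Real.exp (-4 * l)))
    (hM : 2 + 2 * β + 8 * β * l ≤ M) (hσ : 0 < σ) (hKσ : K * (9 + 8 * β * l) ≤ σ) {R : ℝ}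
    {u : EuclideanSpace ℝ (Fin d) → ℝ}
    {g : EuclideanSpace ℝ (Fin d) → EuclideanSpace ℝ (Fin d)}
    {H : EuclideanSpace ℝ (Fin d) → EuclideanSpace ℝ (Fin d) →L[ℝ] EuclideanSpace ℝ (Fin d)}
    {a : EuclideanSpace ℝ (Fin d) → Matrix (Fin d) (Fin d) ℝ}
    {f : EuclideanSpace ℝ (Fin d) → ℝ} (hc : C2Data u g H) (ha : ∀ x, EllMat δ (a x))
    (hf : Measurable f) (hf0 : ∀ x, 0 ≤ f x)
    (hsub : ∀ x ∈ Metric.ball (0 : EuclideanSpace ℝ (Fin d)) R,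
      ∑ i, ∑ j, a x i j * hmat (H x) i j ≤ f x + K * ‖g x‖)
    (hu1 : ∀ x ∈ Metric.closedBall (0 : EuclideanSpace ℝ (Fin d)) R, |u x| ≤ 1)
    {x0 x1 : EuclideanSpace ℝ (Fin d)} {r : ℝ} (hx0 : ‖x0‖ + 8 / σ ≤ R)
    (hx1 : x1 ∈ Aset u g R (σ ^ 2)) (h01 : ‖x1 - x0‖ = r) (hr : 0 < r) (hr2 : r ≤ 2 / σ) :
    ENNReal.ofReal ((σ ^ 2 * r / 2) ^ d) * volume (Metric.ball (0 : EuclideanSpace ℝ (Fin d)) 1) ≤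
      ENNReal.ofReal (δ⁻¹ ^ d * 2 ^ d) *
        (∫⁻ x in Metric.ball x0 (2 * r), ENNReal.ofReal (f x) ^ d) +
      ENNReal.ofReal (δ⁻¹ ^ d * 2 ^ d * ((1 + d * δ⁻¹ + 2 * β * l * (d * δ⁻¹)) * σ ^ 2) ^ d) *
        volume (Aset u g R (M * σ ^ 2) ∩ Metric.ball x0 (r / 4)) := by
  set t := σ ^ 2 with ht
  have ht0 : 0 < t := by positivity
  set B := t * r ^ 2 * β with hB
  set κ := l / r ^ 2 with hκ
  set c1 := B * Real.exp (-4 * l) with hc1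
  have hB0 : 0 < B := by positivity
  have hκ0 : 0 < κ := by positivity
  have hBκ : B * κ = t * β * l := by rw [hB, hκ]; field_simp
  set w := barW u (u x1) c1 t B κ (g x1) x1 x0 with hw
  set G := barG g t B κ (g x1) x1 x0 with hG
  set D := barH H t B κ x0 with hD
  have hcw : C2Data w G D := barW_c2 hc _ _ _ _ _ _ _ _
  set C2 := 1 + d * δ⁻¹ + 2 * β * l * (d * δ⁻¹) with hC2
  have hC20 : 0 < C2 := by positivity
  have htr : t * r ≤ 2 * σ := by
    calc t * r ≤ t * (2 / σ) := by gcongr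
      _ = 2 * σ := by rw [ht]; field_simp
  have h8 : 8 / σ = 4 * (2 / σ) := by ring
  have hinR : ∀ z, ‖z - x0‖ ≤ 3 * r → z ∈ Metric.ball (0 : EuclideanSpace ℝ (Fin d)) R := by
    intro z hz
    rw [mem_ball_zero_iff]
    have : ‖z‖ ≤ ‖x0‖ + ‖z - x0‖ := by
      calc ‖z‖ = ‖x0 + (z - x0)‖ := by congr 1; abel
        _ ≤ _ := norm_add_le _ _
    linarith
  have hw1 : w x1 ≤ -2 * (t * r ^ 2) := by
    have e1 : -κ * r ^ 2 = -l := by rw [hκ]; field_simp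
    have : w x1 = -(t * r ^ 2 * (β * (Real.exp (-l) - Real.exp (-4 * l)))) := by
      rw [hw, barW, h01, e1, hc1, hB]; simp; ring
    rw [this]
    have := mul_le_mul_of_nonneg_left hp3 (by positivity : 0 ≤ t * r ^ 2)
    linarith
  have hw2 : ∀ z, 2 * r ≤ ‖z - x0‖ → ‖z - x0‖ ≤ 3 * r → 0 ≤ w z := by
    intro z h2 h3
    have h := hx1.2 z (Metric.ball_subset_closedBall (hinR z h3))
    have he : Real.exp (-κ * ‖z - x0‖ ^ 2) ≤ Real.exp (-4 * l) := by
      apply Real.exp_le_exp.2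
      have a1 : κ * (2 * r) ^ 2 ≤ κ * ‖z - x0‖ ^ 2 := by gcongr
      have a2 : κ * (2 * r) ^ 2 = 4 * l := by rw [hκ]; field_simp; norm_num
      linarith
    have := mul_le_mul_of_nonneg_left he hB0.le
    rw [hw, barW, hc1]
    linarith
  set Γ : Set (EuclideanSpace ℝ (Fin d)) :=
    {x | x ∈ Metric.ball x0 (2 * r) ∧ ‖G x‖ ≤ t * r / 2 ∧ w x ≤ 0 ∧
      ∀ z ∈ Metric.closedBall x0 (3 * r), w x + inner ℝ (G x) (z - x) ≤ w z} with hΓ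
  have hV := bar_surj hcw hr ht0 h01.le hw1 hw2
  rw [← hΓ] at hV
  have hwc := hcw.continuous
  have hGc := hcw.continuous_grad
  have hΓm : MeasurableSet Γ := by
    refine Metric.isOpen_ball.measurableSet.inter (IsClosed.measurableSet ?_)
    refine (isClosed_le (f := fun x => ‖G x‖) (by fun_prop) continuous_const).inter
      ((isClosed_le hwc continuous_const).inter ?_)
    exact isClosed_forall_mem fun z _ => isClosed_le (by fun_prop) continuous_const
  have hΓ2 : ∀ x ∈ Γ, ‖x - x0‖ < 2 * r := fun x hx => by
    have := hx.1
    rwa [Metric.mem_ball, dist_eq_norm] at this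
  have hpsd : ∀ x ∈ Γ, (hmat (D x)).PosSemidef := by
    intro x hx
    refine hcw.contact_psd (S := Metric.closedBall x0 (3 * r)) (p := G x) ?_ hx.2.2.2
    refine Filter.mem_of_superset (Metric.isOpen_ball.mem_nhds hx.1) ?_
    exact Metric.ball_subset_closedBall.trans (Metric.closedBall_subset_closedBall (by linarith))
  have hΓA : Γ ⊆ Aset u g R (M * t) := by
    intro x hx
    refine bar_touch ht0 hr hβ hl hM hB hκ hx1 (c1 := c1) (by positivity)
      (Metric.ball_subset_closedBall (hinR x (by linarith [hΓ2 x hx]))) (hΓ2 x hx).le hx.2.1 hx.2.2.1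
      hx.2.2.2
  have hg1 : ‖g x1‖ ≤ 2 * σ := by
    refine Aset_grad hσ hu1 hx1 ?_
    have : ‖x1‖ ≤ ‖x0‖ + ‖x1 - x0‖ := by
      calc ‖x1‖ = ‖x0 + (x1 - x0)‖ := by congr 1; abel
        _ ≤ _ := norm_add_le _ _
    have : 0 < 2 / σ := by positivity
    linarith
  have hgK : ∀ x ∈ Γ, K * ‖g x‖ ≤ t := by
    intro x hx
    set e := Real.exp (-κ * ‖x - x0‖ ^ 2) with he
    have he0 : 0 < e := Real.exp_pos _
    have he1 : e ≤ 1 := Real.exp_le_one_iff.2 (by have := sq_nonneg ‖x - x0‖; nlinarith)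
    have hgx : g x = G x + g x1 - t • (x - x1) - (2 * B * κ * e) • (x - x0) := by
      rw [hG, barG]; module
    have h2 := hΓ2 x hx
    have n1 : ‖t • (x - x1)‖ ≤ 6 * σ := by
      rw [norm_smul, Real.norm_of_nonneg ht0.le]
      have : ‖x - x1‖ ≤ 3 * r := by
        have := norm_sub_le_norm_sub_add_norm_sub x x0 x1
        rw [norm_sub_rev x0 x1] at this
        linarith
      calc t * ‖x - x1‖ ≤ t * (3 * r) := by gcongr
        _ = 3 * (t * r) := by ring
        _ ≤ _ := by linarith
    have n2 : ‖(2 * B * κ * e) • (x - x0)‖ ≤ 8 * β * l * σ := by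
      rw [norm_smul, Real.norm_of_nonneg (by positivity)]
      have q1 : 2 * B * κ * e ≤ 2 * (t * β * l) := by
        have : 2 * B * κ * e = 2 * (t * β * l) * e := by rw [← hBκ]; ring
        rw [this]; exact mul_le_of_le_one_right (by positivity) he1
      calc 2 * B * κ * e * ‖x - x0‖ ≤ 2 * (t * β * l) * (2 * r) := by gcongr
        _ = 4 * β * l * (t * r) := by ring
        _ ≤ 4 * β * l * (2 * σ) := by gcongr
        _ = _ := by ring
    have n3 : ‖g x‖ ≤ σ * (9 + 8 * β * l) := by
      rw [hgx]
      have := norm_sub_le (G x + g x1 - t • (x - x1)) ((2 * B * κ * e) • (x - x0))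
      have := norm_sub_le (G x + g x1) (t • (x - x1))
      have := norm_add_le (G x) (g x1)
      have := hx.2.1
      linarith
    calc K * ‖g x‖ ≤ K * (σ * (9 + 8 * β * l)) := by gcongr
      _ = σ * (K * (9 + 8 * β * l)) := by ring
      _ ≤ σ * σ := by gcongr
      _ = t := by rw [ht]; ring
  have htrace : ∀ x ∈ Γ, ∑ i, hmat (D x) i i ≤
      δ⁻¹ * (f x + if ‖x - x0‖ < r / 4 then C2 * t else 0) := by
    intro x hx
    refine bar_trace hδ (ha x) ht0 hr hβ hl hp1 hp2 hB hκ (hΓ2 x hx).le ?_ (hpsd x hx)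
    have := hsub x (hinR x (by linarith [hΓ2 x hx]))
    linarith [hgK x hx]
  have harea := area_le hΓm (fun x _ => hcw.hg x) hV hpsd
    (h := fun x => ENNReal.ofReal (δ⁻¹ ^ d * 2 ^ d) * ENNReal.ofReal (f x) ^ d +
      (Metric.ball x0 (r / 4)).indicator
        (fun _ => ENNReal.ofReal (δ⁻¹ ^ d * 2 ^ d * (C2 * t) ^ d)) x) (by
    intro x hx
    have h0 : 0 ≤ ∑ i, hmat (D x) i i := Finset.sum_nonneg fun i _ => (hpsd x hx).diag_nonneg
    have hfx := hf0 x
    have h1 := pow_le_pow_left₀ h0 (htrace x hx) d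
    by_cases hxr : ‖x - x0‖ < r / 4
    · rw [if_pos hxr, mul_pow] at h1
      have h2 := add_pow_le_two_pow hfx (by positivity : 0 ≤ C2 * t) d
      have hmem : x ∈ Metric.ball x0 (r / 4) := by rw [Metric.mem_ball, dist_eq_norm]; exact hxr
      rw [Set.indicator_of_mem hmem, ← ENNReal.ofReal_pow hfx, ← ENNReal.ofReal_mul (by positivity),
        ← ENNReal.ofReal_add (by positivity) (by positivity)]
      apply ENNReal.ofReal_le_ofReal
      refine h1.trans ?_
      have := mul_le_mul_of_nonneg_left h2 (by positivity : 0 ≤ δ⁻¹ ^ d)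
      linarith
    · rw [if_neg hxr, add_zero, mul_pow] at h1
      rw [← ENNReal.ofReal_pow hfx, ← ENNReal.ofReal_mul (by positivity)]
      refine le_add_right (ENNReal.ofReal_le_ofReal (h1.trans ?_))
      have : (1:ℝ) ≤ 2 ^ d := one_le_pow₀ (by norm_num)
      apply mul_le_mul_of_nonneg_right _ (by positivity)
      exact le_mul_of_one_le_right (by positivity) this)
  rw [vol_ball _ (by positivity : 0 < t * r / 2)] at harea
  refine harea.trans ?_
  rw [lintegral_add_left (by fun_prop), lintegral_const_mul _ (by fun_prop),
    lintegral_indicator_const Metric.isOpen_ball.measurableSet,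
    Measure.restrict_apply Metric.isOpen_ball.measurableSet]
  refine add_le_add ?_ ?_
  · gcongr
    exact fun x hx => hx.1
  · rw [Set.inter_comm]
    gcongr

theorem vitali_gen {d : ℕ} (ν : Measure (EuclideanSpace ℝ (Fin d)))
    {D : Set (EuclideanSpace ℝ (Fin d))} (ρ : EuclideanSpace ℝ (Fin d) → ℝ) {ρm : ℝ}
    (h0 : ∀ x ∈ D, 0 < ρ x) (hm : ∀ x ∈ D, ρ x ≤ ρm)
    (h : ∀ x ∈ D, volume (Metric.closedBall x (5 * (2 * ρ x))) ≤ ν (Metric.ball x (2 * ρ x))) :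
    volume D ≤ ν univ := by
  obtain ⟨v, hvD, hdisj, hcov⟩ := Vitali.exists_disjoint_subfamily_covering_enlargement_closedBall
    D (fun x => x) (fun x => 2 * ρ x) (2 * ρm) (fun x hx => by linarith [hm x hx]) 5 (by norm_num)
  have hvc : v.Countable := by
    refine hdisj.countable_of_nonempty_interior fun x hx => ?_
    refine Set.Nonempty.mono Metric.ball_subset_interior_closedBall ?_
    exact Metric.nonempty_ball.2 (by linarith [h0 x (hvD hx)])
  have hsub : D ⊆ ⋃ b ∈ v, Metric.closedBall b (5 * (2 * ρ b)) := by
    intro x hx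
    obtain ⟨b, hb, hxb⟩ := hcov x hx
    refine Set.mem_biUnion hb (hxb (Metric.mem_closedBall_self (by linarith [h0 x hx])))
  have hdisj2 : v.PairwiseDisjoint fun b => Metric.ball b (2 * ρ b) :=
    hdisj.mono fun b => Metric.ball_subset_closedBall
  calc volume D ≤ volume (⋃ b ∈ v, Metric.closedBall b (5 * (2 * ρ b))) := measure_mono hsub
    _ ≤ ∑' b : v, volume (Metric.closedBall (b : EuclideanSpace ℝ (Fin d)) (5 * (2 * ρ b))) :=
        measure_biUnion_le _ hvc _
    _ ≤ ∑' b : v, ν (Metric.ball (b : EuclideanSpace ℝ (Fin d)) (2 * ρ b)) :=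
        ENNReal.tsum_le_tsum fun b => h b (hvD b.2)
    _ = ν (⋃ b ∈ v, Metric.ball b (2 * ρ b)) :=
        (measure_biUnion hvc hdisj2 fun b _ => Metric.isOpen_ball.measurableSet).symm
    _ ≤ ν univ := measure_mono (subset_univ _)

theorem vitali_est {d : ℕ} {δ K : ℝ} (hδ : 0 < δ) (hK : 0 ≤ K) {β l M σ : ℝ} (hβ : 0 < β)
    (hl : 0 < l)
    (hp1 : 8 * (d * δ⁻¹ + 1) ≤ δ * l) (hp2 : d * δ⁻¹ + 1 ≤ 2 * β * l * Real.exp (-4 * l))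
    (hp3 : 2 ≤ β * (Real.exp (-l) - Real.exp (-4 * l)))
    (hM : 2 + 2 * β + 8 * β * l ≤ M) (hσ : 0 < σ) (hKσ : K * (9 + 8 * β * l) ≤ σ) {R : ℝ}
    {u : EuclideanSpace ℝ (Fin d) → ℝ}
    {g : EuclideanSpace ℝ (Fin d) → EuclideanSpace ℝ (Fin d)}
    {H : EuclideanSpace ℝ (Fin d) → EuclideanSpace ℝ (Fin d) →L[ℝ] EuclideanSpace ℝ (Fin d)}
    {a : EuclideanSpace ℝ (Fin d) → Matrix (Fin d) (Fin d) ℝ}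
    {f : EuclideanSpace ℝ (Fin d) → ℝ} (hc : C2Data u g H) (ha : ∀ x, EllMat δ (a x))
    (hf : Measurable f) (hf0 : ∀ x, 0 ≤ f x)
    (hsub : ∀ x ∈ Metric.ball (0 : EuclideanSpace ℝ (Fin d)) R,
      ∑ i, ∑ j, a x i j * hmat (H x) i j ≤ f x + K * ‖g x‖)
    (hu1 : ∀ x ∈ Metric.closedBall (0 : EuclideanSpace ℝ (Fin d)) R, |u x| ≤ 1) :
    volume ({x | ‖x‖ + 8 / σ ≤ R} \ Aset u g R (σ ^ 2)) ≤
      ENNReal.ofReal ((20 / σ ^ 2) ^ d * (δ⁻¹ ^ d * 2 ^ d)) *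
        (∫⁻ x in Metric.ball 0 R, ENNReal.ofReal (f x) ^ d) +
      ENNReal.ofReal (20 ^ d * (δ⁻¹ ^ d * 2 ^ d) * (1 + d * δ⁻¹ + 2 * β * l * (d * δ⁻¹)) ^ d) *
        volume (Metric.ball 0 R ∩ (Aset u g R (M * σ ^ 2) \ Aset u g R (σ ^ 2))) := by
  set A := Aset u g R (σ ^ 2) with hA
  have hAc : IsClosed A := Aset_isClosed hc.continuous hc.continuous_grad _ _
  have hAc2 : IsClosed (Aset u g R (M * σ ^ 2)) :=
    Aset_isClosed hc.continuous hc.continuous_grad _ _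
  have hAK : IsCompact A := (isCompact_closedBall (0 : EuclideanSpace ℝ (Fin d)) R).of_isClosed_subset
    hAc fun x hx => hx.1
  set C2 := 1 + d * δ⁻¹ + 2 * β * l * (d * δ⁻¹) with hC2
  have hC20 : 0 < C2 := by positivity
  set S := Metric.ball 0 R ∩ (Aset u g R (M * σ ^ 2) \ A) with hS
  have hSm : MeasurableSet S :=
    Metric.isOpen_ball.measurableSet.inter (hAc2.measurableSet.diff hAc.measurableSet)
  set q1 := ENNReal.ofReal ((20 / σ ^ 2) ^ d * (δ⁻¹ ^ d * 2 ^ d)) with hq1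
  set q2 := ENNReal.ofReal (20 ^ d * (δ⁻¹ ^ d * 2 ^ d) * C2 ^ d) with hq2
  set ν : Measure (EuclideanSpace ℝ (Fin d)) :=
    q1 • (volume.restrict (Metric.ball 0 R)).withDensity (fun x => ENNReal.ofReal (f x) ^ d) +
    q2 • volume.restrict S with hν
  have hνu : ν univ = q1 * (∫⁻ x in Metric.ball 0 R, ENNReal.ofReal (f x) ^ d) + q2 * volume S := by
    simp [hν]
  rw [← hνu]
  have h8 : 8 / σ = 4 * (2 / σ) := by ring
  have hσ2 : 0 < 2 / σ := by positivity
  have hnear : ∀ x ∈ {x : EuclideanSpace ℝ (Fin d) | ‖x‖ + 8 / σ ≤ R} \ A,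
      ∃ x1 ∈ A, ‖x1 - x‖ = Metric.infDist x A ∧ 0 < Metric.infDist x A ∧
        Metric.infDist x A ≤ 2 / σ := by
    intro x hx
    have hx1 : ‖x‖ + 8 / σ ≤ R := hx.1
    obtain ⟨y, hy, hyd⟩ := Aset_near hc hσ hu1 (x0 := x) (by linarith)
    obtain ⟨x1, hx1A, hx1d⟩ := hAK.exists_infDist_eq_dist ⟨y, hy⟩ x
    refine ⟨x1, hx1A, by rw [hx1d, dist_comm, dist_eq_norm], ?_,
      (Metric.infDist_le_dist_of_mem hy).trans hyd⟩
    exact (hAc.notMem_iff_infDist_pos ⟨y, hy⟩).1 hx.2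
  refine vitali_gen ν (fun x => Metric.infDist x A) (ρm := 2 / σ) ?_ ?_ ?_
  · intro x hx
    obtain ⟨_, _, _, h, _⟩ := hnear x hx
    exact h
  · intro x hx
    obtain ⟨_, _, _, _, h⟩ := hnear x hx
    exact h
  · intro x hx
    obtain ⟨x1, hx1, h01, hr, hr2⟩ := hnear x hx
    have hxR : ‖x‖ + 8 / σ ≤ R := hx.1
    have hb := barrier hδ hK hβ hl hp1 hp2 hp3 hM hσ hKσ hc ha hf hf0 hsub hu1 hxR hx1 h01 hr hr2
    set r := Metric.infDist x A with hrdef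
    show volume (Metric.closedBall x (5 * (2 * r))) ≤ ν (Metric.ball x (2 * r))
    have hball : Metric.ball x (2 * r) ⊆ Metric.ball 0 R := by
      apply Metric.ball_subset_ball'
      rw [dist_zero_right]
      linarith
    have hr4 : Aset u g R (M * σ ^ 2) ∩ Metric.ball x (r / 4) ⊆ Metric.ball x (2 * r) ∩ S := by
      intro y hy
      have h1 : y ∈ Metric.ball x (2 * r) := Metric.ball_subset_ball (by linarith) hy.2
      refine ⟨h1, hball h1, hy.1, fun hyA => ?_⟩
      have h2 := Metric.infDist_le_dist_of_mem (x := x) hyA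
      have h3 := hy.2
      rw [Metric.mem_ball, dist_comm] at h3
      linarith
    have hνb : ν (Metric.ball x (2 * r)) =
        q1 * (∫⁻ x in Metric.ball x (2 * r), ENNReal.ofReal (f x) ^ d) +
          q2 * volume (Metric.ball x (2 * r) ∩ S) := by
      rw [hν, Measure.add_apply, Measure.smul_apply, Measure.smul_apply,
        withDensity_apply _ Metric.isOpen_ball.measurableSet,
        Measure.restrict_restrict Metric.isOpen_ball.measurableSet,
        Measure.restrict_apply Metric.isOpen_ball.measurableSet,
        Set.inter_eq_self_of_subset_left hball]
      rfl
    rw [hνb, vol_closedBall _ (by positivity)]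
    have e1 : ENNReal.ofReal ((5 * (2 * r)) ^ d) * volume (Metric.ball (0 : EuclideanSpace ℝ (Fin d)) 1)
        = ENNReal.ofReal ((20 / σ ^ 2) ^ d) * (ENNReal.ofReal ((σ ^ 2 * r / 2) ^ d) *
          volume (Metric.ball (0 : EuclideanSpace ℝ (Fin d)) 1)) := by
      rw [← mul_assoc (ENNReal.ofReal _), ← ENNReal.ofReal_mul (by positivity), ← mul_pow]
      congr 3
      field_simp
      norm_num
    rw [e1]
    refine (mul_le_mul_right hb _).trans ?_
    rw [mul_add, ← mul_assoc, ← mul_assoc, ← ENNReal.ofReal_mul (by positivity),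
      ← ENNReal.ofReal_mul (by positivity)]
    refine add_le_add le_rfl ?_
    have e2 : (20 / σ ^ 2) ^ d * (δ⁻¹ ^ d * 2 ^ d * (C2 * σ ^ 2) ^ d) =
        20 ^ d * (δ⁻¹ ^ d * 2 ^ d) * C2 ^ d := by
      rw [mul_pow, div_pow]
      field_simp
    rw [e2]
    gcongr

theorem vol_annulus {d : ℕ} {R s : ℝ} (hs0 : 0 ≤ s) (hsR : s ≤ R) (hR1 : R ≤ 1) (hR0 : 0 < R) :
    volume (Metric.ball (0 : EuclideanSpace ℝ (Fin d)) R \ {x | ‖x‖ + s ≤ R}) ≤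
      ENNReal.ofReal (d * s) * volume (Metric.ball (0 : EuclideanSpace ℝ (Fin d)) 1) := by
  have hset : {x : EuclideanSpace ℝ (Fin d) | ‖x‖ + s ≤ R} = Metric.closedBall 0 (R - s) := by
    ext x; simp [le_sub_iff_add_le]
  rw [hset]
  rcases hs0.eq_or_lt with h0 | h0
  · rw [← h0, sub_zero, Set.sdiff_eq_empty.2 Metric.ball_subset_closedBall]; simp
  rw [measure_sdiff (Metric.closedBall_subset_ball (by linarith))
    Metric.isClosed_closedBall.nullMeasurableSet measure_closedBall_lt_top.ne,
    vol_ball _ hR0, vol_closedBall _ (by linarith)]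
  rw [tsub_le_iff_right, ← add_mul, ← ENNReal.ofReal_add (by positivity) (by
    have : 0 ≤ R - s := by linarith
    positivity)]
  gcongr
  have h1 := one_add_mul_le_pow (a := -(s / R)) (by
    have : s / R ≤ 1 := (div_le_one hR0).2 hsR
    linarith) d
  have h2 : (R - s) ^ d = R ^ d * (1 + -(s / R)) ^ d := by
    rw [← mul_pow]; congr 1; field_simp; ring
  have h3 : R ^ d * (1 + d * -(s / R)) ≤ R ^ d * (1 + -(s / R)) ^ d := by gcongr
  rw [h2]
  have h4 : R ^ d * (d * (s / R)) ≤ d * s := by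
    rcases Nat.eq_zero_or_pos d with hd | hd
    · subst hd; simp
    · obtain ⟨n, rfl⟩ : ∃ n, d = n + 1 := ⟨d - 1, by omega⟩
      have : R ^ (n + 1) * (((n + 1 : ℕ) : ℝ) * (s / R)) = R ^ n * (((n + 1 : ℕ) : ℝ) * s) := by
        field_simp
        ring
      rw [this]
      exact mul_le_of_le_one_left (by positivity) (pow_le_one₀ hR0.le hR1)
  linarith

theorem recurrence {m : ℕ → ℝ} {C E θ B μ : ℝ} (hC : 1 ≤ C) (hE : 0 ≤ E) (hμ : 0 < μ)
    (hθ1 : 1 - 1 / (2 * C) ≤ θ) (hθ2 : μ⁻¹ ≤ θ) (hB0 : m 0 ≤ B) (hB : 2 * C * E ≤ B)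
    (h : ∀ k, C * m (k + 1) ≤ (C - 1) * m k + E * μ⁻¹ ^ k) (k : ℕ) : m k ≤ B * θ ^ k := by
  have hμi : 0 < μ⁻¹ := inv_pos.2 hμ
  have hθ0 : 0 < θ := hμi.trans_le hθ2
  induction k with
  | zero => simpa using hB0
  | succ k ih =>
    have h1 := h k
    have h2 : μ⁻¹ ^ k ≤ θ ^ k := by gcongr
    have h3 : (C - 1) * m k ≤ (C - 1) * (B * θ ^ k) :=
      mul_le_mul_of_nonneg_left ih (by linarith)
    have h4 : E * μ⁻¹ ^ k ≤ E * θ ^ k := by gcongr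
    have hB1 : 0 ≤ B := le_trans (by positivity) hB
    have h5 : C - 1 / 2 ≤ C * θ := by
      have := mul_le_mul_of_nonneg_left hθ1 (by linarith : 0 ≤ C)
      have e : C * (1 - 1 / (2 * C)) = C - 1 / 2 := by field_simp
      linarith
    have h6 : (C - 1 / 2) * (B * θ ^ k) ≤ C * θ * (B * θ ^ k) :=
      mul_le_mul_of_nonneg_right h5 (by positivity)
    have h7 : E * θ ^ k ≤ 1 / 2 * B * θ ^ k := by
      have : E ≤ 1 / 2 * B := by nlinarith
      gcongr
    have h8 : C * m (k + 1) ≤ C * (B * θ ^ (k + 1)) := by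
      rw [pow_succ]
      linarith
    exact le_of_mul_le_mul_left h8 (by linarith)

set_option maxHeartbeats 1000000 in
theorem decay (d : ℕ) (hd : 1 ≤ d) (δ K : ℝ) (hδ : 0 < δ) (hK : 0 ≤ K) (Φ : ℝ) (hΦ : 0 ≤ Φ) :
    ∃ μ σ0 θ B : ℝ, 1 < μ ∧ 17 ≤ σ0 ∧ 0 < θ ∧ θ < 1 ∧ μ⁻¹ ≤ θ ∧ 0 < B ∧
      ∀ R, 1 / 2 ≤ R → R ≤ 1 → ∀ (u : EuclideanSpace ℝ (Fin d) → ℝ)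
        (g : EuclideanSpace ℝ (Fin d) → EuclideanSpace ℝ (Fin d))
        (H : EuclideanSpace ℝ (Fin d) → EuclideanSpace ℝ (Fin d) →L[ℝ] EuclideanSpace ℝ (Fin d))
        (a : EuclideanSpace ℝ (Fin d) → Matrix (Fin d) (Fin d) ℝ)
        (f : EuclideanSpace ℝ (Fin d) → ℝ),
        C2Data u g H → (∀ x, EllMat δ (a x)) → Measurable f → (∀ x, 0 ≤ f x) →
        (∀ x ∈ Metric.ball (0 : EuclideanSpace ℝ (Fin d)) R,
          ∑ i, ∑ j, a x i j * hmat (H x) i j ≤ f x + K * ‖g x‖) →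
        (∀ x ∈ Metric.closedBall (0 : EuclideanSpace ℝ (Fin d)) R, |u x| ≤ 1) →
        ∫⁻ x in Metric.ball (0 : EuclideanSpace ℝ (Fin d)) R, ENNReal.ofReal (f x) ^ d ≤
          ENNReal.ofReal Φ →
        ∀ k : ℕ, volume (Metric.ball 0 R \ Aset u g R ((σ0 * μ ^ k) ^ 2)) ≤
          ENNReal.ofReal (B * θ ^ k) := by
  have hdd : 0 < d * δ⁻¹ + 1 := by positivity
  set l := 8 * (d * δ⁻¹ + 1) / δ with hl
  have hl0 : 0 < l := by positivity
  have hp1 : 8 * (d * δ⁻¹ + 1) ≤ δ * l := by rw [hl]; field_simp; exact le_rfl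
  have hexp : 0 < Real.exp (-l) - Real.exp (-4 * l) := by
    rw [sub_pos]; apply Real.exp_lt_exp.2; linarith
  set β := (d * δ⁻¹ + 1) / (2 * l * Real.exp (-4 * l)) +
    2 / (Real.exp (-l) - Real.exp (-4 * l)) with hβ
  have hβ0 : 0 < β := by have := Real.exp_pos (-4 * l); positivity
  have hp2 : d * δ⁻¹ + 1 ≤ 2 * β * l * Real.exp (-4 * l) := by
    have h1 : (d * δ⁻¹ + 1) / (2 * l * Real.exp (-4 * l)) ≤ β := by
      rw [hβ]; have : 0 < 2 / (Real.exp (-l) - Real.exp (-4 * l)) := by positivity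
      linarith
    rw [div_le_iff₀ (by positivity)] at h1
    linarith
  have hp3 : 2 ≤ β * (Real.exp (-l) - Real.exp (-4 * l)) := by
    have h1 : 2 / (Real.exp (-l) - Real.exp (-4 * l)) ≤ β := by
      rw [hβ]
      have : 0 < (d * δ⁻¹ + 1) / (2 * l * Real.exp (-4 * l)) := by positivity
      linarith
    rwa [div_le_iff₀ hexp] at h1
  clear_value l β
  set μ := 2 + 2 * β + 8 * β * l with hμ
  have hμ2 : 2 < μ := by have := mul_pos hβ0 hl0; nlinarith
  have hM : 2 + 2 * β + 8 * β * l ≤ μ ^ 2 := by rw [← hμ]; nlinarith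
  set σ0 := 17 + K * (9 + 8 * β * l) with hσ0
  have hσ17 : 17 ≤ σ0 := by
    have : 0 ≤ K * (9 + 8 * β * l) := by positivity
    linarith
  set ω := volume (Metric.ball (0 : EuclideanSpace ℝ (Fin d)) 1) with hω
  set C2 := 1 + d * δ⁻¹ + 2 * β * l * (d * δ⁻¹) with hC2
  have hC20 : 0 < C2 := by positivity
  set C0 := 20 ^ d * (δ⁻¹ ^ d * 2 ^ d) * C2 ^ d with hC0
  have hC00 : 0 < C0 := by positivity
  set C := C0 + 1 with hC
  set E := 8 * d * ω.toReal + 20 ^ d * (δ⁻¹ ^ d * 2 ^ d) * Φ with hE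
  have hE0 : 0 ≤ E := by positivity
  set θ := max (1 - 1 / (2 * C)) μ⁻¹ with hθ
  set B := ω.toReal + 2 * C * E with hB
  have hω0 : 0 < ω.toReal := ENNReal.toReal_pos (omega_pos d).ne' (omega_lt_top d).ne
  refine ⟨μ, σ0, θ, B, by linarith, hσ17, ?_, ?_, le_max_right _ _, by positivity, ?_⟩
  · exact lt_of_lt_of_le (by positivity) (le_max_right _ _)
  · refine max_lt ?_ (inv_lt_one_of_one_lt₀ (by linarith))
    have : 0 < 1 / (2 * C) := by positivity
    linarith
  intro R hR0 hR1 u g H a f hc ha hf hf0 hsub hu1 hIntg k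
  set A : ℕ → Set (EuclideanSpace ℝ (Fin d)) := fun k => Aset u g R ((σ0 * μ ^ k) ^ 2) with hA
  have hAm : ∀ k, MeasurableSet (A k) := fun k =>
    (Aset_isClosed hc.continuous hc.continuous_grad _ _).measurableSet
  have hμk : ∀ k : ℕ, 1 ≤ μ ^ k := fun k => one_le_pow₀ (by linarith)
  have hAmono : ∀ k, A k ⊆ A (k + 1) := by
    intro k
    apply Aset_mono
    have := hμk k
    have h2 : μ ^ k ≤ μ ^ (k + 1) := pow_le_pow_right₀ (by linarith) (by omega)
    gcongr
  set m : ℕ → ℝ≥0∞ := fun k => volume (Metric.ball 0 R \ A k) with hm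
  have hmfin : ∀ k, m k ≠ ∞ := fun k =>
    (lt_of_le_of_lt (measure_mono Set.sdiff_subset) measure_ball_lt_top).ne
  have hmle : ∀ k, m k ≤ ω := fun k => by
    refine measure_mono (Set.sdiff_subset.trans (Metric.ball_subset_ball hR1))
  have hdiff : ∀ k, volume (Metric.ball 0 R ∩ (A (k + 1) \ A k)) = m k - m (k + 1) := by
    intro k
    rw [hm, ← measure_sdiff (Set.sdiff_subset_sdiff_right (hAmono k))
      ((Metric.isOpen_ball.measurableSet.diff (hAm (k+1))).nullMeasurableSet) (hmfin (k+1))]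
    congr 1
    ext x
    simp only [mem_inter_iff, mem_sdiff]
    tauto
  have hmono : ∀ k, m (k + 1) ≤ m k := fun k =>
    measure_mono (Set.sdiff_subset_sdiff_right (hAmono k))
  -- recurrence
  have hrec : ∀ k : ℕ, C * (m (k + 1)).toReal ≤ (C - 1) * (m k).toReal + E * μ⁻¹ ^ k := by
    intro k
    set σ := σ0 * μ ^ k with hσ
    have hσ1 : σ0 ≤ σ := le_mul_of_one_le_right (by linarith) (hμk k)
    have hσpos : 0 < σ := by linarith
    have hs : 8 / σ ≤ R := by
      rw [div_le_iff₀ hσpos]; nlinarith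
    have hv := vitali_est hδ hK hβ0 hl0 hp1 hp2 hp3 hM hσpos (by linarith) hc ha hf hf0 hsub hu1
    have hA1 : Aset u g R (μ ^ 2 * σ ^ 2) = A (k + 1) := by
      rw [hA, hσ]; congr 1; ring
    rw [hA1, show Aset u g R (σ ^ 2) = A k from rfl, hdiff k] at hv
    have hann := vol_annulus (d := d) (s := 8 / σ) (by positivity) hs hR1 (by linarith)
    have hcov : Metric.ball 0 R \ A k ⊆ ({x | ‖x‖ + 8 / σ ≤ R} \ A k) ∪
        (Metric.ball (0 : EuclideanSpace ℝ (Fin d)) R \ {x | ‖x‖ + 8 / σ ≤ R}) := by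
      intro x hx
      by_cases hx2 : ‖x‖ + 8 / σ ≤ R
      · exact Or.inl ⟨hx2, hx.2⟩
      · exact Or.inr ⟨hx.1, hx2⟩
    have hmk : m k ≤ ENNReal.ofReal ((20 / σ ^ 2) ^ d * (δ⁻¹ ^ d * 2 ^ d)) * ENNReal.ofReal Φ +
        ENNReal.ofReal C0 * (m k - m (k + 1)) + ENNReal.ofReal (d * (8 / σ)) * ω := by
      refine (measure_mono hcov).trans ((measure_union_le _ _).trans (add_le_add (hv.trans ?_) hann))
      gcongr
    have hfin2 : m k - m (k + 1) ≠ ∞ := (tsub_le_self.trans_lt (hmfin k).lt_top).ne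
    have hr := ENNReal.toReal_mono (by
      refine ENNReal.add_ne_top.2 ⟨ENNReal.add_ne_top.2 ⟨?_, ?_⟩, ?_⟩
      · exact ENNReal.mul_ne_top ofReal_ne_top ofReal_ne_top
      · exact ENNReal.mul_ne_top ofReal_ne_top hfin2
      · exact ENNReal.mul_ne_top ofReal_ne_top (omega_lt_top d).ne) hmk
    rw [ENNReal.toReal_add (ENNReal.add_ne_top.2 ⟨ENNReal.mul_ne_top ofReal_ne_top ofReal_ne_top,
      ENNReal.mul_ne_top ofReal_ne_top hfin2⟩)
      (ENNReal.mul_ne_top ofReal_ne_top (omega_lt_top d).ne),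
      ENNReal.toReal_add (ENNReal.mul_ne_top ofReal_ne_top ofReal_ne_top)
      (ENNReal.mul_ne_top ofReal_ne_top hfin2), ENNReal.toReal_mul, ENNReal.toReal_mul,
      ENNReal.toReal_mul, ENNReal.toReal_sub_of_le (hmono k) (hmfin k),
      ENNReal.toReal_ofReal (by positivity), ENNReal.toReal_ofReal hΦ,
      ENNReal.toReal_ofReal hC00.le, ENNReal.toReal_ofReal (by positivity)] at hr
    have hσinv : 1 / σ ≤ μ⁻¹ ^ k := by
      rw [inv_pow, ← one_div, hσ]
      have := hμk k
      apply one_div_le_one_div_of_le (by positivity)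
      exact le_mul_of_one_le_left (by positivity) (by linarith)
    have hσd : (1 / σ ^ 2) ^ d ≤ μ⁻¹ ^ k := by
      have h1 : 1 / σ ^ 2 ≤ 1 / σ := by
        apply one_div_le_one_div_of_le hσpos; nlinarith
      have h2 : 1 / σ ^ 2 ≤ 1 := by
        rw [div_le_one (by positivity)]; nlinarith
      calc (1 / σ ^ 2) ^ d ≤ (1 / σ ^ 2) ^ 1 := pow_le_pow_of_le_one (by positivity) h2 hd
        _ ≤ _ := by rw [pow_one]; exact h1.trans hσinv
    have t1 : (20 / σ ^ 2) ^ d * (δ⁻¹ ^ d * 2 ^ d) * Φ ≤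
        20 ^ d * (δ⁻¹ ^ d * 2 ^ d) * Φ * μ⁻¹ ^ k := by
      have : (20 / σ ^ 2) ^ d * (δ⁻¹ ^ d * 2 ^ d) * Φ =
        20 ^ d * (δ⁻¹ ^ d * 2 ^ d) * Φ * (1 / σ ^ 2) ^ d := by
        rw [div_eq_mul_one_div, mul_pow]; ring
      rw [this]; gcongr
    have t2 : d * (8 / σ) * ω.toReal ≤ 8 * d * ω.toReal * μ⁻¹ ^ k := by
      have : d * (8 / σ) * ω.toReal = 8 * d * ω.toReal * (1 / σ) := by ring
      rw [this]; gcongr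
    have hmm := ENNReal.toReal_mono (hmfin k) (hmono k)
    rw [hC, hE]
    linarith
  have hfinal := recurrence (m := fun k => (m k).toReal) (by linarith : 1 ≤ C) hE0
    (by linarith : 0 < μ) (le_max_left _ _) (le_max_right _ _)
    (B := B) ((ENNReal.toReal_mono (omega_lt_top d).ne (hmle 0)).trans (by
      have : 0 ≤ 2 * C * E := by positivity
      linarith)) (by linarith) hrec k
  change m k ≤ _
  rw [← ENNReal.ofReal_toReal (hmfin k)]
  exact ENNReal.ofReal_le_ofReal hfinal

theorem layer {α : Type*} [MeasurableSpace α] (ν : Measure α) {v : α → ℝ} (hv : Measurable v)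
    (hv0 : ∀ x, 0 ≤ v x) {s0 p B θ γ : ℝ} (hs0 : 0 < s0) (hp : 1 < p) (hB : 0 ≤ B) (hθ : 0 < θ)
    (hγ : 0 < γ) (hq : p ^ γ * θ < 1)
    (hdec : ∀ k : ℕ, ν {x | s0 * p ^ k < v x} ≤ ENNReal.ofReal (B * θ ^ k)) :
    ∫⁻ x, ENNReal.ofReal (v x) ^ γ ∂ν ≤ ENNReal.ofReal (s0 ^ γ) * ν univ +
      ENNReal.ofReal ((s0 * p) ^ γ * B * (1 - p ^ γ * θ)⁻¹) := by
  have hp0 : 0 < p := by linarith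
  set T : ℕ → Set α := fun k => {x | s0 * p ^ k < v x} with hT
  have hTm : ∀ k, MeasurableSet (T k) := fun k => measurableSet_lt measurable_const hv
  have hpt : ∀ x, ENNReal.ofReal (v x) ^ γ ≤ ENNReal.ofReal (s0 ^ γ) +
      ∑' k, (T k).indicator (fun _ => ENNReal.ofReal ((s0 * p ^ (k + 1)) ^ γ)) x := by
    intro x
    rw [ENNReal.ofReal_rpow_of_nonneg (hv0 x) hγ.le]
    have hex : ∃ k : ℕ, v x ≤ s0 * p ^ k := by
      obtain ⟨k, hk⟩ := pow_unbounded_of_one_lt (v x / s0) hp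
      refine ⟨k, ?_⟩
      rw [div_lt_iff₀ hs0] at hk
      linarith
    classical
    set k := Nat.find hex with hk
    have hks : v x ≤ s0 * p ^ k := Nat.find_spec hex
    rcases Nat.eq_zero_or_pos k with h0 | h0
    · rw [h0, pow_zero, mul_one] at hks
      refine le_add_right (ENNReal.ofReal_le_ofReal ?_)
      exact Real.rpow_le_rpow (hv0 x) hks hγ.le
    · obtain ⟨n, hn⟩ : ∃ n, k = n + 1 := ⟨k - 1, by omega⟩
      have hlt : s0 * p ^ n < v x := by
        have := Nat.find_min hex (m := n) (by omega)
        push Not at this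
        exact this
      refine le_add_left (le_trans ?_ (ENNReal.le_tsum n))
      rw [Set.indicator_of_mem (show x ∈ T n from hlt)]
      apply ENNReal.ofReal_le_ofReal
      rw [hn] at hks
      exact Real.rpow_le_rpow (hv0 x) hks hγ.le
  refine (lintegral_mono hpt).trans ?_
  rw [lintegral_add_left measurable_const, lintegral_const, lintegral_tsum fun k =>
    (measurable_const.indicator (hTm k)).aemeasurable]
  gcongr
  have hq0 : 0 < p ^ γ * θ := by positivity
  have hterm : ∀ k : ℕ, ∫⁻ x, (T k).indicator
      (fun _ => ENNReal.ofReal ((s0 * p ^ (k + 1)) ^ γ)) x ∂ν ≤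
      ENNReal.ofReal ((s0 * p) ^ γ * B * (p ^ γ * θ) ^ k) := by
    intro k
    rw [lintegral_indicator_const (hTm k)]
    refine (mul_le_mul_right (hdec k) _).trans ?_
    rw [← ENNReal.ofReal_mul (by positivity)]
    apply ENNReal.ofReal_le_ofReal
    have e : (s0 * p ^ (k + 1)) ^ γ = (s0 * p) ^ γ * (p ^ γ) ^ k := by
      rw [pow_succ', ← mul_assoc, Real.mul_rpow (by positivity) (by positivity)]
      congr 1
      rw [← Real.rpow_natCast, ← Real.rpow_natCast, ← Real.rpow_mul hp0.le, ← Real.rpow_mul hp0.le]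
      ring_nf
    rw [e, mul_pow]
    apply le_of_eq; ring
  refine (ENNReal.tsum_le_tsum hterm).trans ?_
  have hs := (hasSum_geometric_of_lt_one hq0.le hq).mul_left ((s0 * p) ^ γ * B)
  rw [← ENNReal.ofReal_tsum_of_nonneg (fun k => by positivity) hs.summable, hs.tsum_eq]

theorem measurable_hmat {d : ℕ} {u : EuclideanSpace ℝ (Fin d) → ℝ}
    {g : EuclideanSpace ℝ (Fin d) → EuclideanSpace ℝ (Fin d)}
    {H : EuclideanSpace ℝ (Fin d) → EuclideanSpace ℝ (Fin d) →L[ℝ] EuclideanSpace ℝ (Fin d)}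
    (hc : C2Data u g H) (i j : Fin d) : Measurable fun x => hmat (H x) i j := by
  have h : H = fderiv ℝ g := by
    funext x; exact (hc.hg x).fderiv.symm
  rw [h]
  have h1 := measurable_fderiv_apply_const ℝ g (EuclideanSpace.single j (1:ℝ))
  exact (by fun_prop : Measurable fun x : EuclideanSpace ℝ (Fin d) => x i).comp h1

theorem measurable_frob {d : ℕ} {A : EuclideanSpace ℝ (Fin d) → Matrix (Fin d) (Fin d) ℝ}
    (h : ∀ i j, Measurable fun x => A x i j) : Measurable fun x => frobNorm (A x) := by
  unfold frobNorm
  fun_prop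

/-- Hessian bound at contact points. -/
theorem hess_bound {d : ℕ} {δ K : ℝ} (hδ : 0 < δ) (hK : 0 ≤ K) {σ : ℝ} (hσ : 1 ≤ σ) {R : ℝ}
    {u : EuclideanSpace ℝ (Fin d) → ℝ}
    {g : EuclideanSpace ℝ (Fin d) → EuclideanSpace ℝ (Fin d)}
    {H : EuclideanSpace ℝ (Fin d) → EuclideanSpace ℝ (Fin d) →L[ℝ] EuclideanSpace ℝ (Fin d)}
    {a : EuclideanSpace ℝ (Fin d) → Matrix (Fin d) (Fin d) ℝ}
    {f : EuclideanSpace ℝ (Fin d) → ℝ} (hc : C2Data u g H) (ha : ∀ x, EllMat δ (a x))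
    (hsub : ∀ x ∈ Metric.ball (0 : EuclideanSpace ℝ (Fin d)) R,
      ∑ i, ∑ j, a x i j * hmat (H x) i j ≤ f x + K * ‖g x‖)
    (hu1 : ∀ x ∈ Metric.closedBall (0 : EuclideanSpace ℝ (Fin d)) R, |u x| ≤ 1)
    {x : EuclideanSpace ℝ (Fin d)} (hx : x ∈ Aset u g R (σ ^ 2)) (hxR : ‖x‖ + 8 / σ ≤ R)
    (hfx0 : 0 ≤ f x) (hfx : f x ≤ σ ^ 2) :
    frobNorm (hmat (H x)) ≤ d * (δ⁻¹ * (1 + 2 * K + d * δ⁻¹) + 1) * σ ^ 2 := by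
  have hσ0 : 0 < σ := by linarith
  have hσ8 : 0 < 8 / σ := by positivity
  have hxb : x ∈ Metric.ball (0 : EuclideanSpace ℝ (Fin d)) R := by
    rw [mem_ball_zero_iff]; linarith
  set t := σ ^ 2 with ht
  have ht0 : 0 < t := by positivity
  have hcw := barW_c2 hc (u x) 0 t 0 0 (g x) x x
  have hpsd : (hmat (barH H t 0 0 x x)).PosSemidef := by
    refine hcw.contact_psd (S := Metric.closedBall 0 R) (p := 0)
      (Filter.mem_of_superset (Metric.isOpen_ball.mem_nhds hxb) Metric.ball_subset_closedBall) ?_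
    intro z hz
    have := hx.2 z hz
    simp [barW]
    linarith
  have htr := ell_trace_le (ha x) hpsd
  rw [barH_sum] at htr
  have hdiag := ell_trace_diag (ha x)
  have hs := hsub x hxb
  have hg : ‖g x‖ ≤ 2 * σ := by
    refine Aset_grad hσ0 hu1 hx ?_
    have : 8 / σ = 4 * (2 / σ) := by ring
    have : 0 < 2 / σ := by positivity
    linarith
  have hKg : K * ‖g x‖ ≤ 2 * K * t := by
    calc K * ‖g x‖ ≤ K * (2 * σ) := by gcongr
      _ ≤ K * (2 * (σ * σ)) := by gcongr; nlinarith
      _ = _ := by rw [ht]; ring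
  have htd : t * ∑ i, a x i i ≤ t * (d * δ⁻¹) := by gcongr
  have hT : ∑ i, hmat (barH H t 0 0 x x) i i ≤ δ⁻¹ * (1 + 2 * K + d * δ⁻¹) * t := by
    have : δ * ∑ i, hmat (barH H t 0 0 x x) i i ≤ (1 + 2 * K + d * δ⁻¹) * t := by
      simp only [mul_zero, zero_mul, add_zero, sub_zero] at htr
      linarith
    have := mul_le_mul_of_nonneg_left this (inv_pos.2 hδ).le
    rw [← mul_assoc, inv_mul_cancel₀ hδ.ne', one_mul] at this
    linarith
  have hent : ∀ i j, |hmat (H x) i j| ≤ (δ⁻¹ * (1 + 2 * K + d * δ⁻¹) + 1) * t := by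
    intro i j
    have h1 := (entry_le_trace hpsd i j).trans hT
    have h2 : hmat (H x) i j = hmat (barH H t 0 0 x x) i j - t * (if i = j then 1 else 0) := by
      by_cases hij : i = j
      · simp [hmat, barH, hij]
      · simp [hmat, barH, hij]
    rw [h2]
    have h3 : |t * (if i = j then 1 else 0)| ≤ t := by
      split_ifs
      · rw [mul_one, abs_of_pos ht0]
      · simp [ht0.le]
    have := abs_sub (hmat (barH H t 0 0 x x) i j) (t * (if i = j then 1 else 0))
    linarith
  have := frobNorm_le (by positivity) hent
  linarith

theorem exists_gamma {p θ : ℝ} (hp : 1 < p) (hθ : 0 < θ) (hθ1 : θ < 1) :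
    ∃ γ : ℝ, 0 < γ ∧ γ ≤ 1 ∧ p ^ γ * θ < 1 := by
  have hlp : 0 < Real.log p := Real.log_pos hp
  have hlt : Real.log θ < 0 := Real.log_neg hθ hθ1
  refine ⟨min 1 (-Real.log θ / (2 * Real.log p)), lt_min one_pos (div_pos (by linarith) (by linarith)),
    min_le_left _ _, ?_⟩
  rw [Real.rpow_def_of_pos (by linarith)]
  nth_rewrite 2 [← Real.exp_log hθ]
  rw [← Real.exp_add, Real.exp_lt_one_iff]
  have h1 : Real.log p * min 1 (-Real.log θ / (2 * Real.log p)) ≤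
      Real.log p * (-Real.log θ / (2 * Real.log p)) :=
    mul_le_mul_of_nonneg_left (min_le_right _ _) hlp.le
  have h2 : Real.log p * (-Real.log θ / (2 * Real.log p)) = -Real.log θ / 2 := by
    field_simp
  linarith

/-- The normalised smooth estimate. -/
theorem normalised (d : ℕ) (hd : 1 ≤ d) (δ K : ℝ) (hδ : 0 < δ) (hK : 0 ≤ K) (Φ : ℝ) (hΦ : 0 ≤ Φ) :
    ∃ γ N : ℝ, 0 < γ ∧ γ ≤ 1 ∧ 0 < N ∧
      ∀ R, 1 / 2 ≤ R → R ≤ 1 → ∀ (u : EuclideanSpace ℝ (Fin d) → ℝ)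
        (g : EuclideanSpace ℝ (Fin d) → EuclideanSpace ℝ (Fin d))
        (H : EuclideanSpace ℝ (Fin d) → EuclideanSpace ℝ (Fin d) →L[ℝ] EuclideanSpace ℝ (Fin d))
        (a : EuclideanSpace ℝ (Fin d) → Matrix (Fin d) (Fin d) ℝ)
        (f : EuclideanSpace ℝ (Fin d) → ℝ),
        C2Data u g H → (∀ x, EllMat δ (a x)) → Measurable f → (∀ x, 0 ≤ f x) →
        (∀ x ∈ Metric.ball (0 : EuclideanSpace ℝ (Fin d)) R,
          ∑ i, ∑ j, a x i j * hmat (H x) i j ≤ f x + K * ‖g x‖) →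
        (∀ x ∈ Metric.closedBall (0 : EuclideanSpace ℝ (Fin d)) R, |u x| ≤ 1) →
        ∫⁻ x in Metric.ball (0 : EuclideanSpace ℝ (Fin d)) R, ENNReal.ofReal (f x) ^ d ≤
          ENNReal.ofReal Φ →
        ∫⁻ x in Metric.ball (0 : EuclideanSpace ℝ (Fin d)) R,
          ENNReal.ofReal (frobNorm (hmat (H x))) ^ γ ≤ ENNReal.ofReal N := by
  obtain ⟨μ, σ0, θ, B, hμ, hσ0, hθ, hθ1, hμθ, hB, hdec⟩ := decay d hd δ K hδ hK Φ hΦ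
  have hp : 1 < μ ^ 2 := one_lt_pow₀ hμ two_ne_zero
  have hμ0 : 0 < μ := by linarith
  obtain ⟨γ, hγ0, hγ1, hq⟩ := exists_gamma hp hθ hθ1
  set ω : ℝ := (volume (Metric.ball (0 : EuclideanSpace ℝ (Fin d)) 1)).toReal with hω
  have hωe : volume (Metric.ball (0 : EuclideanSpace ℝ (Fin d)) 1) = ENNReal.ofReal ω :=
    (ENNReal.ofReal_toReal (omega_lt_top d).ne).symm
  have hω0 : 0 < ω := ENNReal.toReal_pos (omega_pos d).ne' (omega_lt_top d).ne
  have hd0 : (0 : ℝ) < d := by exact_mod_cast hd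
  set C3 : ℝ := d * (δ⁻¹ * (1 + 2 * K + d * δ⁻¹) + 1) with hC3
  have hC30 : 0 < C3 := by positivity
  have hσp : 0 < σ0 := by linarith
  have hs0 : 0 < C3 * σ0 ^ 2 := by positivity
  set s0 := C3 * σ0 ^ 2 with hs0d
  set B' := B + d * ω + Φ with hB'
  have hB'0 : 0 < B' := by positivity
  have hq' : 0 < 1 - (μ ^ 2) ^ γ * θ := by linarith
  refine ⟨γ, s0 ^ γ * ω + (s0 * μ ^ 2) ^ γ * B' * (1 - (μ ^ 2) ^ γ * θ)⁻¹, hγ0, hγ1, by positivity, ?_⟩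
  intro R hR hR1 u g H a f hc ha hf hf0 hsub hu1 hfΦ
  have hdec' := hdec R hR hR1 u g H a f hc ha hf hf0 hsub hu1 hfΦ
  have hfr : Measurable fun x => frobNorm (hmat (H x)) :=
    measurable_frob (measurable_hmat hc)
  refine (layer (volume.restrict (Metric.ball 0 R)) hfr (fun x => Real.sqrt_nonneg _) hs0 hp
    hB'0.le hθ hγ0 hq ?_).trans ?_
  · intro k
    rw [Measure.restrict_apply (measurableSet_lt measurable_const hfr)]
    set σ := σ0 * μ ^ k with hσ
    have hμk : 1 ≤ μ ^ k := one_le_pow₀ hμ.le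
    have hσ17 : 17 ≤ σ := by nlinarith
    have hσpos : 0 < σ := by linarith
    have hpw : (μ ^ k)⁻¹ ≤ θ ^ k := by
      rw [← inv_pow]; exact pow_le_pow_left₀ (by positivity) hμθ k
    have h8 : 8 / σ ≤ (μ ^ k)⁻¹ := by
      rw [div_le_iff₀ hσpos, hσ, mul_comm σ0, ← mul_assoc, inv_mul_cancel₀ (by positivity)]
      linarith
    have h8R : 8 / σ ≤ R := by
      rw [div_le_iff₀ hσpos]; nlinarith
    have hincl : {x | s0 * (μ ^ 2) ^ k < frobNorm (hmat (H x))} ∩ Metric.ball 0 R ⊆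
        ((Metric.ball 0 R \ Aset u g R (σ ^ 2)) ∪
          (Metric.ball 0 R \ {x | ‖x‖ + 8 / σ ≤ R})) ∪
          (Metric.ball 0 R ∩ {x | ENNReal.ofReal (σ ^ 2) ^ d ≤ ENNReal.ofReal (f x) ^ d}) := by
      rintro x ⟨hx, hxR⟩
      by_contra hcon
      simp only [mem_union, mem_sdiff, mem_inter_iff, hxR, true_and, not_or, not_not,
        mem_ofPred_eq] at hcon hx
      obtain ⟨⟨h1, h2⟩, h3⟩ := hcon
      have hfx : f x ≤ σ ^ 2 := by
        by_contra hlt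
        push Not at hlt
        apply h3
        gcongr
      have := hess_bound hδ hK (by linarith : 1 ≤ σ) hc ha hsub hu1 h1 h2 (hf0 x) hfx
      have e : C3 * σ ^ 2 = s0 * (μ ^ 2) ^ k := by
        rw [hs0d, hσ, mul_pow, ← pow_mul, ← pow_mul, mul_comm 2 k]; ring
      rw [← hC3, e] at this
      linarith
    refine (measure_mono hincl).trans ?_
    refine (measure_union_le _ _).trans ?_
    refine (add_le_add (measure_union_le _ _) le_rfl).trans ?_
    have e1 := hdec' k
    have e2 : volume (Metric.ball (0 : EuclideanSpace ℝ (Fin d)) R \ {x | ‖x‖ + 8 / σ ≤ R}) ≤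
        ENNReal.ofReal (d * ω * θ ^ k) := by
      refine (vol_annulus (by positivity) h8R hR1 (by linarith)).trans ?_
      rw [hωe, ← ENNReal.ofReal_mul (by positivity)]
      apply ENNReal.ofReal_le_ofReal
      calc d * (8 / σ) * ω = d * ω * (8 / σ) := by ring
        _ ≤ d * ω * θ ^ k := by
          apply mul_le_mul_of_nonneg_left (h8.trans hpw) (by positivity)
    have e3 : volume (Metric.ball (0 : EuclideanSpace ℝ (Fin d)) R ∩
        {x | ENNReal.ofReal (σ ^ 2) ^ d ≤ ENNReal.ofReal (f x) ^ d}) ≤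
        ENNReal.ofReal (Φ * θ ^ k) := by
      have hpos : 0 < (σ ^ 2) ^ d := by positivity
      have hge : μ ^ k ≤ (σ ^ 2) ^ d := by
        have a1 : σ ≤ σ ^ 2 := by nlinarith
        have a2 : σ ^ 2 ≤ (σ ^ 2) ^ d := le_self_pow₀ (by linarith) (by omega)
        have a3 : μ ^ k ≤ σ := by rw [hσ]; nlinarith
        linarith
      have hm := meas_ge_le_lintegral_div (μ := volume.restrict (Metric.ball 0 R))
        (f := fun x => ENNReal.ofReal (f x) ^ d) (by fun_prop)
        (ε := ENNReal.ofReal (σ ^ 2) ^ d) (by positivity) (by finiteness)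
      rw [Measure.restrict_apply (measurableSet_le measurable_const (by fun_prop)), inter_comm] at hm
      refine hm.trans ((ENNReal.div_le_div_right hfΦ _).trans ?_)
      rw [← ENNReal.ofReal_pow (by positivity), ← ENNReal.ofReal_div_of_pos hpos]
      apply ENNReal.ofReal_le_ofReal
      rw [div_eq_mul_inv]
      apply mul_le_mul_of_nonneg_left _ hΦ
      refine le_trans ?_ hpw
      gcongr
    refine (add_le_add (add_le_add e1 e2) e3).trans ?_
    rw [← ENNReal.ofReal_add (by positivity) (by positivity),
      ← ENNReal.ofReal_add (by positivity) (by positivity)]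
    apply ENNReal.ofReal_le_ofReal
    rw [hB']; apply le_of_eq; ring
  · rw [Measure.restrict_apply_univ, ENNReal.ofReal_add (by positivity) (by positivity)]
    gcongr
    rw [ENNReal.ofReal_mul (by positivity), ← hωe]
    gcongr

theorem frob_smul {d : ℕ} (s : ℝ) (hs : 0 ≤ s)
    (H : EuclideanSpace ℝ (Fin d) →L[ℝ] EuclideanSpace ℝ (Fin d)) :
    frobNorm (hmat (s • H)) = s * frobNorm (hmat H) := by
  unfold frobNorm
  have : ∑ i, ∑ j, (hmat (s • H) i j) ^ 2 = s ^ 2 * ∑ i, ∑ j, (hmat H i j) ^ 2 := by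
    simp only [Finset.mul_sum]
    refine Finset.sum_congr rfl fun i _ => Finset.sum_congr rfl fun j _ => ?_
    simp [hmat, mul_pow]
  rw [this, Real.sqrt_mul (by positivity), Real.sqrt_sq hs]

theorem abs_sum_inner {d : ℕ} (b g : EuclideanSpace ℝ (Fin d)) :
    |∑ i, b i * g i| ≤ ‖b‖ * ‖g‖ := by
  have : ∑ i, b i * g i = inner ℝ b g := by
    simp [PiLp.inner_apply, mul_comm]
  rw [this]; exact abs_real_inner_le_norm b g

/-- The smooth estimate. -/
theorem smooth_est (d : ℕ) (hd : 1 ≤ d) (δ K : ℝ) (hδ : 0 < δ) (hK : 0 ≤ K) :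
    ∃ γ N : ℝ, 0 < γ ∧ γ ≤ 1 ∧ 0 < N ∧
      ∀ R, 1 / 2 ≤ R → R ≤ 1 → ∀ (u : EuclideanSpace ℝ (Fin d) → ℝ)
        (g : EuclideanSpace ℝ (Fin d) → EuclideanSpace ℝ (Fin d))
        (H : EuclideanSpace ℝ (Fin d) → EuclideanSpace ℝ (Fin d) →L[ℝ] EuclideanSpace ℝ (Fin d))
        (a : EuclideanSpace ℝ (Fin d) → Matrix (Fin d) (Fin d) ℝ)
        (b : EuclideanSpace ℝ (Fin d) → EuclideanSpace ℝ (Fin d))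
        (c : EuclideanSpace ℝ (Fin d) → ℝ) (S F : ℝ),
        C2Data u g H → (∀ x, EllMat δ (a x)) → 
        (∀ i j, Measurable fun x => a x i j) → (∀ i, Measurable fun x => b x i) → Measurable c →
        (∀ x, ‖b x‖ + c x ≤ K) → (∀ x, 0 ≤ c x) → 0 ≤ S → 0 < F → 
        (∀ x ∈ Metric.sphere (0 : EuclideanSpace ℝ (Fin d)) R, |u x| ≤ S) →
        ∫⁻ x in Metric.ball (0 : EuclideanSpace ℝ (Fin d)) R, ENNReal.ofReal 
          |(∑ i, ∑ j, a x i j * hmat (H x) i j) + (∑ i, b x i * g x i) - c x * u x| ^ d ≤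
          ENNReal.ofReal (F ^ d) →
        ∫⁻ x in Metric.ball (0 : EuclideanSpace ℝ (Fin d)) R,
          ENNReal.ofReal (frobNorm (hmat (H x))) ^ γ ≤ ENNReal.ofReal (N * (S + F) ^ γ) := by
  obtain ⟨C, hC, habp⟩ := abp_one_sided d hd δ K hδ hK
  set ω : ℝ := (volume (Metric.ball (0 : EuclideanSpace ℝ (Fin d)) 1)).toReal with hω
  have hωe : volume (Metric.ball (0 : EuclideanSpace ℝ (Fin d)) 1) = ENNReal.ofReal ω :=
    (ENNReal.ofReal_toReal (omega_lt_top d).ne).symm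
  obtain ⟨γ, N, hγ0, hγ1, hN, hnorm⟩ := normalised d hd δ K hδ hK (2 ^ d * (1 + K ^ d * ω))
    (by positivity)
  refine ⟨γ, N * (1 + C) ^ γ, hγ0, hγ1, by positivity, ?_⟩
  intro R hR hR1 u g H a b c S F hc ha ham hbm hcm hbc hc0 hS hF huS hLF
  set L : EuclideanSpace ℝ (Fin d) → ℝ := fun x =>
    (∑ i, ∑ j, a x i j * hmat (H x) i j) + (∑ i, b x i * g x i) - c x * u x with hL
  have hLm : Measurable L := by
    have h1 := hc.continuous.measurable
    have h2 := hc.continuous_grad.measurable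
    have h3 := measurable_hmat hc
    have h4 : ∀ i, Measurable fun x => g x i := fun i => by fun_prop
    refine ((Finset.measurable_sum _ fun i _ => Finset.measurable_sum _ fun j _ =>
      (ham i j).mul (h3 i j)).add (Finset.measurable_sum _ fun i _ => (hbm i).mul (h4 i))).sub
      (hcm.mul h1)
  have hbg : ∀ x, |∑ i, b x i * g x i| ≤ K * ‖g x‖ := fun x =>
    (abs_sum_inner _ _).trans (mul_le_mul_of_nonneg_right (by linarith [hbc x, hc0 x]) (norm_nonneg _))
  have hcu : ∀ x, |c x * u x| ≤ K * |u x| := fun x => by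
    rw [abs_mul, abs_of_nonneg (hc0 x)]
    exact mul_le_mul_of_nonneg_right (by linarith [hbc x, norm_nonneg (b x)]) (abs_nonneg _)
  have hLx : ∀ x, L x = (∑ i, ∑ j, a x i j * hmat (H x) i j) + (∑ i, b x i * g x i) - c x * u x :=
    fun x => rfl
  have hR0 : 0 < R := by linarith
  have hup : ∀ x ∈ Metric.closedBall (0 : EuclideanSpace ℝ (Fin d)) R, u x ≤ S + C * F := by
    refine habp R hR0 hR1 u g H a (fun x => |L x|) S F hc ha (by fun_prop) (fun x => abs_nonneg _)
      ?_ hS (fun x hx => (le_abs_self _).trans (huS x hx)) hF hLF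
    intro x _ hx
    have h1 := abs_le.1 (hbg x)
    have h2 := mul_nonneg (hc0 x) hx
    have h3 := neg_abs_le (L x)
    have h4 := hLx x
    linarith
  have hum : ∀ x ∈ Metric.closedBall (0 : EuclideanSpace ℝ (Fin d)) R, - u x ≤ S + C * F := by
    refine habp R hR0 hR1 (fun x => - u x) (fun x => - g x) (fun x => - H x) a (fun x => |L x|) S F
      hc.neg ha (by fun_prop) (fun x => abs_nonneg _)
      ?_ hS (fun x hx => (neg_le_abs _).trans (huS x hx)) hF hLF
    intro x _ hx
    have h1 := abs_le.1 (hbg x)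
    have h2 := mul_nonneg (hc0 x) hx
    have h3 := le_abs_self (L x)
    have h4 := hLx x
    have h5 : ∑ i, ∑ j, a x i j * hmat (- H x) i j = - ∑ i, ∑ j, a x i j * hmat (H x) i j := by
      simp [hmat]
    rw [h5, norm_neg]
    linarith
  set Λ := (1 + C) * (S + F) with hΛ
  have hΛ0 : 0 < Λ := by positivity
  have hub : ∀ x ∈ Metric.closedBall (0 : EuclideanSpace ℝ (Fin d)) R, |u x| ≤ Λ := by
    intro x hx
    have e : Λ = S + C * F + (F + C * S) := by rw [hΛ]; ring
    have : 0 ≤ F + C * S := by positivity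
    rw [abs_le]; constructor <;> linarith [hup x hx, hum x hx]
  have hFΛ : F ≤ Λ := by
    have : 0 ≤ C * (S + F) := by positivity
    rw [hΛ]; linarith
  have hmain := hnorm R hR hR1 (fun x => Λ⁻¹ * u x) (fun x => Λ⁻¹ • g x) (fun x => Λ⁻¹ • H x) a
    (fun x => Λ⁻¹ * |L x| + K) (hc.const_mul Λ⁻¹) ha (by fun_prop) (fun x => by positivity) ?_ ?_ ?_
  · have e : ∀ x, ENNReal.ofReal (frobNorm (hmat (H x))) ^ γ =
        ENNReal.ofReal (Λ ^ γ) * ENNReal.ofReal (frobNorm (hmat (Λ⁻¹ • H x))) ^ γ := by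
      intro x
      have h0 : 0 ≤ frobNorm (hmat (H x)) := Real.sqrt_nonneg _
      rw [frob_smul _ (by positivity), ← ENNReal.ofReal_rpow_of_nonneg hΛ0.le hγ0.le,
        ← ENNReal.mul_rpow_of_nonneg _ _ hγ0.le, ← ENNReal.ofReal_mul hΛ0.le, ← mul_assoc,
        mul_inv_cancel₀ hΛ0.ne', one_mul]
    simp_rw [e]
    rw [lintegral_const_mul' _ _ ENNReal.ofReal_ne_top]
    refine (mul_le_mul_right hmain _).trans ?_
    rw [← ENNReal.ofReal_mul (by positivity)]
    apply ENNReal.ofReal_le_ofReal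
    rw [hΛ, Real.mul_rpow (by positivity) (by positivity)]
    apply le_of_eq; ring
  · intro x hx
    have h5 : ∑ i, ∑ j, a x i j * hmat (Λ⁻¹ • H x) i j =
        Λ⁻¹ * ∑ i, ∑ j, a x i j * hmat (H x) i j := by
      simp only [Finset.mul_sum]
      refine Finset.sum_congr rfl fun i _ => Finset.sum_congr rfl fun j _ => ?_
      simp [hmat]; ring
    rw [h5, norm_smul, Real.norm_eq_abs, abs_of_pos (by positivity : 0 < Λ⁻¹)]
    have h1 := abs_le.1 (hbg x)
    have h2 := abs_le.1 (hcu x)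
    have h3 := le_abs_self (L x)
    have h4 := hLx x
    have h6 : ∑ i, ∑ j, a x i j * hmat (H x) i j ≤ |L x| + K * Λ + K * ‖g x‖ := by
      have := mul_le_mul_of_nonneg_left (hub x (Metric.ball_subset_closedBall hx)) hK
      linarith
    have h7 := mul_le_mul_of_nonneg_left h6 (by positivity : 0 ≤ Λ⁻¹)
    have h8 : Λ⁻¹ * (|L x| + K * Λ + K * ‖g x‖) = Λ⁻¹ * |L x| + K + K * (Λ⁻¹ * ‖g x‖) := by
      field_simp
    linarith
  · intro x hx
    rw [abs_mul, abs_of_pos (by positivity : 0 < Λ⁻¹), inv_mul_le_iff₀ hΛ0, mul_one]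
    exact hub x hx
  · have hpt : ∀ x, ENNReal.ofReal (Λ⁻¹ * |L x| + K) ^ d ≤
        ENNReal.ofReal (2 ^ d * Λ⁻¹ ^ d) * ENNReal.ofReal |L x| ^ d +
          ENNReal.ofReal (2 ^ d * K ^ d) := by
      intro x
      rw [← ENNReal.ofReal_pow (by positivity), ← ENNReal.ofReal_pow (by positivity),
        ← ENNReal.ofReal_mul (by positivity), ← ENNReal.ofReal_add (by positivity) (by positivity)]
      apply ENNReal.ofReal_le_ofReal
      refine (add_pow_le_two_pow (by positivity) hK d).trans (le_of_eq ?_)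
      rw [mul_pow]; ring
    refine (lintegral_mono hpt).trans ?_
    rw [lintegral_add_right _ measurable_const, lintegral_const_mul' _ _ ENNReal.ofReal_ne_top,
      lintegral_const, Measure.restrict_apply_univ]
    have hv : volume (Metric.ball (0 : EuclideanSpace ℝ (Fin d)) R) ≤ ENNReal.ofReal ω :=
      hωe ▸ measure_mono (Metric.ball_subset_ball hR1)
    refine (add_le_add (mul_le_mul_right hLF _) (mul_le_mul_right hv _)).trans ?_
    rw [← ENNReal.ofReal_mul (by positivity), ← ENNReal.ofReal_mul (by positivity),
      ← ENNReal.ofReal_add (by positivity) (by positivity)]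
    apply ENNReal.ofReal_le_ofReal
    have h9 : Λ⁻¹ ^ d * F ^ d ≤ 1 := by
      rw [← mul_pow]
      apply pow_le_one₀ (by positivity)
      rw [inv_mul_le_iff₀ hΛ0]; linarith
    have h10 := mul_le_mul_of_nonneg_left h9 (by positivity : (0:ℝ) ≤ 2 ^ d)
    calc _ = 2 ^ d * (Λ⁻¹ ^ d * F ^ d) + 2 ^ d * K ^ d * ω := by ring
      _ ≤ 2 ^ d * 1 + 2 ^ d * K ^ d * ω := by linarith
      _ = _ := by ring

open scoped Convolution in
/-- The mollification of a function. -/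
def moll {d : ℕ} (φ : ContDiffBump (0 : EuclideanSpace ℝ (Fin d)))
    (w : EuclideanSpace ℝ (Fin d) → ℝ) : EuclideanSpace ℝ (Fin d) → ℝ :=
  (φ.normed volume ⋆[ContinuousLinearMap.lsmul ℝ ℝ, volume] w)

theorem transl_cont {d : ℕ} {w : EuclideanSpace ℝ (Fin d) → ℝ} {p : ℝ≥0∞} (hp1 : 1 ≤ p)
    (hp : p ≠ ∞) (hw : MemLp w p volume) :
    Filter.Tendsto (fun t => eLpNorm (fun x => w (x - t) - w x) p volume)
      (nhds (0 : EuclideanSpace ℝ (Fin d))) (nhds 0) := by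
  have : Fact (1 ≤ p) := ⟨hp1⟩
  let G : EuclideanSpace ℝ (Fin d) → C(EuclideanSpace ℝ (Fin d), EuclideanSpace ℝ (Fin d)) :=
    fun t => ⟨fun x => x - t, by fun_prop⟩
  have hG : Continuous G := by
    apply ContinuousMap.continuous_of_continuous_uncurry
    simp only [Function.uncurry_def]
    change Continuous fun q : EuclideanSpace ℝ (Fin d) × EuclideanSpace ℝ (Fin d) => q.2 - q.1
    fun_prop
  have hmp : ∀ t, MeasurePreserving (G t) volume volume := fun t =>
    measurePreserving_sub_right volume t
  have hcont := (continuous_const (y := hw.toLp w)).compMeasurePreservingLp hG hmp hp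
  have h0 := (hcont.tendsto 0).edist (tendsto_const_nhds (x := hw.toLp w))
  have e0 : Lp.compMeasurePreserving (G 0) (hmp 0) (hw.toLp w) = hw.toLp w := by
    rw [Lp.toLp_compMeasurePreserving hw (hmp 0)]
    congr 1
    funext x
    simp [G]
  rw [e0, edist_self] at h0
  refine h0.congr fun t => ?_
  rw [Lp.toLp_compMeasurePreserving hw (hmp t), Lp.edist_toLp_toLp]
  rfl

theorem jensen_pow {α : Type*} [MeasurableSpace α] (ν : Measure α) [IsProbabilityMeasure ν]
    {h : α → ℝ≥0∞} (hh : Measurable h) {d : ℕ} (hd : 1 ≤ d) :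
    (∫⁻ x, h x ∂ν) ^ d ≤ ∫⁻ x, h x ^ d ∂ν := by
  have h1 := eLpNorm'_le_eLpNorm'_of_exponent_le (f := h) (p := 1) (q := (d : ℝ)) one_pos
    (by exact_mod_cast hd) ν hh.aestronglyMeasurable
  simp only [eLpNorm', enorm_eq_self, ENNReal.rpow_one, one_div, inv_one, ENNReal.rpow_natCast] at h1
  have hd0 : (d : ℝ) ≠ 0 := by positivity
  calc (∫⁻ x, h x ∂ν) ^ d ≤ ((∫⁻ x, h x ^ d ∂ν) ^ ((d : ℝ)⁻¹)) ^ d := by gcongr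
    _ = _ := by rw [← ENNReal.rpow_natCast, ← ENNReal.rpow_mul, inv_mul_cancel₀ hd0, ENNReal.rpow_one]

theorem moll_sub_le {d : ℕ} (hd : 1 ≤ d) (φ : ContDiffBump (0 : EuclideanSpace ℝ (Fin d)))
    {w : EuclideanSpace ℝ (Fin d) → ℝ} (hwm : Measurable w) (hw : LocallyIntegrable w volume)
    {ε : ℝ≥0∞} (hε : ∀ t, ‖t‖ < φ.rOut → ∫⁻ x, ‖w (x - t) - w x‖ₑ ^ d ≤ ε) :
    ∫⁻ x, ‖moll φ w x - w x‖ₑ ^ d ≤ ε := by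
  set ρ : EuclideanSpace ℝ (Fin d) → ℝ≥0∞ := fun t => ENNReal.ofReal (φ.normed volume t) with hρ
  have hρm : Measurable ρ := by
    have := φ.continuous_normed (μ := volume)
    fun_prop
  have hρ1 : ∫⁻ t, ρ t = 1 := by
    rw [← ofReal_integral_eq_lintegral_ofReal φ.integrable_normed
      (Filter.Eventually.of_forall φ.nonneg_normed), φ.integral_normed, ENNReal.ofReal_one]
  set ν := (volume : Measure (EuclideanSpace ℝ (Fin d))).withDensity ρ with hν
  have : IsProbabilityMeasure ν := ⟨by rw [hν, withDensity_apply _ MeasurableSet.univ,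
    Measure.restrict_univ, hρ1]⟩
  have hpt : ∀ x, ‖moll φ w x - w x‖ₑ ^ d ≤ ∫⁻ t, ‖w (x - t) - w x‖ₑ ^ d ∂ν := by
    intro x
    refine le_trans ?_ (jensen_pow ν (by fun_prop) hd)
    gcongr
    have hi1 : Integrable (fun t => φ.normed volume t * w (x - t)) volume :=
      φ.hasCompactSupport_normed.convolutionExists_left (ContinuousLinearMap.lsmul ℝ ℝ)
        φ.continuous_normed hw x
    have hi2 : Integrable (fun t => φ.normed volume t * w x) volume :=
      φ.integrable_normed.mul_const _
    have e : moll φ w x - w x = ∫ t, φ.normed volume t * (w (x - t) - w x) := by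
      have e1 : moll φ w x = ∫ t, φ.normed volume t * w (x - t) := rfl
      have e2 : w x = ∫ t, φ.normed volume t * w x := by
        rw [integral_mul_const, φ.integral_normed, one_mul]
      simp only [mul_sub]
      rw [integral_sub hi1 hi2, ← e2, e1]
    rw [e]
    refine (enorm_integral_le_lintegral_enorm _).trans (le_of_eq ?_)
    rw [hν, lintegral_withDensity_eq_lintegral_mul _ hρm (by fun_prop)]
    refine lintegral_congr fun t => ?_
    rw [enorm_mul, Pi.mul_apply, hρ, Real.enorm_of_nonneg (φ.nonneg_normed t)]
  refine (lintegral_mono hpt).trans ?_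
  rw [lintegral_lintegral_swap (by fun_prop)]
  rw [hν, lintegral_withDensity_eq_lintegral_mul _ hρm]
  · calc _ ≤ ∫⁻ t, ρ t * ε := by
          refine lintegral_mono fun t => ?_
          simp only [Pi.mul_apply]
          by_cases ht : ‖t‖ < φ.rOut
          · exact mul_le_mul_right (hε t ht) _
          · have : ρ t = 0 := by
              have : t ∉ Function.support (φ.normed volume) := by
                rw [φ.support_normed_eq, mem_ball_zero_iff]; exact ht
              rw [hρ]; simp only
              rw [Function.notMem_support.1 this, ENNReal.ofReal_zero]
            rw [this]; simp
      _ = ε := by rw [lintegral_mul_const _ hρm, hρ1, one_mul]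
  · exact Measurable.lintegral_prod_left' (f := fun q : EuclideanSpace ℝ (Fin d) × EuclideanSpace ℝ (Fin d) =>
      ‖w (q.1 - q.2) - w q.1‖ₑ ^ d) (by fun_prop)

theorem eLpNorm_pow {α : Type*} [MeasurableSpace α] {ν : Measure α} {d : ℕ} (hd : 1 ≤ d) (f : α → ℝ) :
    eLpNorm f d ν ^ d = ∫⁻ x, ‖f x‖ₑ ^ d ∂ν := by
  have hd0 : (d : ℝ) ≠ 0 := by positivity
  rw [eLpNorm_eq_lintegral_rpow_enorm_toReal (by positivity) (by finiteness)]
  simp only [ENNReal.toReal_natCast, ENNReal.rpow_natCast, one_div]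
  rw [← ENNReal.rpow_natCast, ← ENNReal.rpow_mul, inv_mul_cancel₀ hd0, ENNReal.rpow_one]

theorem moll_Lp {d : ℕ} (hd : 1 ≤ d) {φ : ℕ → ContDiffBump (0 : EuclideanSpace ℝ (Fin d))}
    (hφ : Filter.Tendsto (fun n => (φ n).rOut) Filter.atTop (nhds 0))
    {w : EuclideanSpace ℝ (Fin d) → ℝ} (hwm : Measurable w) (hw : MemLp w d volume) :
    Filter.Tendsto (fun n => eLpNorm (fun x => moll (φ n) w x - w x) d volume)
      Filter.atTop (nhds 0) := by
  have hd1 : (1 : ℝ≥0∞) ≤ d := by exact_mod_cast hd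
  have ht := transl_cont hd1 (by finiteness) hw
  rw [ENNReal.tendsto_nhds_zero] at ht ⊢
  intro ε hε
  have h1 := ht ε hε
  rw [Metric.eventually_nhds_iff] at h1
  obtain ⟨η, hη, h1⟩ := h1
  have h2 : ∀ᶠ n in Filter.atTop, (φ n).rOut < η := hφ.eventually (gt_mem_nhds hη)
  filter_upwards [h2] with n hn
  have h3 := moll_sub_le hd (φ n) hwm (hw.locallyIntegrable hd1) (ε := ε ^ d) (fun t htt => by
    rw [← eLpNorm_pow hd]
    gcongr
    apply h1
    rw [dist_zero_right]; linarith)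
  rw [← eLpNorm_pow hd] at h3
  exact (ENNReal.pow_le_pow_left_iff (by omega)).1 h3

theorem moll_contDiff {d : ℕ} (φ : ContDiffBump (0 : EuclideanSpace ℝ (Fin d)))
    {w : EuclideanSpace ℝ (Fin d) → ℝ} (hw : LocallyIntegrable w volume) :
    ContDiff ℝ 2 (moll φ w) :=
  φ.hasCompactSupport_normed.contDiff_convolution_left (n := 2) _ φ.contDiff_normed hw

theorem moll_deriv {d : ℕ} (φ : ContDiffBump (0 : EuclideanSpace ℝ (Fin d)))
    {w w' : EuclideanSpace ℝ (Fin d) → ℝ} (hw : LocallyIntegrable w volume)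
    (hw' : LocallyIntegrable w' volume) (x e : EuclideanSpace ℝ (Fin d))
    (hd : ∀ y ∈ Metric.closedBall x φ.rOut, HasLineDerivAt ℝ w (w' y) y e) :
    fderiv ℝ (moll φ w) x e = moll φ w' x := by
  have hcs := φ.hasCompactSupport_normed (μ := volume)
  have hC1 : ContDiff ℝ 1 (φ.normed volume) := φ.contDiff_normed
  have hfd := hcs.hasFDerivAt_convolution_left (ContinuousLinearMap.lsmul ℝ ℝ) hC1 hw x
  have hcf : Continuous (fderiv ℝ (φ.normed volume)) := hC1.continuous_fderiv one_ne_zero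
  have hex := (hcs.fderiv ℝ).convolutionExists_left
    ((ContinuousLinearMap.lsmul ℝ ℝ : ℝ →L[ℝ] ℝ →L[ℝ] ℝ).precompL (EuclideanSpace ℝ (Fin d))) hcf hw x
  have e1 : fderiv ℝ (moll φ w) x e = ∫ t, fderiv ℝ (φ.normed volume) t e * w (x - t) := by
    rw [show fderiv ℝ (moll φ w) x = _ from hfd.fderiv, convolution_def,
      ContinuousLinearMap.integral_apply hex]
    rfl
  have hi1 : Integrable (fun t => fderiv ℝ (φ.normed volume) t e * w (x - t)) volume := by
    exact hex.apply_continuousLinearMap e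
  have hi2 : Integrable (fun t => φ.normed volume t * w (x - t)) volume :=
    hcs.convolutionExists_left (ContinuousLinearMap.lsmul ℝ ℝ) φ.continuous_normed hw x
  have hi3 : Integrable (fun t => φ.normed volume t * w' (x - t)) volume :=
    hcs.convolutionExists_left (ContinuousLinearMap.lsmul ℝ ℝ) φ.continuous_normed hw' x
  have hibp := integral_bilinear_hasLineDerivAt_right_eq_neg_left_of_integrable
    (μ := (volume : Measure (EuclideanSpace ℝ (Fin d))))
    (f := φ.normed volume) (f' := fun t => fderiv ℝ (φ.normed volume) t e)
    (g := fun t => w (x - t)) (g' := fun t => - w' (x - t)) (v := e)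
    (B := ContinuousLinearMap.mul ℝ ℝ) hi1 (by simpa using hi3.neg) hi2
    (fun t _ => ((hC1.differentiable one_ne_zero) t).hasFDerivAt.hasLineDerivAt e) ?_
  · simp only [ContinuousLinearMap.mul_apply', mul_neg, integral_neg, neg_inj] at hibp
    rw [e1, ← hibp]
    rfl
  · intro t ht
    rw [φ.tsupport_normed_eq, mem_closedBall_zero_iff] at ht
    have h := hd (x - t) (by rw [mem_closedBall_iff_norm]; simpa using ht)
    unfold HasLineDerivAt at h ⊢
    have h2 : HasDerivAt (fun s : ℝ => -s) (-1) 0 := hasDerivAt_neg 0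
    have h3 := HasDerivAt.comp (0 : ℝ) (h₂ := fun s : ℝ => w (x - t + s • e)) (h := fun s : ℝ => -s)
      (by simpa using h) h2
    have e2 : (fun s : ℝ => w (x - (t + s • e))) =
        (fun s : ℝ => w (x - t + s • e)) ∘ fun s : ℝ => -s := by
      funext s
      simp only [Function.comp]
      congr 1
      simp only [neg_smul]; abel
    rw [mul_neg_one] at h3
    rw [e2]
    exact h3

/-- The gradient. -/
def gradF {d : ℕ} (f : EuclideanSpace ℝ (Fin d) → ℝ) (x : EuclideanSpace ℝ (Fin d)) :
    EuclideanSpace ℝ (Fin d) := (InnerProductSpace.toDual ℝ (EuclideanSpace ℝ (Fin d))).symm (fderiv ℝ f x)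

/-- The Hessian. -/
def hessF {d : ℕ} (f : EuclideanSpace ℝ (Fin d) → ℝ) (x : EuclideanSpace ℝ (Fin d)) :
    EuclideanSpace ℝ (Fin d) →L[ℝ] EuclideanSpace ℝ (Fin d) := fderiv ℝ (gradF f) x

theorem inner_gradF {d : ℕ} (f : EuclideanSpace ℝ (Fin d) → ℝ) (x v : EuclideanSpace ℝ (Fin d)) :
    inner ℝ (gradF f x) v = fderiv ℝ f x v := by
  rw [gradF, InnerProductSpace.toDual_symm_apply]

theorem gradF_diff {d : ℕ} {f : EuclideanSpace ℝ (Fin d) → ℝ} (hf : ContDiff ℝ 2 f) :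
    Differentiable ℝ (gradF f) := by
  have h1 : Differentiable ℝ (fderiv ℝ f) :=
    (hf.fderiv_right (m := 1) (by norm_num)).differentiable one_ne_zero
  exact ((InnerProductSpace.toDual ℝ (EuclideanSpace ℝ (Fin d))).symm.toContinuousLinearEquiv.differentiable).comp h1

theorem inner_hessF {d : ℕ} {f : EuclideanSpace ℝ (Fin d) → ℝ} (hf : ContDiff ℝ 2 f)
    (x v w : EuclideanSpace ℝ (Fin d)) :
    inner ℝ (hessF f x v) w = fderiv ℝ (fderiv ℝ f) x v w := by
  have h1 : Differentiable ℝ (fderiv ℝ f) :=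
    (hf.fderiv_right (m := 1) (by norm_num)).differentiable one_ne_zero
  have h2 : HasFDerivAt (fun y => inner ℝ (gradF f y) w) _ x :=
    ((gradF_diff hf x).hasFDerivAt).inner ℝ (hasFDerivAt_const w x)
  have h3 : HasFDerivAt (fun y => fderiv ℝ f y w) _ x :=
    (h1 x).hasFDerivAt.clm_apply (hasFDerivAt_const w x)
  have e : (fun y => inner ℝ (gradF f y) w) = fun y => fderiv ℝ f y w := by
    funext y; exact inner_gradF f y w
  rw [e] at h2
  have := congrArg (fun ℓ => ℓ v) (h2.unique h3)
  simpa [hessF] using this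

theorem c2Data_of_contDiff {d : ℕ} {f : EuclideanSpace ℝ (Fin d) → ℝ} (hf : ContDiff ℝ 2 f) :
    C2Data f (gradF f) (hessF f) := by
  refine ⟨fun x => ?_, fun x => (gradF_diff hf x).hasFDerivAt, fun x v w => ?_⟩
  · have e : innerSL ℝ (gradF f x) = fderiv ℝ f x := by
      ext v; exact inner_gradF f x v
    rw [e]
    exact (hf.differentiable two_ne_zero x).hasFDerivAt
  · rw [inner_hessF hf, inner_hessF hf]
    exact (hf.contDiffAt.isSymmSndFDerivAt (by simp)).eq v w

theorem gradF_coord {d : ℕ} (f : EuclideanSpace ℝ (Fin d) → ℝ) (x : EuclideanSpace ℝ (Fin d)) (i : Fin d) :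
    gradF f x i = fderiv ℝ f x (EuclideanSpace.single i 1) := by
  rw [← inner_gradF]; simp [EuclideanSpace.inner_single_right]

theorem hessF_coord {d : ℕ} {f : EuclideanSpace ℝ (Fin d) → ℝ} (hf : ContDiff ℝ 2 f)
    (x : EuclideanSpace ℝ (Fin d)) (i j : Fin d) :
    hmat (hessF f x) i j =
      fderiv ℝ (fun y => gradF f y i) x (EuclideanSpace.single j 1) := by
  have h := (gradF_diff hf x).hasFDerivAt
  have h2 := ((EuclideanSpace.proj i : EuclideanSpace ℝ (Fin d) →L[ℝ] ℝ).hasFDerivAt).comp x h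
  have e : fderiv ℝ (fun y => gradF f y i) x = _ := h2.fderiv
  rw [e]
  rfl

theorem ind_memLp {d : ℕ} (hd : 1 ≤ d) {V : Set (EuclideanSpace ℝ (Fin d))} (hV : MeasurableSet V)
    {f h : EuclideanSpace ℝ (Fin d) → ℝ} (hf : Measurable f) (hh : IntegrableOn h V volume)
    (hle : ∀ x, |f x| ^ (d : ℝ) ≤ h x) : MemLp (V.indicator f) d volume := by
  rw [memLp_indicator_iff_restrict hV]
  rw [← integrable_norm_rpow_iff hf.aestronglyMeasurable (by positivity) (by finiteness)]
  refine Integrable.mono' hh ?_ (Filter.Eventually.of_forall fun x => ?_)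
  · exact (by fun_prop : Measurable fun x => ‖f x‖ ^ (d : ℝ≥0∞).toReal).aestronglyMeasurable
  · rw [Real.norm_of_nonneg (by positivity)]
    simpa using hle x

theorem ind_lineDeriv {d : ℕ} {ρ : ℝ} {f f' : EuclideanSpace ℝ (Fin d) → ℝ}
    {y e : EuclideanSpace ℝ (Fin d)} (hy : y ∈ Metric.ball 0 ρ)
    (h : HasDerivAt (fun s : ℝ => f (y + s • e)) (f' y) 0) :
    HasLineDerivAt ℝ ((Metric.closedBall 0 ρ).indicator f)
      ((Metric.closedBall 0 ρ).indicator f' y) y e := by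
  unfold HasLineDerivAt
  rw [indicator_of_mem (Metric.ball_subset_closedBall hy)]
  refine h.congr_of_eventuallyEq ?_
  have hc : Continuous fun s : ℝ => y + s • e := by fun_prop
  have hm : (fun s : ℝ => y + s • e) ⁻¹' Metric.ball 0 ρ ∈ nhds (0 : ℝ) := by
    apply hc.continuousAt.preimage_mem_nhds
    apply Metric.isOpen_ball.mem_nhds
    simpa using hy
  filter_upwards [hm] with s hs
  exact indicator_of_mem (Metric.ball_subset_closedBall hs) f

theorem conv_restrict {d : ℕ} (hd : 1 ≤ d) {φ : ℕ → ContDiffBump (0 : EuclideanSpace ℝ (Fin d))}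
    (hφ : Filter.Tendsto (fun n => (φ n).rOut) Filter.atTop (nhds 0)) {r ρ : ℝ} (hrρ : r ≤ ρ)
    {f : EuclideanSpace ℝ (Fin d) → ℝ} {G : ℕ → EuclideanSpace ℝ (Fin d) → ℝ} (hf : Measurable f)
    (hw : MemLp ((Metric.closedBall 0 ρ).indicator f) d volume)
    (hG : ∀ n, ∀ x ∈ Metric.ball (0 : EuclideanSpace ℝ (Fin d)) r,
      G n x = moll (φ n) ((Metric.closedBall 0 ρ).indicator f) x) :
    Filter.Tendsto (fun n => eLpNorm (fun x => G n x - f x) d (volume.restrict (Metric.ball 0 r)))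
      Filter.atTop (nhds 0) := by
  have h1 := moll_Lp hd hφ (hf.indicator Metric.isClosed_closedBall.measurableSet) hw
  refine tendsto_of_tendsto_of_tendsto_of_le_of_le tendsto_const_nhds h1 (fun n => zero_le) ?_
  intro n
  refine le_trans (le_of_eq ?_) (eLpNorm_mono_measure _
    (Measure.restrict_le_self (s := Metric.ball (0 : EuclideanSpace ℝ (Fin d)) r)))
  apply eLpNorm_congr_ae
  filter_upwards [ae_restrict_mem Metric.isOpen_ball.measurableSet] with x hx
  rw [hG n x hx, indicator_of_mem]
  exact Metric.ball_subset_closedBall (Metric.ball_subset_ball hrρ hx)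

theorem approx {d : ℕ} (hd : 1 ≤ d) {u : EuclideanSpace ℝ (Fin d) → ℝ}
    {du : EuclideanSpace ℝ (Fin d) → EuclideanSpace ℝ (Fin d)}
    {d2u : EuclideanSpace ℝ (Fin d) → Matrix (Fin d) (Fin d) ℝ}
    (hum : Measurable u) (hdum : ∀ i, Measurable fun x => du x i)
    (hd2um : ∀ i j, Measurable fun x => d2u x i j)
    (huc : ContinuousOn u (Metric.closedBall (0 : EuclideanSpace ℝ (Fin d)) 1))
    (hdu : ∀ x ∈ Metric.ball (0 : EuclideanSpace ℝ (Fin d)) 1, ∀ i,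
          HasDerivAt (fun s : ℝ => u (x + s • EuclideanSpace.single i (1 : ℝ))) (du x i) 0)
    (hd2u : ∀ x ∈ Metric.ball (0 : EuclideanSpace ℝ (Fin d)) 1, ∀ i j,
          HasDerivAt (fun s : ℝ => du (x + s • EuclideanSpace.single j (1 : ℝ)) i) (d2u x i j) 0)
    (hIntg : ∀ G : Set (EuclideanSpace ℝ (Fin d)), IsCompact G →
          G ⊆ Metric.ball (0 : EuclideanSpace ℝ (Fin d)) 1 →
          IntegrableOn (fun x => |u x| ^ (d : ℝ) + ‖du x‖ ^ (d : ℝ) + frobNorm (d2u x) ^ (d : ℝ))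
            G volume) {r : ℝ} (hr0 : 0 < r) (hr1 : r < 1) :
    ∃ f : ℕ → EuclideanSpace ℝ (Fin d) → ℝ, (∀ n, ContDiff ℝ 2 (f n)) ∧
      (∀ ε > 0, ∀ᶠ n in Filter.atTop, ∀ x ∈ Metric.closedBall (0 : EuclideanSpace ℝ (Fin d)) r,
        |f n x - u x| ≤ ε) ∧
      Filter.Tendsto (fun n => eLpNorm (fun x => f n x - u x) d (volume.restrict (Metric.ball 0 r)))
        Filter.atTop (nhds 0) ∧
      (∀ i, Filter.Tendsto (fun n => eLpNorm (fun x => gradF (f n) x i - du x i) d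
        (volume.restrict (Metric.ball 0 r))) Filter.atTop (nhds 0)) ∧
      (∀ i j, Filter.Tendsto (fun n => eLpNorm (fun x => hmat (hessF (f n) x) i j - d2u x i j) d
        (volume.restrict (Metric.ball 0 r))) Filter.atTop (nhds 0)) ∧
      ∀ᵐ x ∂(volume.restrict (Metric.ball (0 : EuclideanSpace ℝ (Fin d)) r)), ∀ i j,
        Filter.Tendsto (fun n => hmat (hessF (f n) x) i j) Filter.atTop (nhds (d2u x i j)) := by
  obtain ⟨ρ, hrρ, hρ1⟩ := exists_between hr1
  set η := ρ - r with hη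
  have hη0 : 0 < η := by linarith
  let φ : ℕ → ContDiffBump (0 : EuclideanSpace ℝ (Fin d)) := fun n =>
    ⟨η / (n + 1) / 2, η / (n + 1), by positivity, half_lt_self (by positivity)⟩
  have hφr : ∀ n, (φ n).rOut = η / (n + 1) := fun n => rfl
  have hφη : ∀ n, (φ n).rOut ≤ η := fun n => by
    rw [hφr]; apply div_le_self hη0.le; linarith [(Nat.cast_nonneg n : (0:ℝ) ≤ n)]
  have hφ : Filter.Tendsto (fun n => (φ n).rOut) Filter.atTop (nhds 0) := by
    simp only [hφr]
    have := (tendsto_one_div_add_atTop_nhds_zero_nat (𝕜 := ℝ)).const_mul η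
    simpa [div_eq_mul_inv] using this
  set V := Metric.closedBall (0 : EuclideanSpace ℝ (Fin d)) ρ with hV
  have hVm : MeasurableSet V := Metric.isClosed_closedBall.measurableSet
  have hVi := hIntg V (isCompact_closedBall _ _) (Metric.closedBall_subset_ball hρ1)
  have hfrob0 : ∀ x, 0 ≤ frobNorm (d2u x) := fun x => Real.sqrt_nonneg _
  have hd1 : (1 : ℝ≥0∞) ≤ d := by exact_mod_cast hd
  have hu_p : MemLp (V.indicator u) d volume := by
    refine ind_memLp hd hVm hum hVi fun x => ?_
    have h1 : 0 ≤ ‖du x‖ ^ (d : ℝ) := by positivity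
    have h2 : 0 ≤ frobNorm (d2u x) ^ (d : ℝ) := Real.rpow_nonneg (hfrob0 x) _
    linarith
  have hdu_p : ∀ i, MemLp (V.indicator fun x => du x i) d volume := by
    intro i
    refine ind_memLp hd hVm (hdum i) hVi fun x => ?_
    have h1 : 0 ≤ |u x| ^ (d : ℝ) := by positivity
    have h2 : 0 ≤ frobNorm (d2u x) ^ (d : ℝ) := Real.rpow_nonneg (hfrob0 x) _
    have h3 : |du x i| ^ (d : ℝ) ≤ ‖du x‖ ^ (d : ℝ) :=
      Real.rpow_le_rpow (abs_nonneg _) (PiLp.norm_apply_le (du x) i) (by positivity)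
    linarith
  have hd2u_p : ∀ i j, MemLp (V.indicator fun x => d2u x i j) d volume := by
    intro i j
    refine ind_memLp hd hVm (hd2um i j) hVi fun x => ?_
    have h1 : 0 ≤ |u x| ^ (d : ℝ) := by positivity
    have h2 : 0 ≤ ‖du x‖ ^ (d : ℝ) := by positivity
    have h4 : |d2u x i j| ≤ frobNorm (d2u x) := by
      apply Real.abs_le_sqrt
      refine le_trans ?_ (Finset.single_le_sum (f := fun i => ∑ j, (d2u x i j) ^ 2)
        (fun i _ => by positivity) (Finset.mem_univ i))
      exact Finset.single_le_sum (f := fun j => (d2u x i j) ^ 2)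
        (fun i _ => by positivity) (Finset.mem_univ j)
    have h3 : |d2u x i j| ^ (d : ℝ) ≤ frobNorm (d2u x) ^ (d : ℝ) :=
      Real.rpow_le_rpow (abs_nonneg _) h4 (by positivity)
    linarith
  have hu_l := hu_p.locallyIntegrable hd1
  have hdu_l := fun i => (hdu_p i).locallyIntegrable hd1
  have hd2u_l := fun i j => (hd2u_p i j).locallyIntegrable hd1
  have hin : ∀ n, ∀ x ∈ Metric.ball (0 : EuclideanSpace ℝ (Fin d)) r,
      ∀ y ∈ Metric.closedBall x (φ n).rOut, y ∈ Metric.ball (0 : EuclideanSpace ℝ (Fin d)) ρ := by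
    intro n x hx y hy
    rw [mem_ball_zero_iff] at hx ⊢
    rw [mem_closedBall_iff_norm] at hy
    have h1 := norm_le_insert' y x
    have h2 := hφη n
    linarith
  have hsub1 : Metric.ball (0 : EuclideanSpace ℝ (Fin d)) ρ ⊆ Metric.ball 0 1 :=
    Metric.ball_subset_ball hρ1.le
  set f : ℕ → EuclideanSpace ℝ (Fin d) → ℝ := fun n => moll (φ n) (V.indicator u) with hf
  have hfC : ∀ n, ContDiff ℝ 2 (f n) := fun n => moll_contDiff (φ n) hu_l
  have hgr : ∀ i n, ∀ x ∈ Metric.ball (0 : EuclideanSpace ℝ (Fin d)) r,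
      gradF (f n) x i = moll (φ n) (V.indicator fun x => du x i) x := by
    intro i n x hx
    rw [gradF_coord]
    exact moll_deriv (φ n) hu_l (hdu_l i) x _ fun y hy =>
      ind_lineDeriv (f' := fun x => du x i) (hin n x hx y hy) (hdu y (hsub1 (hin n x hx y hy)) i)
  have hhe : ∀ i j n, ∀ x ∈ Metric.ball (0 : EuclideanSpace ℝ (Fin d)) r,
      hmat (hessF (f n) x) i j = moll (φ n) (V.indicator fun x => d2u x i j) x := by
    intro i j n x hx
    rw [hessF_coord (hfC n)]
    have he : (fun y => gradF (f n) y i) =ᶠ[nhds x] moll (φ n) (V.indicator fun x => du x i) := by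
      filter_upwards [Metric.isOpen_ball.mem_nhds hx] with y hy using hgr i n y hy
    rw [he.fderiv_eq]
    exact moll_deriv (φ n) (hdu_l i) (hd2u_l i j) x _ fun y hy =>
      ind_lineDeriv (f := fun x => du x i) (f' := fun x => d2u x i j) (hin n x hx y hy)
        (hd2u y (hsub1 (hin n x hx y hy)) i j)
  refine ⟨f, hfC, ?_, conv_restrict hd hφ hrρ.le hum hu_p fun n x _ => rfl,
    fun i => conv_restrict hd hφ hrρ.le (hdum i) (hdu_p i) (hgr i),
    fun i j => conv_restrict hd hφ hrρ.le (hd2um i j) (hd2u_p i j) (hhe i j), ?_⟩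
  · intro ε hε
    have huc' := (isCompact_closedBall (0 : EuclideanSpace ℝ (Fin d)) 1).uniformContinuousOn_of_continuous huc
    rw [Metric.uniformContinuousOn_iff] at huc'
    obtain ⟨κ, hκ, huc'⟩ := huc' ε hε
    filter_upwards [hφ.eventually (gt_mem_nhds hκ)] with n hn x hx
    have hxV : x ∈ V := Metric.closedBall_subset_closedBall hrρ.le hx
    have hd := ContDiffBump.dist_normed_convolution_le (φ := φ n) (μ := volume) (g := V.indicator u)
      (x₀ := x) (ε := ε) hu_l.aestronglyMeasurable ?_
    · rw [Real.dist_eq, indicator_of_mem hxV] at hd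
      exact hd
    · intro y hy
      have hyV : y ∈ V := by
        rw [mem_closedBall_zero_iff] at hx ⊢
        rw [mem_ball_iff_norm] at hy
        have h1 := norm_le_insert' y x
        have h2 := hφη n
        linarith
      rw [indicator_of_mem hxV, indicator_of_mem hyV]
      have hV1 : V ⊆ Metric.closedBall 0 1 := Metric.closedBall_subset_closedBall hρ1.le
      exact (huc' y (hV1 hyV) x (hV1 hxV) (lt_trans (Metric.mem_ball.1 hy) hn)).le
  · have hae : ∀ i j, ∀ᵐ x ∂(volume.restrict (Metric.ball (0 : EuclideanSpace ℝ (Fin d)) r)),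
        Filter.Tendsto (fun n => hmat (hessF (f n) x) i j) Filter.atTop (nhds (d2u x i j)) := by
      intro i j
      have h := ContDiffBump.ae_convolution_tendsto_right_of_locallyIntegrable (K := 2) hφ
        (Filter.Eventually.of_forall fun n => by
          change η / (n + 1) ≤ 2 * (η / (n + 1) / 2); linarith) (hd2u_l i j)
      filter_upwards [ae_restrict_of_ae h, ae_restrict_mem Metric.isOpen_ball.measurableSet] with x hx hxr
      have hxV : x ∈ V := Metric.ball_subset_closedBall (Metric.ball_subset_ball hrρ.le hxr)
      rw [indicator_of_mem hxV] at hx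
      refine hx.congr fun n => ?_
      rw [hhe i j n x hxr]
      rfl
    filter_upwards [ae_all_iff.2 fun i => ae_all_iff.2 (hae i)] with x hx i j using hx i j

/-- Sequences tending to zero in `L_d`. -/
def ZSeq {α : Type*} [MeasurableSpace α] (d : ℕ) (ν : Measure α) (h : ℕ → α → ℝ) : Prop :=
  (∀ n, Measurable (h n)) ∧
    Filter.Tendsto (fun n => eLpNorm (h n) d ν) Filter.atTop (nhds 0)

theorem ZSeq.add {α : Type*} [MeasurableSpace α] {d : ℕ} (hd : 1 ≤ d) {ν : Measure α}
    {h k : ℕ → α → ℝ} (hh : ZSeq d ν h) (hk : ZSeq d ν k) :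
    ZSeq d ν (fun n x => h n x + k n x) := by
  refine ⟨fun n => (hh.1 n).add (hk.1 n), ?_⟩
  have h1 := hh.2.add hk.2
  rw [add_zero] at h1
  refine tendsto_of_tendsto_of_tendsto_of_le_of_le tendsto_const_nhds h1 (fun n => zero_le) ?_
  intro n
  exact eLpNorm_add_le (hh.1 n).aestronglyMeasurable (hk.1 n).aestronglyMeasurable
    (by exact_mod_cast hd)

theorem ZSeq.mul {α : Type*} [MeasurableSpace α] {d : ℕ} {ν : Measure α}
    {h : ℕ → α → ℝ} (hh : ZSeq d ν h) {m : α → ℝ} (hm : Measurable m) {C : ℝ}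
    (hC : ∀ x, |m x| ≤ C) : ZSeq d ν (fun n x => m x * h n x) := by
  refine ⟨fun n => hm.mul (hh.1 n), ?_⟩
  have h1 := ENNReal.Tendsto.const_mul (a := ENNReal.ofReal C) hh.2 (Or.inr ENNReal.ofReal_ne_top)
  rw [mul_zero] at h1
  refine tendsto_of_tendsto_of_tendsto_of_le_of_le tendsto_const_nhds h1 (fun n => zero_le) ?_
  intro n
  refine eLpNorm_le_mul_eLpNorm_of_ae_le_mul (Filter.Eventually.of_forall fun x => ?_) _
  rw [norm_mul]
  exact mul_le_mul_of_nonneg_right (hC x) (norm_nonneg _)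

theorem ZSeq.sum {α : Type*} [MeasurableSpace α] {d : ℕ} (hd : 1 ≤ d) {ν : Measure α}
    {ι : Type*} (s : Finset ι) {h : ι → ℕ → α → ℝ} (hh : ∀ i, ZSeq d ν (h i)) :
    ZSeq d ν (fun n x => ∑ i ∈ s, h i n x) := by
  classical
  induction s using Finset.induction_on with
  | empty => simp [ZSeq]
  | insert i s hi ih =>
    simp only [Finset.sum_insert hi]
    exact (hh i).add hd ih

theorem frob_tendsto {d : ℕ} {A : ℕ → Matrix (Fin d) (Fin d) ℝ} {B : Matrix (Fin d) (Fin d) ℝ}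
    (h : ∀ i j, Filter.Tendsto (fun n => A n i j) Filter.atTop (nhds (B i j))) :
    Filter.Tendsto (fun n => frobNorm (A n)) Filter.atTop (nhds (frobNorm B)) := by
  unfold frobNorm
  exact (tendsto_finsetSum _ fun i _ => tendsto_finsetSum _ fun j _ => (h i j).pow 2).sqrt

set_option maxHeartbeats 1000000 in
theorem est_r (d : ℕ) (hd : 1 ≤ d) (δ K : ℝ) (hδ : 0 < δ) (hK : 0 ≤ K) :
    ∃ γ N : ℝ, 0 < γ ∧ γ ≤ 1 ∧ 0 < N ∧
      ∀ r, 1 / 2 ≤ r → r < 1 →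
      ∀ (a : EuclideanSpace ℝ (Fin d) → Matrix (Fin d) (Fin d) ℝ)
        (b : EuclideanSpace ℝ (Fin d) → EuclideanSpace ℝ (Fin d))
        (c : EuclideanSpace ℝ (Fin d) → ℝ)
        (u : EuclideanSpace ℝ (Fin d) → ℝ)
        (du : EuclideanSpace ℝ (Fin d) → EuclideanSpace ℝ (Fin d))
        (d2u : EuclideanSpace ℝ (Fin d) → Matrix (Fin d) (Fin d) ℝ) (S' S F : ℝ),
        (∀ i j, Measurable fun x => a x i j) →
        (∀ i, Measurable fun x => b x i) →
        Measurable c →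
        (∀ x, EllMat δ (a x)) →
        (∀ x, ‖b x‖ + c x ≤ K) →
        (∀ x, 0 ≤ c x) →
        Measurable u →
        (∀ i, Measurable fun x => du x i) →
        (∀ i j, Measurable fun x => d2u x i j) →
        ContinuousOn u (Metric.closedBall (0 : EuclideanSpace ℝ (Fin d)) 1) →
        (∀ x ∈ Metric.ball (0 : EuclideanSpace ℝ (Fin d)) 1, ∀ i,
          HasDerivAt (fun s : ℝ => u (x + s • EuclideanSpace.single i (1 : ℝ))) (du x i) 0) →
        (∀ x ∈ Metric.ball (0 : EuclideanSpace ℝ (Fin d)) 1, ∀ i j,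
          HasDerivAt (fun s : ℝ => du (x + s • EuclideanSpace.single j (1 : ℝ)) i) (d2u x i j) 0) →
        (∀ G : Set (EuclideanSpace ℝ (Fin d)), IsCompact G →
          G ⊆ Metric.ball (0 : EuclideanSpace ℝ (Fin d)) 1 →
          IntegrableOn (fun x => |u x| ^ (d : ℝ) + ‖du x‖ ^ (d : ℝ) + frobNorm (d2u x) ^ (d : ℝ))
            G volume) →
        0 ≤ S' → S' < S → (∀ x ∈ Metric.sphere (0 : EuclideanSpace ℝ (Fin d)) r, |u x| ≤ S') →
        0 < F →
        eLpNorm (fun x => (∑ i, ∑ j, a x i j * d2u x i j) + (∑ i, b x i * du x i) - c x * u x) d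
          (volume.restrict (Metric.ball (0 : EuclideanSpace ℝ (Fin d)) r)) < ENNReal.ofReal F →
        (∫⁻ x in Metric.ball (0 : EuclideanSpace ℝ (Fin d)) r,
            ENNReal.ofReal (frobNorm (d2u x)) ^ γ ∂volume) ≤ ENNReal.ofReal (N * (S + F) ^ γ) := by
  obtain ⟨γ, N, hγ0, hγ1, hN, hest⟩ := smooth_est d hd δ K hδ hK
  refine ⟨γ, N, hγ0, hγ1, hN, ?_⟩
  intro r hr hr1 a b c u du d2u S' S F ham hbm hcm ha hbc hc0 hum hdum hd2um huc hdu hd2u hIntg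
    hS'0 hS'S huS hF hLF
  obtain ⟨f, hf, hfu, hf0, hf1, hf2, hfae⟩ :=
    approx hd hum hdum hd2um huc hdu hd2u hIntg (by linarith : 0 < r) hr1
  set ν := volume.restrict (Metric.ball (0 : EuclideanSpace ℝ (Fin d)) r) with hν
  have hC2 := fun n => c2Data_of_contDiff (hf n)
  have hfm : ∀ n, Measurable (f n) := fun n => (hf n).continuous.measurable
  have hgm : ∀ n i, Measurable fun x => gradF (f n) x i := by
    intro n i
    have h1 : Continuous (gradF (f n)) :=
      continuous_iff_continuousAt.2 fun x => ((hC2 n).hg x).continuousAt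
    exact (by fun_prop : Measurable fun x : EuclideanSpace ℝ (Fin d) => x i).comp h1.measurable
  have hHm : ∀ n i j, Measurable fun x => hmat (hessF (f n) x) i j := fun n i j =>
    measurable_hmat (hC2 n) i j
  have hab : ∀ i j x, |a x i j| ≤ d * δ⁻¹ := by
    intro i j x
    have hp : (a x).PosSemidef := posSemidef_of_quad (ha x).1 fun ξ =>
      le_trans (by positivity) ((ha x).2 ξ).1
    exact (entry_le_trace hp i j).trans (ell_trace_diag (ha x))
  have hbb : ∀ i x, |b x i| ≤ K := by
    intro i x
    have := PiLp.norm_apply_le (b x) i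
    rw [Real.norm_eq_abs] at this
    linarith [hbc x, hc0 x]
  have hcb : ∀ x, |-c x| ≤ K := by
    intro x
    rw [abs_neg, abs_of_nonneg (hc0 x)]
    linarith [hbc x, norm_nonneg (b x)]
  have z0 : ZSeq d ν (fun n x => f n x - u x) := ⟨fun n => (hfm n).sub hum, hf0⟩
  have z1 : ∀ i, ZSeq d ν (fun n x => gradF (f n) x i - du x i) := fun i =>
    ⟨fun n => (hgm n i).sub (hdum i), hf1 i⟩
  have z2 : ∀ i j, ZSeq d ν (fun n x => hmat (hessF (f n) x) i j - d2u x i j) := fun i j =>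
    ⟨fun n => (hHm n i j).sub (hd2um i j), hf2 i j⟩
  have zL := ((ZSeq.sum hd Finset.univ fun i => ZSeq.sum hd Finset.univ fun j =>
    (z2 i j).mul (ham i j) (hab i j)).add hd
      (ZSeq.sum hd Finset.univ fun i => (z1 i).mul (hbm i) (hbb i))).add hd
        (z0.mul hcm.neg hcb)
  set Lu : EuclideanSpace ℝ (Fin d) → ℝ := fun x =>
    (∑ i, ∑ j, a x i j * d2u x i j) + (∑ i, b x i * du x i) - c x * u x with hLu
  have hLum : Measurable Lu := by
    exact ((Finset.measurable_sum _ fun i _ => Finset.measurable_sum _ fun j _ =>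
      (ham i j).mul (hd2um i j)).add (Finset.measurable_sum _ fun i _ =>
        (hbm i).mul (hdum i))).sub (hcm.mul hum)
  have hev : ∀ᶠ n in Filter.atTop, eLpNorm (fun x =>
      (∑ i, ∑ j, a x i j * hmat (hessF (f n) x) i j) + (∑ i, b x i * gradF (f n) x i)
        - c x * f n x) d ν ≤ ENNReal.ofReal F := by
    have h1 := zL.2.const_add (eLpNorm Lu d ν)
    rw [add_zero] at h1
    filter_upwards [h1.eventually_lt_const hLF] with n hn
    refine le_trans ?_ hn.le
    refine le_trans (le_of_eq ?_) (eLpNorm_add_le hLum.aestronglyMeasurable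
      (zL.1 n).aestronglyMeasurable (by exact_mod_cast hd))
    congr 1
    funext x
    simp only [hLu, Pi.add_apply, Pi.neg_apply, mul_sub, Finset.sum_sub_distrib]
    ring
  have hevS : ∀ᶠ n in Filter.atTop, ∀ x ∈ Metric.sphere (0 : EuclideanSpace ℝ (Fin d)) r,
      |f n x| ≤ S := by
    filter_upwards [hfu (S - S') (by linarith)] with n hn x hx
    have h1 := hn x (Metric.sphere_subset_closedBall hx)
    have h2 := huS x hx
    have h3 := abs_add_le (f n x - u x) (u x)
    rw [sub_add_cancel] at h3
    linarith
  have hevI : ∀ᶠ n in Filter.atTop, ∫⁻ x, ENNReal.ofReal (frobNorm (hmat (hessF (f n) x))) ^ γ ∂ν ≤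
      ENNReal.ofReal (N * (S + F) ^ γ) := by
    filter_upwards [hev, hevS] with n h1 h2
    refine hest r hr hr1.le (f n) (gradF (f n)) (hessF (f n)) a b c S F (hC2 n) ha ham hbm hcm hbc
      hc0 (by linarith) hF h2 ?_
    have h3 := pow_le_pow_left' h1 d
    rw [eLpNorm_pow hd, ← ENNReal.ofReal_pow hF.le] at h3
    simpa only [Real.enorm_eq_ofReal_abs] using h3
  have hfatou := lintegral_liminf_le (μ := ν) (u := Filter.atTop)
    (f := fun n x => ENNReal.ofReal (frobNorm (hmat (hessF (f n) x))) ^ γ)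
    (fun n => ((measurable_frob (hHm n)).ennreal_ofReal).pow_const γ)
  have heq : ∫⁻ x, ENNReal.ofReal (frobNorm (d2u x)) ^ γ ∂ν = ∫⁻ x, Filter.liminf
      (fun n => ENNReal.ofReal (frobNorm (hmat (hessF (f n) x))) ^ γ) Filter.atTop ∂ν := by
    apply lintegral_congr_ae
    filter_upwards [hfae] with x hx
    have h1 := frob_tendsto (A := fun n => hmat (hessF (f n) x)) hx
    have h2 := (ENNReal.continuous_rpow_const (y := γ)).continuousAt.tendsto.comp
      (ENNReal.tendsto_ofReal h1)
    exact h2.liminf_eq.symm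
  rw [heq]
  refine hfatou.trans ?_
  exact Filter.liminf_le_of_frequently_le' hevI.frequently

theorem lint_ball_le {d : ℕ} {f : EuclideanSpace ℝ (Fin d) → ℝ≥0∞} {C : ℝ≥0∞} {r0 : ℝ}
    (hr0 : r0 < 1)
    (h : ∀ r, r0 < r → r < 1 → ∫⁻ x in Metric.ball (0 : EuclideanSpace ℝ (Fin d)) r, f x ≤ C) :
    ∫⁻ x in Metric.ball (0 : EuclideanSpace ℝ (Fin d)) 1, f x ≤ C := by
  set ρ : ℕ → ℝ := fun k => 1 - (1 - r0) / ((k : ℝ) + 2) with hρ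
  have hk0 : ∀ k : ℕ, (0 : ℝ) < (k : ℝ) + 2 := fun k => by positivity
  have hρ1 : ∀ k, ρ k < 1 := fun k => by
    have : 0 < (1 - r0) / ((k : ℝ) + 2) := div_pos (by linarith) (hk0 k)
    simp only [hρ]; linarith
  have hρ0 : ∀ k, r0 < ρ k := fun k => by
    have : (1 - r0) / ((k : ℝ) + 2) < 1 - r0 :=
      div_lt_self (by linarith) (by linarith [(Nat.cast_nonneg k : (0:ℝ) ≤ k)])
    simp only [hρ]; linarith
  have hmono : Monotone ρ := by
    intro k l hkl
    have hkl' : (k : ℝ) ≤ l := by exact_mod_cast hkl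
    have : (1 - r0) / ((l : ℝ) + 2) ≤ (1 - r0) / ((k : ℝ) + 2) :=
      div_le_div_of_nonneg_left (by linarith) (hk0 k) (by linarith)
    simp only [hρ]; linarith
  have hlim : Filter.Tendsto ρ Filter.atTop (nhds 1) := by
    have h1 : Filter.Tendsto (fun k : ℕ => (k : ℝ) + 2) Filter.atTop Filter.atTop :=
      Filter.tendsto_atTop_add_const_right _ _ tendsto_natCast_atTop_atTop
    have h2 := (h1.const_div_atTop (1 - r0)).const_sub 1
    rwa [sub_zero] at h2
  have hU : Metric.ball (0 : EuclideanSpace ℝ (Fin d)) 1 = ⋃ k, Metric.ball 0 (ρ k) := by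
    ext x
    simp only [mem_iUnion, Metric.mem_ball]
    constructor
    · intro hx
      exact (hlim.eventually_const_lt hx).exists
    · rintro ⟨k, hk⟩
      exact hk.trans (hρ1 k)
  rw [hU, setLIntegral_iUnion_of_directed _
    (directed_of_isDirected_le fun k l hkl => Metric.ball_subset_ball (hmono hkl))]
  exact iSup_le fun k => h _ (hρ0 k) (hρ1 k)

theorem sup_facts {d : ℕ} {u : EuclideanSpace ℝ (Fin d) → ℝ}
    (huc : ContinuousOn u (Metric.closedBall (0 : EuclideanSpace ℝ (Fin d)) 1)) :
    0 ≤ (⨆ x ∈ Metric.sphere (0 : EuclideanSpace ℝ (Fin d)) 1, |u x|) ∧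
    ∀ y ∈ Metric.sphere (0 : EuclideanSpace ℝ (Fin d)) 1,
      |u y| ≤ ⨆ x ∈ Metric.sphere (0 : EuclideanSpace ℝ (Fin d)) 1, |u x| := by
  constructor
  · exact Real.iSup_nonneg fun x => Real.iSup_nonneg fun _ => abs_nonneg _
  obtain ⟨B, hB⟩ := (isCompact_closedBall (0 : EuclideanSpace ℝ (Fin d)) 1).exists_bound_of_continuousOn huc
  intro y hy
  have hbdd : BddAbove (range fun x : EuclideanSpace ℝ (Fin d) =>
      ⨆ (_ : x ∈ Metric.sphere (0 : EuclideanSpace ℝ (Fin d)) 1), |u x|) := by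
    refine ⟨max B 0, ?_⟩
    rintro _ ⟨x, rfl⟩
    refine Real.iSup_le (fun hx => ?_) (le_max_right _ _)
    exact (hB x (Metric.sphere_subset_closedBall hx)).trans (le_max_left _ _)
  refine le_trans (le_of_eq ?_) (le_ciSup hbdd y)
  simp only [hy, ciSup_unique]

theorem sup_near {d : ℕ} {u : EuclideanSpace ℝ (Fin d) → ℝ}
    (huc : ContinuousOn u (Metric.closedBall (0 : EuclideanSpace ℝ (Fin d)) 1)) {M : ℝ}
    (hM : ∀ y ∈ Metric.sphere (0 : EuclideanSpace ℝ (Fin d)) 1, |u y| ≤ M) {ε : ℝ} (hε : 0 < ε) :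
    ∃ r0, 1 / 2 ≤ r0 ∧ r0 < 1 ∧ ∀ r, r0 < r → r < 1 →
      ∀ x ∈ Metric.sphere (0 : EuclideanSpace ℝ (Fin d)) r, |u x| ≤ M + ε := by
  have h1 := (isCompact_closedBall (0 : EuclideanSpace ℝ (Fin d)) 1).uniformContinuousOn_of_continuous huc
  obtain ⟨η, hη, h2⟩ := Metric.uniformContinuousOn_iff.1 h1 ε hε
  refine ⟨max (1 / 2) (1 - η), le_max_left _ _, max_lt (by norm_num) (by linarith), ?_⟩
  intro r hr hr1 x hx
  have hr2 : 1 / 2 < r := (le_max_left _ _).trans_lt hr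
  have hr3 : 1 - η < r := (le_max_right _ _).trans_lt hr
  have hxn : ‖x‖ = r := by simpa using hx
  have hr0 : 0 < r := by linarith
  have hyn : ‖r⁻¹ • x‖ = 1 := by
    rw [norm_smul, hxn, Real.norm_of_nonneg (by positivity), inv_mul_cancel₀ hr0.ne']
  have hd : dist x (r⁻¹ • x) < η := by
    have : x - r⁻¹ • x = (1 - r⁻¹) • x := by rw [sub_smul, one_smul]
    rw [dist_eq_norm, this, norm_smul, hxn, Real.norm_eq_abs, abs_of_nonpos, neg_mul, sub_mul,
      inv_mul_cancel₀ hr0.ne']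
    · linarith
    · have := one_le_inv_iff₀.2 ⟨hr0, hr1.le⟩
      linarith
  have h3 := h2 x (by simp [hxn, hr1.le]) (r⁻¹ • x) (by rw [mem_closedBall_zero_iff, hyn]) hd
  have h4 := hM (r⁻¹ • x) (by rw [mem_sphere_zero_iff_norm, hyn])
  rw [Real.dist_eq] at h3
  have h5 := abs_add_le (u x - u (r⁻¹ • x)) (u (r⁻¹ • x))
  rw [sub_add_cancel] at h5
  linarith

/-- **Theorem 1.8.** There are constants `γ ∈ (0,1]` and `N`, depending only on `δ`, `K`, `d`,
such that for any `L ∈ 𝔏_{δ,K}` with coefficients independent of `t`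
(`Lu = aⁱʲD_{ij}u + bⁱDᵢu - cu`) and any `u ∈ W²_{d,loc}(B₁) ∩ C(B̄₁)` one has
`∫_{B₁} |D²u|^γ ≤ N (∫_{B₁} |Lu|^d)^{γ/d} + N sup_{∂B₁} |u|^γ`. -/
theorem elliptic_second_derivative_estimate
    (d : ℕ) (hd : 1 ≤ d) (δ K : ℝ) (hδ0 : 0 < δ) (hδ1 : δ < 1) (hK : 0 ≤ K) :
    ∃ γ N : ℝ, γ ∈ Set.Ioc (0 : ℝ) 1 ∧ 0 < N ∧
      ∀ (a : EuclideanSpace ℝ (Fin d) → Matrix (Fin d) (Fin d) ℝ)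
        (b : EuclideanSpace ℝ (Fin d) → EuclideanSpace ℝ (Fin d))
        (c : EuclideanSpace ℝ (Fin d) → ℝ)
        (u : EuclideanSpace ℝ (Fin d) → ℝ)
        (du : EuclideanSpace ℝ (Fin d) → EuclideanSpace ℝ (Fin d))
        (d2u : EuclideanSpace ℝ (Fin d) → Matrix (Fin d) (Fin d) ℝ),
        -- measurability of the coefficients of `L ∈ 𝔏_{δ,K}`
        (∀ i j, Measurable fun x => a x i j) →
        (∀ i, Measurable fun x => b x i) →
        Measurable c →
        -- `a` is `S_δ`-valued
        (∀ x, (a x).IsSymm) →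
        (∀ x (ξ : EuclideanSpace ℝ (Fin d)),
          δ * ‖ξ‖ ^ 2 ≤ ∑ i, ∑ j, a x i j * ξ i * ξ j ∧
          ∑ i, ∑ j, a x i j * ξ i * ξ j ≤ δ⁻¹ * ‖ξ‖ ^ 2) →
        -- `|b| + c ≤ K`, `c ≥ 0`
        (∀ x, ‖b x‖ + c x ≤ K) →
        (∀ x, 0 ≤ c x) →
        -- measurability
        Measurable u →
        (∀ i, Measurable fun x => du x i) →
        (∀ i j, Measurable fun x => d2u x i j) →
        -- `u ∈ C(B̄₁)`
        ContinuousOn u (Metric.closedBall (0 : EuclideanSpace ℝ (Fin d)) 1) →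
        -- `du = Du`, `d2u = D²u` pointwise in `B₁`
        (∀ x ∈ Metric.ball (0 : EuclideanSpace ℝ (Fin d)) 1, ∀ i,
          HasDerivAt (fun s : ℝ => u (x + s • EuclideanSpace.single i (1 : ℝ))) (du x i) 0) →
        (∀ x ∈ Metric.ball (0 : EuclideanSpace ℝ (Fin d)) 1, ∀ i j,
          HasDerivAt (fun s : ℝ => du (x + s • EuclideanSpace.single j (1 : ℝ)) i) (d2u x i j) 0) →
        -- `u ∈ W²_{d,loc}(B₁)`
        (∀ G : Set (EuclideanSpace ℝ (Fin d)), IsCompact G →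
          G ⊆ Metric.ball (0 : EuclideanSpace ℝ (Fin d)) 1 →
          IntegrableOn (fun x => |u x| ^ (d : ℝ) + ‖du x‖ ^ (d : ℝ) + frobNorm (d2u x) ^ (d : ℝ))
            G volume) →
        (∫⁻ x in Metric.ball (0 : EuclideanSpace ℝ (Fin d)) 1,
            ENNReal.ofReal (frobNorm (d2u x)) ^ γ ∂volume)
          ≤ ENNReal.ofReal N *
              (∫⁻ x in Metric.ball (0 : EuclideanSpace ℝ (Fin d)) 1,
                ENNReal.ofReal
                  |(∑ i, ∑ j, a x i j * d2u x i j) + (∑ i, b x i * du x i) - c x * u x|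
                  ^ (d : ℝ) ∂volume) ^ (γ / (d : ℝ))
            + ENNReal.ofReal N *
              ENNReal.ofReal
                ((⨆ x ∈ Metric.sphere (0 : EuclideanSpace ℝ (Fin d)) 1, |u x|) ^ γ) := by
  obtain ⟨γ, N, hγ0, hγ1, hN, hest⟩ := est_r d hd δ K hδ0 hK
  refine ⟨γ, N, ⟨hγ0, hγ1⟩, hN, ?_⟩
  intro a b c u du d2u ham hbm hcm has hae hbc hc0 hum hdum hd2um huc hdu hd2u hIntg
  obtain ⟨hM0, hM⟩ := sup_facts huc
  set M := ⨆ x ∈ Metric.sphere (0 : EuclideanSpace ℝ (Fin d)) 1, |u x| with hMdef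
  set Lu : EuclideanSpace ℝ (Fin d) → ℝ := fun x =>
    (∑ i, ∑ j, a x i j * d2u x i j) + (∑ i, b x i * du x i) - c x * u x with hLu
  have hd0 : (0 : ℝ) < d := by exact_mod_cast hd
  set I := ∫⁻ x in Metric.ball (0 : EuclideanSpace ℝ (Fin d)) 1,
    ENNReal.ofReal |Lu x| ^ (d : ℝ) ∂volume with hI
  by_cases hIt : I = ⊤
  · rw [hIt, ENNReal.top_rpow_of_pos (div_pos hγ0 hd0), ENNReal.mul_top (by simpa using hN), top_add]
    exact le_top
  have hnorm : eLpNorm Lu d (volume.restrict (Metric.ball (0 : EuclideanSpace ℝ (Fin d)) 1)) =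
      I ^ (1 / (d : ℝ)) := by
    rw [eLpNorm_eq_lintegral_rpow_enorm_toReal (by simp; omega) (by simp)]
    simp only [ENNReal.toReal_natCast, Real.enorm_eq_ofReal_abs, hI]
  have hfin : I ^ (1 / (d : ℝ)) ≠ ⊤ := ENNReal.rpow_ne_top_of_nonneg (by positivity) hIt
  set A := (I ^ (1 / (d : ℝ))).toReal with hA
  have hA0 : 0 ≤ A := ENNReal.toReal_nonneg
  have hAe : I ^ (1 / (d : ℝ)) = ENNReal.ofReal A := (ENNReal.ofReal_toReal hfin).symm
  have key : ∀ ε > 0, (∫⁻ x in Metric.ball (0 : EuclideanSpace ℝ (Fin d)) 1,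
      ENNReal.ofReal (frobNorm (d2u x)) ^ γ ∂volume) ≤
      ENNReal.ofReal (N * ((M + 2 * ε) + (A + ε)) ^ γ) := by
    intro ε hε
    obtain ⟨r0, hr0, hr01, hsup⟩ := sup_near huc hM hε
    refine lint_ball_le hr01 fun r hr hr1 => ?_
    refine hest r (by linarith) hr1 a b c u du d2u (M + ε) (M + 2 * ε) (A + ε) ham hbm hcm
      (fun x => ⟨has x, hae x⟩) hbc hc0 hum hdum hd2um huc hdu hd2u hIntg (by linarith) (by linarith)
      (hsup r hr hr1) (by linarith) ?_
    refine lt_of_le_of_lt (eLpNorm_mono_measure _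
      (Measure.restrict_mono (Metric.ball_subset_ball hr1.le) le_rfl)) ?_
    refine lt_of_eq_of_lt (hnorm.trans hAe) ?_
    exact (ENNReal.ofReal_lt_ofReal_iff (by linarith)).2 (by linarith)
  have hlim : Filter.Tendsto (fun ε : ℝ => ENNReal.ofReal (N * ((M + 2 * ε) + (A + ε)) ^ γ))
      (nhdsWithin 0 (Ioi 0)) (nhds (ENNReal.ofReal (N * (M + A) ^ γ))) := by
    have hc : Continuous fun ε : ℝ => ENNReal.ofReal (N * ((M + 2 * ε) + (A + ε)) ^ γ) := by
      refine ENNReal.continuous_ofReal.comp (continuous_const.mul ?_)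
      exact (by fun_prop : Continuous fun ε : ℝ => (M + 2 * ε) + (A + ε)).rpow_const
        fun _ => Or.inr hγ0.le
    have := (hc.tendsto 0).mono_left (nhdsWithin_le_nhds (s := Ioi 0))
    simpa using this
  have hfinal := ge_of_tendsto hlim (Filter.eventually_of_mem self_mem_nhdsWithin key)
  refine hfinal.trans ?_
  have h1 : I ^ (γ / (d : ℝ)) = ENNReal.ofReal A ^ γ := by
    rw [← hAe, ← ENNReal.rpow_mul]
    congr 1
    ring
  rw [h1, ENNReal.ofReal_mul hN.le, ← mul_add, ← ENNReal.ofReal_rpow_of_nonneg (by linarith) hγ0.le,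
    ← ENNReal.ofReal_rpow_of_nonneg hM0 hγ0.le, ENNReal.ofReal_add hM0 hA0, add_comm]
  refine mul_le_mul_right ?_ _
  rw [add_comm]
  refine (ENNReal.rpow_add_le_add_rpow _ _ hγ0.le hγ1).trans (le_of_eq ?_)
  first | rfl | exact add_comm _ _
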